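/- arXiv:1205.4994 — 2 statements merged into one kernel-verified Lean document; each statement's English description precedes it below -/
import Mathlib

section
/- Let n be any positive integer and let m ≥ 3. If v = 4^n, or v = 2p^n + 2 with p ∈ {7, 31, 127}, then C((m−1)v, 6, 3, m) ≤ v²(v−1)(m−1)/24. -/
/-- `(X, Bs)` is a `(|X|, k, t, m)` cover: `Bs` is a collection of `k`-subsets of `X` such that
every `m`-subset of `X` intersects at least one block of `Bs` in at least `t` points. -/
def IsCover {α : Type*} [DecidableEq α] (X : Finset α) (Bs : Finset (Finset α))
    (k t m : ℕ) : Prop :=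
  (∀ B ∈ Bs, B ⊆ X ∧ B.card = k) ∧
  ∀ M ⊆ X, M.card = m → ∃ B ∈ Bs, t ≤ (M ∩ B).card

/-- The cover number `C(v,k,t,m)`: the minimum number of blocks of a `(v,k,t,m)` cover.
The covering number `C(v,k,t)` is `C(v,k,t,t)`. -/
noncomputable def coverNumber (v k t m : ℕ) : ℕ :=
  sInf { b | ∃ Bs : Finset (Finset (Fin v)),
    IsCover Finset.univ Bs k t m ∧ Bs.card = b }


open Finset in
theorem coverNumber_card_le {Z : Type*} [Fintype Z] [DecidableEq Z] {k t m b : ℕ}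
    (Bs : Finset (Finset Z)) (h : IsCover Finset.univ Bs k t m) (hb : Bs.card ≤ b) :
    coverNumber (Fintype.card Z) k t m ≤ b := by
  classical
  let e := Fintype.equivFin Z
  refine le_trans (Nat.sInf_le ⟨Bs.map (Finset.mapEmbedding e.toEmbedding).toEmbedding, ⟨?_, ?_⟩,
    rfl⟩) ((Finset.card_map _).trans_le hb)
  · intro B hB
    obtain ⟨B', hB', rfl⟩ := Finset.mem_map.1 hB
    exact ⟨Finset.subset_univ _, (Finset.card_map _).trans (h.1 B' hB').2⟩
  · intro M _ hM
    obtain ⟨B, hB, hc⟩ := h.2 (M.map e.symm.toEmbedding) (Finset.subset_univ _)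
      ((Finset.card_map _).trans hM)
    refine ⟨B.map e.toEmbedding, Finset.mem_map.2 ⟨B, hB, rfl⟩, hc.trans ?_⟩
    rw [← Finset.card_map e.toEmbedding, Finset.map_inter, Finset.map_map]
    simp

/-- The fibres of a set with more points than groups: under a permutation of the groups, some
group contains three points, or two points with a further point in the next group. -/
theorem exists_three_le_or_two_le {I : Type*} [Fintype I] (σ : Equiv.Perm I) (f : I → ℕ)
    (hf : Fintype.card I < ∑ i, f i) : ∃ i, 3 ≤ f i ∨ (2 ≤ f i ∧ 1 ≤ f (σ i)) := by
  by_contra! hcon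
  let g : I → ℤ := fun i => if f i = 0 then 1 else 0
  have hle : ∀ i, (f i : ℤ) ≤ 1 + g (σ i) - g i := by
    intro i
    obtain ⟨h1, h2⟩ := hcon i
    simp only [g]
    split_ifs <;> omega
  have hsum := Finset.sum_le_sum fun i (_ : i ∈ Finset.univ) => hle i
  rw [Finset.sum_sub_distrib, Finset.sum_add_distrib, Equiv.sum_comp σ g] at hsum
  simp only [Finset.sum_const, Finset.card_univ, nsmul_eq_mul, mul_one] at hsum
  zify at hf
  linarith

theorem card_mul_twelve_le_of_packing {Y : Type*} [Fintype Y] [DecidableEq Y]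
    (D : Finset (Finset Y)) (hcard : ∀ B ∈ D, B.card = 4)
    (huniq : ∀ B ∈ D, ∀ B' ∈ D, ∀ a b, a ≠ b → a ∈ B → b ∈ B → a ∈ B' → b ∈ B' → B = B') :
    D.card * 12 ≤ Fintype.card Y * (Fintype.card Y - 1) := by
  have hdisj : (D : Set (Finset Y)).PairwiseDisjoint Finset.offDiag := by
    intro B hB B' hB' hne
    refine Finset.disjoint_left.2 fun x hx hx' => hne ?_
    rw [Finset.mem_offDiag] at hx hx'
    exact huniq B hB B' hB' x.1 x.2 hx.2.2 hx.1 hx.2.1 hx'.1 hx'.2.1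
  have h1 : (D.biUnion Finset.offDiag).card = D.card * 12 := by
    rw [Finset.card_biUnion hdisj, Finset.sum_const_nat]
    intro B hB
    rw [Finset.offDiag_card, hcard B hB]
  rw [← h1, Nat.mul_sub_one, ← Finset.card_univ, ← Finset.offDiag_card]
  refine Finset.card_le_card fun x hx => ?_
  obtain ⟨B, -, hx⟩ := Finset.mem_biUnion.1 hx
  exact Finset.mem_offDiag.2 ⟨Finset.mem_univ _, Finset.mem_univ _, (Finset.mem_offDiag.1 hx).2.2⟩

/-- Families `D t`, indexed by `t : P`, of Steiner systems `S(2, 4, 2 |P|)` on `P × Bool` whose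
blocks together cover every triple. -/
structure IsTripleCovering {P : Type*} (D : P → Set (Finset (P × Bool))) : Prop where
  card_eq : ∀ t, ∀ B ∈ D t, B.card = 4
  exists_pair : ∀ t a b, a ≠ b → ∃ B ∈ D t, a ∈ B ∧ b ∈ B
  unique : ∀ t, ∀ B ∈ D t, ∀ B' ∈ D t, ∀ a b, a ≠ b → a ∈ B → b ∈ B → a ∈ B' → b ∈ B' → B = B'
  exists_triple : ∀ a b c, a ≠ b → a ≠ c → b ≠ c → ∃ t, ∃ B ∈ D t, a ∈ B ∧ b ∈ B ∧ c ∈ B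

open Classical in
theorem IsTripleCovering.coverNumber_le {P : Type*} [Fintype P] {D : P → Set (Finset (P × Bool))}
    (hD : IsTripleCovering D) {m v : ℕ} (hm : 3 ≤ m) (hv : v = 2 * Fintype.card P) :
    coverNumber ((m - 1) * v) 6 3 m ≤ v ^ 2 * (v - 1) * (m - 1) / 24 := by
  obtain ⟨m, rfl⟩ : ∃ l, m = l + 3 := ⟨m - 3, by omega⟩
  have hm1 : m + 3 - 1 = m + 2 := rfl
  rw [hm1]
  have hY : Fintype.card (P × Bool) = v := by
    rw [Fintype.card_prod, Fintype.card_bool, hv, mul_comm]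
  have hZ : Fintype.card (Fin (m + 2) × (P × Bool)) = (m + 2) * v := by
    rw [Fintype.card_prod, Fintype.card_fin, hY]
  have hsucc : ∀ i : Fin (m + 2), i ≠ i + 1 := fun i h => by simp at h
  let blk : Fin (m + 2) → P → Finset (P × Bool) → Finset (Fin (m + 2) × (P × Bool)) :=
    fun i t B => {i} ×ˢ B ∪ {i + 1} ×ˢ {(t, false), (t, true)}
  let Bs : Finset (Finset (Fin (m + 2) × (P × Bool))) :=
    Finset.univ.biUnion fun i => Finset.univ.biUnion fun t => (D t).toFinset.image (blk i t)
  have hmem : ∀ i t B, B ∈ D t → blk i t B ∈ Bs := fun i t B hB =>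
    Finset.mem_biUnion.2 ⟨i, Finset.mem_univ _, Finset.mem_biUnion.2 ⟨t, Finset.mem_univ _,
      Finset.mem_image.2 ⟨B, Set.mem_toFinset.2 hB, rfl⟩⟩⟩
  rw [← hZ]
  refine coverNumber_card_le Bs ⟨?_, ?_⟩ ?_
  · intro S hS
    refine ⟨Finset.subset_univ _, ?_⟩
    simp only [Bs, Finset.mem_biUnion, Finset.mem_image, Set.mem_toFinset, Finset.mem_univ,
      true_and] at hS
    obtain ⟨i, t, B, hB, rfl⟩ := hS
    rw [Finset.card_union_of_disjoint, Finset.card_product, Finset.card_product, hD.card_eq t B hB]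
    · simp
    · rw [Finset.disjoint_left]
      rintro ⟨j, y⟩ h1 h2
      simp only [Finset.mem_product, Finset.mem_singleton] at h1 h2
      exact hsucc i (h1.1.symm.trans h2.1)
  · intro M _ hM
    let fib : Fin (m + 2) → Finset (P × Bool) := fun i => Finset.univ.filter fun y => (i, y) ∈ M
    have hfib : ∀ i y, y ∈ fib i ↔ (i, y) ∈ M := fun i y => by simp [fib]
    have hsum : ∑ i, (fib i).card = m + 3 := by
      rw [← hM, ← Finset.card_sigma]
      refine Finset.card_bij (fun x _ => (x.1, x.2)) ?_ ?_ ?_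
      · rintro ⟨i, y⟩ h
        simpa [hfib] using h
      · rintro ⟨i, y⟩ _ ⟨j, z⟩ _ h
        simp only [Prod.mk.injEq] at h
        obtain ⟨rfl, h⟩ := h
        rw [h]
      · rintro ⟨i, y⟩ h
        exact ⟨⟨i, y⟩, by simpa [hfib] using h, rfl⟩
    obtain ⟨i, hi | ⟨hi, hi'⟩⟩ := exists_three_le_or_two_le (Equiv.addRight (1 : Fin (m + 2)))
      (fun i => (fib i).card) (by rw [hsum, Fintype.card_fin]; omega)
    · obtain ⟨a, b, c, ha, hb, hc, hab, hac, hbc⟩ := Finset.two_lt_card_iff.1 hi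
      obtain ⟨t, B, hB, haB, hbB, hcB⟩ := hD.exists_triple a b c hab hac hbc
      refine ⟨_, hmem i t B hB, ?_⟩
      have : ({(i, a), (i, b), (i, c)} : Finset (Fin (m + 2) × (P × Bool))).card = 3 := by
        rw [Finset.card_eq_three]
        exact ⟨_, _, _, by simpa using hab, by simpa using hac, by simpa using hbc, rfl⟩
      rw [← this]
      refine Finset.card_le_card fun x hx => ?_
      simp only [Finset.mem_insert, Finset.mem_singleton] at hx
      rw [hfib] at ha hb hc
      rcases hx with rfl | rfl | rfl <;> simp [blk, *]
    · obtain ⟨a, b, ha, hb, hab⟩ := Finset.one_lt_card_iff.1 hi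
      obtain ⟨⟨t, ε⟩, hc⟩ := Finset.card_pos.1 hi'
      obtain ⟨B, hB, haB, hbB⟩ := hD.exists_pair t a b hab
      refine ⟨_, hmem i t B hB, ?_⟩
      have : ({(i, a), (i, b), (i + 1, (t, ε))} :
          Finset (Fin (m + 2) × (P × Bool))).card = 3 := by
        rw [Finset.card_eq_three]
        exact ⟨_, _, _, by simpa using hab, fun h => hsucc i (congrArg Prod.fst h),
          fun h => hsucc i (congrArg Prod.fst h), rfl⟩
      rw [← this]
      refine Finset.card_le_card fun x hx => ?_
      simp only [Finset.mem_insert, Finset.mem_singleton] at hx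
      rw [hfib] at ha hb hc
      simp only [Equiv.coe_addRight] at hc
      rcases hx with rfl | rfl | rfl
      · simp [blk, *]
      · simp [blk, *]
      · cases ε <;> simp [blk, *]
  · have hDt : ∀ t, (D t).toFinset.card ≤ v * (v - 1) / 12 := by
      intro t
      rw [Nat.le_div_iff_mul_le (by norm_num), ← hY]
      refine card_mul_twelve_le_of_packing _ ?_ ?_
      · simpa using hD.card_eq t
      · simpa using hD.unique t
    have h1 : Bs.card ≤ (m + 2) * (Fintype.card P * (v * (v - 1) / 12)) := by
      refine (Finset.card_biUnion_le_card_mul _ _ (Fintype.card P * (v * (v - 1) / 12))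
        fun i _ => ?_).trans (by simp)
      refine (Finset.card_biUnion_le_card_mul _ _ (v * (v - 1) / 12) fun t _ => ?_).trans (by simp)
      exact Finset.card_image_le.trans (hDt t)
    rw [Nat.le_div_iff_mul_le (by norm_num)]
    have h2 : v * (v - 1) / 12 * 12 ≤ v * (v - 1) := Nat.div_mul_le_self _ _
    calc Bs.card * 24 ≤ (m + 2) * (Fintype.card P * (v * (v - 1) / 12)) * 24 := by gcongr
      _ = (m + 2) * (2 * Fintype.card P) * (v * (v - 1) / 12 * 12) := by ring
      _ ≤ (m + 2) * (2 * Fintype.card P) * (v * (v - 1)) := by gcongr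
      _ = v ^ 2 * (v - 1) * (m + 2) := by rw [← hv]; ring

/-- Steiner systems `S(2, 4, 2 |C|)` on `C × Bool`, indexed by `t ∈ C \ {o}`, which together cover
all triples and such that the one with index `t` has `{o, t} × Bool` as a block. -/
structure IsPointedSystem {P : Type*} [DecidableEq P] (C : Set P) (o : P)
    (A : P → Set (Finset (P × Bool))) : Prop where
  subset : ∀ t ∈ C, t ≠ o → ∀ B ∈ A t, ∀ a ∈ B, a.1 ∈ C
  card_eq : ∀ t ∈ C, t ≠ o → ∀ B ∈ A t, B.card = 4
  exists_pair : ∀ t ∈ C, t ≠ o → ∀ a b, a.1 ∈ C → b.1 ∈ C → a ≠ b → ∃ B ∈ A t, a ∈ B ∧ b ∈ B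
  unique : ∀ t ∈ C, t ≠ o → ∀ B ∈ A t, ∀ B' ∈ A t, ∀ a b, a ≠ b →
    a ∈ B → b ∈ B → a ∈ B' → b ∈ B' → B = B'
  base_mem : ∀ t ∈ C, t ≠ o → {o, t} ×ˢ Finset.univ ∈ A t
  exists_triple : ∀ a b c, a.1 ∈ C → b.1 ∈ C → c.1 ∈ C → a ≠ b → a ≠ c → b ≠ c →
    ∃ t ∈ C, t ≠ o ∧ ∃ B ∈ A t, a ∈ B ∧ b ∈ B ∧ c ∈ B

/-- Group divisible designs with groups `{x} × Bool`, `x ∈ C \ {t}`, and blocks of size four,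
indexed by `t ∈ C`, which together cover all transversal triples. -/
structure IsTransversalSystem {P : Type*} (C : Set P)
    (A : P → Set (Finset (P × Bool))) : Prop where
  subset : ∀ t ∈ C, ∀ B ∈ A t, ∀ a ∈ B, a.1 ∈ C ∧ a.1 ≠ t
  transversal : ∀ t ∈ C, ∀ B ∈ A t, ∀ a ∈ B, ∀ b ∈ B, a.1 = b.1 → a = b
  card_eq : ∀ t ∈ C, ∀ B ∈ A t, B.card = 4
  exists_pair : ∀ t ∈ C, ∀ a b, a.1 ∈ C → b.1 ∈ C → a.1 ≠ t → b.1 ≠ t → a.1 ≠ b.1 →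
    ∃ B ∈ A t, a ∈ B ∧ b ∈ B
  unique : ∀ t ∈ C, ∀ B ∈ A t, ∀ B' ∈ A t, ∀ a b, a ≠ b →
    a ∈ B → b ∈ B → a ∈ B' → b ∈ B' → B = B'
  exists_triple : ∀ a b c, a.1 ∈ C → b.1 ∈ C → c.1 ∈ C → a.1 ≠ b.1 → a.1 ≠ c.1 → b.1 ≠ c.1 →
    ∃ t ∈ C, ∃ B ∈ A t, a ∈ B ∧ b ∈ B ∧ c ∈ B

section Transport

variable {Q P : Type*}

/-- The pushforward of a family of block sets along an embedding. -/
def pushFamily (e : Q ↪ P) (A : Q → Set (Finset (Q × Bool))) (t : P) : Set (Finset (P × Bool)) :=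
  {B | ∃ s, e s = t ∧ ∃ B' ∈ A s, B = B'.map (e.prodMap (Function.Embedding.refl Bool))}

theorem mem_pushFamily_apply {e : Q ↪ P} {A : Q → Set (Finset (Q × Bool))} {s : Q}
    {B : Finset (P × Bool)} : B ∈ pushFamily e A (e s) ↔
      ∃ B' ∈ A s, B = B'.map (e.prodMap (Function.Embedding.refl Bool)) := by
  constructor
  · rintro ⟨s', h, h'⟩
    rwa [e.injective h] at h'
  · exact fun h => ⟨s, rfl, h⟩

theorem mem_map_prodMap {e : Q ↪ P} {x : Q} {ε : Bool} {B : Finset (Q × Bool)} :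
    (e x, ε) ∈ B.map (e.prodMap (Function.Embedding.refl Bool)) ↔ (x, ε) ∈ B :=
  Finset.mem_map' (f := e.prodMap (Function.Embedding.refl Bool)) (a := (x, ε))

theorem IsTransversalSystem.push {A : Q → Set (Finset (Q × Bool))}
    (h : IsTransversalSystem Set.univ A) (e : Q ↪ P) :
    IsTransversalSystem (Set.range e) (pushFamily e A) where
  subset := by
    rintro _ ⟨s, rfl⟩ B hB a ha
    obtain ⟨B', hB', rfl⟩ := mem_pushFamily_apply.1 hB
    obtain ⟨⟨x, ε⟩, hx, rfl⟩ := Finset.mem_map.1 ha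
    exact ⟨⟨x, rfl⟩, fun h' => (h.subset s trivial B' hB' _ hx).2 (e.injective h')⟩
  transversal := by
    rintro _ ⟨s, rfl⟩ B hB a ha b hb hab
    obtain ⟨B', hB', rfl⟩ := mem_pushFamily_apply.1 hB
    obtain ⟨x, hx, rfl⟩ := Finset.mem_map.1 ha
    obtain ⟨y, hy, rfl⟩ := Finset.mem_map.1 hb
    rw [h.transversal s trivial B' hB' x hx y hy (e.injective hab)]
  card_eq := by
    rintro _ ⟨s, rfl⟩ B hB
    obtain ⟨B', hB', rfl⟩ := mem_pushFamily_apply.1 hB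
    rw [Finset.card_map, h.card_eq s trivial B' hB']
  exists_pair := by
    rintro _ ⟨s, rfl⟩ ⟨_, ε⟩ ⟨_, δ⟩ ⟨x, rfl⟩ ⟨y, rfl⟩ h1 h2 h3
    obtain ⟨B, hB, hx, hy⟩ := h.exists_pair s trivial (x, ε) (y, δ) trivial trivial
      (fun h => h1 (congrArg e h)) (fun h => h2 (congrArg e h)) (fun h => h3 (congrArg e h))
    exact ⟨_, mem_pushFamily_apply.2 ⟨B, hB, rfl⟩, mem_map_prodMap.2 hx, mem_map_prodMap.2 hy⟩
  unique := by
    rintro _ ⟨s, rfl⟩ B hB B' hB' a b hab ha hb ha' hb'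
    obtain ⟨B₁, hB₁, rfl⟩ := mem_pushFamily_apply.1 hB
    obtain ⟨B₂, hB₂, rfl⟩ := mem_pushFamily_apply.1 hB'
    obtain ⟨⟨x, ε⟩, hx, rfl⟩ := Finset.mem_map.1 ha
    obtain ⟨⟨y, δ⟩, hy, rfl⟩ := Finset.mem_map.1 hb
    rw [h.unique s trivial B₁ hB₁ B₂ hB₂ (x, ε) (y, δ) (fun h => hab (by rw [h])) hx hy
      (mem_map_prodMap.1 ha') (mem_map_prodMap.1 hb')]
  exists_triple := by
    rintro ⟨_, ε⟩ ⟨_, δ⟩ ⟨_, η⟩ ⟨x, rfl⟩ ⟨y, rfl⟩ ⟨z, rfl⟩ h1 h2 h3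
    obtain ⟨t, -, B, hB, hx, hy, hz⟩ := h.exists_triple (x, ε) (y, δ) (z, η) trivial trivial
      trivial (fun h => h1 (congrArg e h)) (fun h => h2 (congrArg e h))
      (fun h => h3 (congrArg e h))
    exact ⟨e t, ⟨t, rfl⟩, _, mem_pushFamily_apply.2 ⟨B, hB, rfl⟩, mem_map_prodMap.2 hx,
      mem_map_prodMap.2 hy, mem_map_prodMap.2 hz⟩

theorem IsPointedSystem.push [DecidableEq Q] [DecidableEq P] {A : Q → Set (Finset (Q × Bool))}
    {o : Q} (h : IsPointedSystem Set.univ o A) (e : Q ↪ P) :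
    IsPointedSystem (Set.range e) (e o) (pushFamily e A) where
  subset := by
    rintro _ ⟨s, rfl⟩ hs B hB a ha
    obtain ⟨B', hB', rfl⟩ := mem_pushFamily_apply.1 hB
    obtain ⟨⟨x, ε⟩, hx, rfl⟩ := Finset.mem_map.1 ha
    exact ⟨x, rfl⟩
  card_eq := by
    rintro _ ⟨s, rfl⟩ hs B hB
    obtain ⟨B', hB', rfl⟩ := mem_pushFamily_apply.1 hB
    rw [Finset.card_map, h.card_eq s trivial (fun h => hs (congrArg e h)) B' hB']
  exists_pair := by
    rintro _ ⟨s, rfl⟩ hs ⟨_, ε⟩ ⟨_, δ⟩ ⟨x, rfl⟩ ⟨y, rfl⟩ h1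
    obtain ⟨B, hB, hx, hy⟩ := h.exists_pair s trivial (fun h => hs (congrArg e h))
      (x, ε) (y, δ) trivial trivial (fun h => h1 (by simpa using h))
    exact ⟨_, mem_pushFamily_apply.2 ⟨B, hB, rfl⟩, mem_map_prodMap.2 hx, mem_map_prodMap.2 hy⟩
  unique := by
    rintro _ ⟨s, rfl⟩ hs B hB B' hB' a b hab ha hb ha' hb'
    obtain ⟨B₁, hB₁, rfl⟩ := mem_pushFamily_apply.1 hB
    obtain ⟨B₂, hB₂, rfl⟩ := mem_pushFamily_apply.1 hB'
    obtain ⟨⟨x, ε⟩, hx, rfl⟩ := Finset.mem_map.1 ha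
    obtain ⟨⟨y, δ⟩, hy, rfl⟩ := Finset.mem_map.1 hb
    rw [h.unique s trivial (fun h => hs (congrArg e h)) B₁ hB₁ B₂ hB₂ (x, ε) (y, δ)
      (fun h => hab (by rw [h])) hx hy (mem_map_prodMap.1 ha') (mem_map_prodMap.1 hb')]
  base_mem := by
    rintro _ ⟨s, rfl⟩ hs
    refine mem_pushFamily_apply.2 ⟨_, h.base_mem s trivial fun h => hs (congrArg e h), ?_⟩
    ext ⟨y, ε⟩
    simp only [Finset.mem_product, Finset.mem_insert, Finset.mem_singleton, Finset.mem_univ,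
      and_true, Finset.mem_map, Prod.exists, Function.Embedding.coe_prodMap, Prod.map_apply,
      Function.Embedding.refl_apply, Prod.mk.injEq]
    constructor
    · rintro (rfl | rfl)
      · exact ⟨o, ε, Or.inl rfl, rfl, rfl⟩
      · exact ⟨s, ε, Or.inr rfl, rfl, rfl⟩
    · rintro ⟨x, _, rfl | rfl, rfl, -⟩ <;> simp
  exists_triple := by
    rintro ⟨_, ε⟩ ⟨_, δ⟩ ⟨_, η⟩ ⟨x, rfl⟩ ⟨y, rfl⟩ ⟨z, rfl⟩ h1 h2 h3
    obtain ⟨t, -, ht, B, hB, hx, hy, hz⟩ := h.exists_triple (x, ε) (y, δ) (z, η) trivial trivial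
      trivial (fun h => h1 (by simpa using h)) (fun h => h2 (by simpa using h))
      (fun h => h3 (by simpa using h))
    exact ⟨e t, ⟨t, rfl⟩, fun h => ht (e.injective h), _, mem_pushFamily_apply.2 ⟨B, hB, rfl⟩,
      mem_map_prodMap.2 hx, mem_map_prodMap.2 hy, mem_map_prodMap.2 hz⟩

end Transport

/-- Steiner systems of strength three: any three points lie on a circle, which is unique if they
are distinct. -/
structure IsInversive {P : Type*} (𝒞 : Set (Set P)) : Prop where
  exists_circle : ∀ x y z, ∃ C ∈ 𝒞, x ∈ C ∧ y ∈ C ∧ z ∈ C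
  unique : ∀ x y z, x ≠ y → x ≠ z → y ≠ z → ∀ C ∈ 𝒞, ∀ C' ∈ 𝒞, x ∈ C → y ∈ C → z ∈ C →
    x ∈ C' → y ∈ C' → z ∈ C' → C = C'

theorem IsPointedSystem.isTripleCovering {P : Type*} [DecidableEq P] {o p : P} (hp : p ≠ o)
    {A : P → Set (Finset (P × Bool))} (hA : IsPointedSystem Set.univ o A) :
    IsTripleCovering fun t => A (if t = o then p else t) := by
  have hne : ∀ t, (if t = o then p else t) ≠ o := fun t => by split_ifs <;> assumption
  exact
    { card_eq := fun t => hA.card_eq _ trivial (hne t)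
      exists_pair := fun t a b => hA.exists_pair _ trivial (hne t) a b trivial trivial
      unique := fun t => hA.unique _ trivial (hne t)
      exists_triple := fun a b c hab hac hbc => by
        obtain ⟨t, -, ht, h⟩ := hA.exists_triple a b c trivial trivial trivial hab hac hbc
        exact ⟨t, by rwa [if_neg ht]⟩ }

theorem IsInversive.exists_isPointedSystem {P : Type*} [DecidableEq P] {𝒞 : Set (Set P)}
    (h𝒞 : IsInversive 𝒞) (o : P)
    (hline : ∀ C ∈ 𝒞, o ∈ C → ∃ A, IsPointedSystem C o A)
    (hcirc : ∀ C ∈ 𝒞, o ∉ C → ∃ A, IsTransversalSystem C A) :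
    ∃ A, IsPointedSystem (Set.univ : Set P) o A := by
  choose! L hL using hline
  choose! T hT using hcirc
  refine ⟨fun t => {B | ∃ C ∈ 𝒞, t ∈ C ∧ ((o ∈ C ∧ B ∈ L C t) ∨ (o ∉ C ∧ B ∈ T C t))}, ?_⟩
  constructor
  · exact fun _ _ _ _ _ _ _ => trivial
  · rintro t - ht B ⟨C, hC, htC, ⟨ho, hB⟩ | ⟨ho, hB⟩⟩
    · exact (hL C hC ho).card_eq t htC ht B hB
    · exact (hT C hC ho).card_eq t htC B hB
  · rintro t - ht a b - - hab
    have key : ∀ C ∈ 𝒞, o ∈ C → t ∈ C → a.1 ∈ C → b.1 ∈ C → ∃ B, (∃ C ∈ 𝒞, t ∈ C ∧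
        ((o ∈ C ∧ B ∈ L C t) ∨ (o ∉ C ∧ B ∈ T C t))) ∧ a ∈ B ∧ b ∈ B := by
      intro C hC ho htC ha hb
      obtain ⟨B, hB, h⟩ := (hL C hC ho).exists_pair t htC ht a b ha hb hab
      exact ⟨B, ⟨C, hC, htC, Or.inl ⟨ho, hB⟩⟩, h⟩
    by_cases hat : a.1 = t
    · obtain ⟨C, hC, h1, h2, h3⟩ := h𝒞.exists_circle o t b.1
      exact key C hC h1 h2 (hat ▸ h2) h3
    by_cases hbt : b.1 = t
    · obtain ⟨C, hC, h1, h2, h3⟩ := h𝒞.exists_circle o t a.1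
      exact key C hC h1 h2 h3 (hbt ▸ h2)
    by_cases hab1 : a.1 = b.1
    · obtain ⟨C, hC, h1, h2, h3⟩ := h𝒞.exists_circle o t a.1
      exact key C hC h1 h2 h3 (hab1 ▸ h3)
    obtain ⟨C, hC, h1, h2, h3⟩ := h𝒞.exists_circle t a.1 b.1
    by_cases ho : o ∈ C
    · exact key C hC ho h1 h2 h3
    · obtain ⟨B, hB, h⟩ := (hT C hC ho).exists_pair t h1 a b h2 h3 hat hbt hab1
      exact ⟨B, ⟨C, hC, h1, Or.inr ⟨ho, hB⟩⟩, h⟩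
  · rintro t - ht B hB B' hB' a b hab ha hb ha' hb'
    have key : ∀ C ∈ 𝒞, ∀ C' ∈ 𝒞, t ∈ C → t ∈ C' → o ∉ C → B ∈ T C t →
        ((o ∈ C' ∧ B' ∈ L C' t) ∨ (o ∉ C' ∧ B' ∈ T C' t)) →
        ∀ a b, a ≠ b → a ∈ B → b ∈ B → a ∈ B' → b ∈ B' → B = B' := by
      intro C hC C' hC' htC htC' ho hB hB' a b hab ha hb ha' hb'
      have h1 := (hT C hC ho).subset t htC B hB a ha
      have h2 := (hT C hC ho).subset t htC B hB b hb
      have h3 : a.1 ≠ b.1 := fun h => hab ((hT C hC ho).transversal t htC B hB a ha b hb h)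
      have h4 : a.1 ∈ C' ∧ b.1 ∈ C' := by
        rcases hB' with ⟨ho', hB'⟩ | ⟨ho', hB'⟩
        · exact ⟨(hL C' hC' ho').subset t htC' ht B' hB' a ha',
            (hL C' hC' ho').subset t htC' ht B' hB' b hb'⟩
        · exact ⟨((hT C' hC' ho').subset t htC' B' hB' a ha').1,
            ((hT C' hC' ho').subset t htC' B' hB' b hb').1⟩
      obtain rfl := h𝒞.unique t a.1 b.1 h1.2.symm h2.2.symm h3 C hC C' hC' htC h1.1 h2.1 htC'
        h4.1 h4.2
      rcases hB' with ⟨ho', hB'⟩ | ⟨ho', hB'⟩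
      · exact absurd ho' ho
      · exact (hT C hC ho).unique t htC B hB B' hB' a b hab ha hb ha' hb'
    obtain ⟨C, hC, htC, ⟨ho, hB⟩ | ⟨ho, hB⟩⟩ := hB
    · obtain ⟨C', hC', htC', ⟨ho', hB'⟩ | ⟨ho', hB'⟩⟩ := hB'
      · have base : ∀ x y, x ∈ B → y ∈ B → x ∈ B' → y ∈ B' → x ≠ y →
            x.1 ∈ ({o, t} : Finset P) → y.1 ∈ ({o, t} : Finset P) → B = B' := by
          intro x y hx hy hx' hy' hxy h1 h2
          have h1 : x ∈ ({o, t} ×ˢ Finset.univ : Finset (P × Bool)) :=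
            Finset.mem_product.2 ⟨h1, Finset.mem_univ _⟩
          have h2 : y ∈ ({o, t} ×ˢ Finset.univ : Finset (P × Bool)) :=
            Finset.mem_product.2 ⟨h2, Finset.mem_univ _⟩
          rw [(hL C hC ho).unique t htC ht B hB _ ((hL C hC ho).base_mem t htC ht) x y hxy hx hy
            h1 h2, (hL C' hC' ho').unique t htC' ht B' hB' _
            ((hL C' hC' ho').base_mem t htC' ht) x y hxy hx' hy' h1 h2]
        have same : ∀ x, x ∈ B → x ∈ B' → x.1 ∉ ({o, t} : Finset P) → C = C' := by
          intro x hx hx' h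
          simp only [Finset.mem_insert, Finset.mem_singleton, not_or] at h
          exact h𝒞.unique o t x.1 ht.symm (Ne.symm h.1) (Ne.symm h.2) C hC C' hC' ho htC
            ((hL C hC ho).subset t htC ht B hB x hx) ho' htC'
            ((hL C' hC' ho').subset t htC' ht B' hB' x hx')
        by_cases h1 : a.1 ∈ ({o, t} : Finset P)
        · by_cases h2 : b.1 ∈ ({o, t} : Finset P)
          · exact base a b ha hb ha' hb' hab h1 h2
          · obtain rfl := same b hb hb' h2
            exact (hL C hC ho).unique t htC ht B hB B' hB' a b hab ha hb ha' hb'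
        · obtain rfl := same a ha ha' h1
          exact (hL C hC ho).unique t htC ht B hB B' hB' a b hab ha hb ha' hb'
      · have h1 := (hT C' hC' ho').subset t htC' B' hB' a ha'
        have h2 := (hT C' hC' ho').subset t htC' B' hB' b hb'
        have h3 : a.1 ≠ b.1 := fun h =>
          hab ((hT C' hC' ho').transversal t htC' B' hB' a ha' b hb' h)
        obtain rfl := h𝒞.unique t a.1 b.1 h1.2.symm h2.2.symm h3 C hC C' hC' htC
          ((hL C hC ho).subset t htC ht B hB a ha) ((hL C hC ho).subset t htC ht B hB b hb)
          htC' h1.1 h2.1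
        exact absurd ho ho'
    · obtain ⟨C', hC', htC', hB'⟩ := hB'
      exact key C hC C' hC' htC htC' ho hB hB' a b hab ha hb ha' hb'
  · rintro t - ht
    obtain ⟨C, hC, ho, htC, -⟩ := h𝒞.exists_circle o t t
    exact ⟨C, hC, htC, Or.inl ⟨ho, (hL C hC ho).base_mem t htC ht⟩⟩
  · rintro a b c - - - hab hac hbc
    have key : ∀ C ∈ 𝒞, o ∈ C → a.1 ∈ C → b.1 ∈ C → c.1 ∈ C → ∃ t ∈ Set.univ, t ≠ o ∧ ∃ B,
        (∃ C ∈ 𝒞, t ∈ C ∧ ((o ∈ C ∧ B ∈ L C t) ∨ (o ∉ C ∧ B ∈ T C t))) ∧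
        a ∈ B ∧ b ∈ B ∧ c ∈ B := by
      intro C hC ho ha hb hc
      obtain ⟨t, htC, ht, B, hB, h⟩ := (hL C hC ho).exists_triple a b c ha hb hc hab hac hbc
      exact ⟨t, trivial, ht, B, ⟨C, hC, htC, Or.inl ⟨ho, hB⟩⟩, h⟩
    by_cases h1 : a.1 = b.1
    · obtain ⟨C, hC, ho, ha, hc⟩ := h𝒞.exists_circle o a.1 c.1
      exact key C hC ho ha (h1 ▸ ha) hc
    by_cases h2 : a.1 = c.1
    · obtain ⟨C, hC, ho, ha, hb⟩ := h𝒞.exists_circle o a.1 b.1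
      exact key C hC ho ha hb (h2 ▸ ha)
    by_cases h3 : b.1 = c.1
    · obtain ⟨C, hC, ho, ha, hb⟩ := h𝒞.exists_circle o a.1 b.1
      exact key C hC ho ha hb (h3 ▸ hb)
    obtain ⟨C, hC, ha, hb, hc⟩ := h𝒞.exists_circle a.1 b.1 c.1
    by_cases ho : o ∈ C
    · exact key C hC ho ha hb hc
    · obtain ⟨t, htC, B, hB, h⟩ := (hT C hC ho).exists_triple a b c ha hb hc h1 h2 h3
      exact ⟨t, trivial, fun h' => ho (h' ▸ htC), B, ⟨C, hC, htC, Or.inr ⟨ho, hB⟩⟩, h⟩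

section CharTwo

variable {F : Type*} [Field F]

/-- The fourth point of the plane through three points of `F × Bool`. -/
def fourthPoint (a b c : F × Bool) : F × Bool := (a.1 + b.1 + c.1, a.2 ^^ (b.2 ^^ c.2))

/-- The invariant, cubic in the points, according to which the planes are distributed. -/
def cubicInvariant (B : Finset (F × Bool)) : F :=
  ∑ a ∈ B, a.1 ^ 3 + (∑ a ∈ B, if a.2 then a.1 else 0) ^ 3

/-- The value of `cubicInvariant` on the plane through three points. -/
def planeInvariant (a b c : F × Bool) : F :=
  a.1 ^ 3 + b.1 ^ 3 + c.1 ^ 3 + (fourthPoint a b c).1 ^ 3 +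
    ((if a.2 then a.1 else 0) + (if b.2 then b.1 else 0) + (if c.2 then c.1 else 0) +
      if (fourthPoint a b c).2 then (fourthPoint a b c).1 else 0) ^ 3

theorem planeInvariant_of_eq (h2 : (2 : F) = 0) {a b c : F × Bool} (hab : a.2 = b.2) :
    planeInvariant a b c = (a.1 + b.1) * ((a.1 + c.1) * (b.1 + c.1) +
      if a.2 = c.2 then 0 else (a.1 + b.1) ^ 2) := by
  obtain ⟨x, ε⟩ := a
  obtain ⟨y, δ⟩ := b
  obtain ⟨z, η⟩ := c
  simp only at hab
  subst hab
  cases ε <;> cases η <;> simp [planeInvariant, fourthPoint] <;> grind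

theorem planeInvariant_of_ne (h2 : (2 : F) = 0) {a b c : F × Bool} (hab : a.2 ≠ b.2) :
    planeInvariant a b c =
      (a.1 + b.1) ^ 3 + ((if a.2 = c.2 then b.1 else a.1) + c.1) ^ 3 := by
  obtain ⟨x, ε⟩ := a
  obtain ⟨y, δ⟩ := b
  obtain ⟨z, η⟩ := c
  cases ε <;> cases δ <;> cases η <;> simp_all [planeInvariant, fourthPoint] <;> grind


theorem fourthPoint_ne (h2 : (2 : F) = 0) {a b c : F × Bool} (hab : a ≠ b) (hac : a ≠ c)
    (hbc : b ≠ c) : a ≠ fourthPoint a b c ∧ b ≠ fourthPoint a b c ∧ c ≠ fourthPoint a b c := by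
  obtain ⟨x, ε⟩ := a
  obtain ⟨y, δ⟩ := b
  obtain ⟨z, η⟩ := c
  simp only [fourthPoint, ne_eq, Prod.mk.injEq] at *
  refine ⟨?_, ?_, ?_⟩
  · rintro ⟨h, h'⟩
    exact hbc ⟨by grind, by revert h'; cases ε <;> cases δ <;> cases η <;> decide⟩
  · rintro ⟨h, h'⟩
    exact hac ⟨by grind, by revert h'; cases ε <;> cases δ <;> cases η <;> decide⟩
  · rintro ⟨h, h'⟩
    exact hab ⟨by grind, by revert h'; cases ε <;> cases δ <;> cases η <;> decide⟩

theorem planeInvariant_left (h2 : (2 : F) = 0) (a b : F × Bool) : planeInvariant a b a = 0 := by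
  by_cases hab : a.2 = b.2
  · rw [planeInvariant_of_eq h2 hab]
    simp
    grind
  · rw [planeInvariant_of_ne h2 hab]
    simp
    grind

theorem planeInvariant_right (h2 : (2 : F) = 0) (a b : F × Bool) : planeInvariant a b b = 0 := by
  by_cases hab : a.2 = b.2
  · rw [planeInvariant_of_eq h2 hab]
    simp [hab]
    grind
  · rw [planeInvariant_of_ne h2 hab]
    simp [hab]
    grind

theorem sq_add_mul_add_sq_ne_zero (h2 : (2 : F) = 0)
    (hinj : Function.Injective fun x : F => x ^ 3) {x y : F} (hx : x ≠ 0) :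
    y ^ 2 + y * x + x ^ 2 ≠ 0 := by
  intro h
  have h3 : y ^ 3 = x ^ 3 := by linear_combination (y - x) * h
  obtain rfl : y = x := hinj h3
  have : y ^ 2 = 0 := by grind
  exact hx (pow_eq_zero_iff two_ne_zero |>.1 this)

theorem planeInvariant_ne_zero (h2 : (2 : F) = 0)
    (hinj : Function.Injective fun x : F => x ^ 3) {a b c : F × Bool}
    (hab : a ≠ b) (hac : a ≠ c) (hbc : b ≠ c) : planeInvariant a b c ≠ 0 := by
  have hne : ∀ {p q : F × Bool}, p ≠ q → p.2 = q.2 → p.1 + q.1 ≠ 0 := by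
    intro p q h h' h0
    exact h (Prod.ext (by grind) h')
  have hcube : ∀ {x y : F}, x ^ 3 + y ^ 3 = 0 → x + y = 0 := by
    intro x y h
    have : x = y := hinj (show x ^ 3 = y ^ 3 by grind)
    grind
  by_cases h : a.2 = b.2
  · rw [planeInvariant_of_eq h2 h]
    refine mul_ne_zero (hne hab h) ?_
    split_ifs with h'
    · rw [add_zero]
      exact mul_ne_zero (hne hac h') (hne hbc (h ▸ h'))
    · have := sq_add_mul_add_sq_ne_zero h2 hinj (y := a.1 + c.1) (hne hab h)
      intro h0
      apply this
      grind
  · rw [planeInvariant_of_ne h2 h]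
    split_ifs with h'
    · intro h0
      exact hne hac h' (by have := hcube h0; grind)
    · intro h0
      refine hne hbc ?_ (by have := hcube h0; grind)
      revert h h'
      generalize a.2 = ε₁, b.2 = ε₂, c.2 = ε₃
      decide +revert

theorem eq_or_eq_fourthPoint (h2 : (2 : F) = 0)
    (hinj : Function.Injective fun x : F => x ^ 3) {a b c d : F × Bool} (hab : a ≠ b)
    (h : planeInvariant a b c = planeInvariant a b d) : d = c ∨ d = fourthPoint a b c := by
  by_cases hε : a.2 = b.2
  · rw [planeInvariant_of_eq h2 hε, planeInvariant_of_eq h2 hε] at h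
    have h0 : a.1 + b.1 ≠ 0 := fun h0 => hab (Prod.ext (by grind) hε)
    have h := mul_left_cancel₀ h0 h
    have hcd : c.2 = d.2 := by
      by_contra hcd
      refine sq_add_mul_add_sq_ne_zero h2 hinj (y := c.1 + d.1) h0 ?_
      by_cases h3 : a.2 = c.2
      · rw [if_pos h3, if_neg (h3 ▸ hcd)] at h
        grind
      · have h5 : a.2 = d.2 := by
          cases h : a.2 <;> cases h' : c.2 <;> cases h'' : d.2 <;> simp_all
        rw [if_neg h3, if_pos h5] at h
        grind
    have h4 : (c.1 + d.1) * (c.1 + d.1 + (a.1 + b.1)) = 0 := by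
      rw [hcd] at h
      have := add_right_cancel h
      grind
    rcases mul_eq_zero.1 h4 with h4 | h4
    · exact Or.inl (Prod.ext (by grind) hcd.symm)
    · refine Or.inr (Prod.ext ?_ ?_)
      · simp only [fourthPoint]; grind
      · simp only [fourthPoint]; grind
  · rw [planeInvariant_of_ne h2 hε, planeInvariant_of_ne h2 hε] at h
    have h := hinj (add_left_cancel h)
    obtain ⟨x, ε⟩ := a
    obtain ⟨y, δ⟩ := b
    obtain ⟨z, η⟩ := c
    obtain ⟨w, ζ⟩ := d
    cases ε <;> cases δ <;> cases η <;> cases ζ <;> simp_all [fourthPoint] <;> grind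

variable [DecidableEq F]

/-- The planes of `F × Bool` on which the cubic invariant is a given cube. -/
def planeFamily (t : F) : Set (Finset (F × Bool)) :=
  {B | B.card = 4 ∧ ∑ a ∈ B, a.1 = 0 ∧ (∑ a ∈ B, if a.2 then (1 : F) else 0) = 0 ∧
    cubicInvariant B = t ^ 3}

theorem sum_four {α M : Type*} [DecidableEq α] [AddCommMonoid M] (f : α → M) {a b c d : α}
    (hab : a ≠ b) (hac : a ≠ c) (had : a ≠ d) (hbc : b ≠ c) (hbd : b ≠ d) (hcd : c ≠ d) :
    ∑ x ∈ {a, b, c, d}, f x = f a + f b + f c + f d := by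
  rw [Finset.sum_insert (by simp [*]), Finset.sum_insert (by simp [*]),
    Finset.sum_insert (by simp [*]), Finset.sum_singleton]
  simp only [add_assoc]

theorem insert_fourthPoint_mem_planeFamily (h2 : (2 : F) = 0) {t : F} {a b c : F × Bool}
    (hab : a ≠ b) (hac : a ≠ c) (hbc : b ≠ c) (ht : planeInvariant a b c = t ^ 3) :
    {a, b, c, fourthPoint a b c} ∈ planeFamily t := by
  obtain ⟨had, hbd, hcd⟩ := fourthPoint_ne h2 hab hac hbc
  refine ⟨Finset.card_eq_of_equiv_fin ?_ |>.trans rfl, ?_, ?_, ?_⟩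
  · exact Finset.equivFinOfCardEq (by
      rw [Finset.card_insert_of_notMem (by simp [*]), Finset.card_insert_of_notMem (by simp [*]),
        Finset.card_insert_of_notMem (by simp [*]), Finset.card_singleton])
  · rw [sum_four _ hab hac had hbc hbd hcd]
    simp only [fourthPoint]
    grind
  · rw [sum_four _ hab hac had hbc hbd hcd]
    obtain ⟨x, ε⟩ := a
    obtain ⟨y, δ⟩ := b
    obtain ⟨z, η⟩ := c
    cases ε <;> cases δ <;> cases η <;> simp [fourthPoint] <;> grind
  · rw [← ht, cubicInvariant, sum_four _ hab hac had hbc hbd hcd,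
      sum_four _ hab hac had hbc hbd hcd, planeInvariant]

theorem exists_eq_insert_of_mem_planeFamily (h2 : (2 : F) = 0) {t : F} {B : Finset (F × Bool)}
    (hB : B ∈ planeFamily t) {a b : F × Bool} (hab : a ≠ b) (ha : a ∈ B) (hb : b ∈ B) :
    ∃ c, B = {a, b, c, fourthPoint a b c} ∧ planeInvariant a b c = t ^ 3 := by
  obtain ⟨h4, hs, hε, ht⟩ := hB
  obtain ⟨c, d, hcd, hcd'⟩ := Finset.card_eq_two.1 (show ((B.erase a).erase b).card = 2 by
    rw [Finset.card_erase_of_mem (Finset.mem_erase.2 ⟨hab.symm, hb⟩),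
      Finset.card_erase_of_mem ha, h4])
  have hc : c ∈ (B.erase a).erase b := by simp [hcd']
  have hd : d ∈ (B.erase a).erase b := by simp [hcd']
  simp only [Finset.mem_erase] at hc hd
  obtain rfl : B = {a, b, c, d} := by
    rw [← hcd', Finset.insert_erase (Finset.mem_erase.2 ⟨hab.symm, hb⟩), Finset.insert_erase ha]
  have hac := hc.2.1.symm
  have had := hd.2.1.symm
  have hbc := hc.1.symm
  have hbd := hd.1.symm
  have key : d = fourthPoint a b c := by
    rw [sum_four _ hab hac had hbc hbd hcd] at hs hε
    refine Prod.ext ?_ ?_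
    · simp only [fourthPoint]
      grind
    · simp only [fourthPoint]
      have h1 : (1 : F) ≠ 0 := one_ne_zero
      revert hε
      clear * - h2 h1
      generalize a.2 = ε₁, b.2 = ε₂, c.2 = ε₃, d.2 = ε₄
      cases ε₁ <;> cases ε₂ <;> cases ε₃ <;> cases ε₄ <;> simp <;> grind
  refine ⟨c, by rw [key], ?_⟩
  rw [← ht, cubicInvariant, sum_four _ hab hac had hbc hbd hcd,
      sum_four _ hab hac had hbc hbd hcd, planeInvariant, key]

theorem exists_sq_add_self [Fintype F] (h2 : (2 : F) = 0)
    (hinj : Function.Injective fun x : F => x ^ 3) (α : F) :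
    ∃ w : F, w ^ 2 + w = α ∨ w ^ 2 + w + 1 = α := by
  have hcard := Finset.card_le_mul_card_image (f := fun w : F => w ^ 2 + w) Finset.univ 2 (by
    intro a ha
    obtain ⟨w, -, rfl⟩ := Finset.mem_image.1 ha
    refine (Finset.card_le_card (t := {w, w + 1}) fun x hx => ?_).trans Finset.card_le_two
    have hx := (Finset.mem_filter.1 hx).2
    have : (x - w) * (x - (w + 1)) = 0 := by grind
    rcases mul_eq_zero.1 this with h | h
    · simp [sub_eq_zero.1 h]
    · simp [sub_eq_zero.1 h])
  have hdisj : Disjoint (Finset.univ.image fun w : F => w ^ 2 + w)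
      ((Finset.univ.image fun w : F => w ^ 2 + w).map (addRightEmbedding 1)) := by
    rw [Finset.disjoint_left]
    intro x hx hx'
    obtain ⟨w, -, rfl⟩ := Finset.mem_image.1 hx
    obtain ⟨y, hy, hy'⟩ := Finset.mem_map.1 hx'
    obtain ⟨z, -, rfl⟩ := Finset.mem_image.1 hy
    simp only [addRightEmbedding_apply] at hy'
    exact sq_add_mul_add_sq_ne_zero h2 hinj (x := 1) (y := w + z) one_ne_zero (by grind)
  have huniv : (Finset.univ.image fun w : F => w ^ 2 + w) ∪
      (Finset.univ.image fun w : F => w ^ 2 + w).map (addRightEmbedding 1) = Finset.univ := by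
    refine Finset.eq_univ_of_card _ (le_antisymm (Finset.card_le_univ _) ?_)
    rw [Finset.card_union_of_disjoint hdisj, Finset.card_map, ← Finset.card_univ]
    omega
  rcases Finset.mem_union.1 (huniv ▸ Finset.mem_univ α) with h | h
  · obtain ⟨w, -, hw⟩ := Finset.mem_image.1 h
    exact ⟨w, Or.inl hw⟩
  · obtain ⟨y, hy, hy'⟩ := Finset.mem_map.1 h
    obtain ⟨w, -, rfl⟩ := Finset.mem_image.1 hy
    exact ⟨w, Or.inr hy'⟩

theorem exists_planeInvariant_eq [Fintype F] (h2 : (2 : F) = 0)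
    (hinj : Function.Injective fun x : F => x ^ 3) {a b : F × Bool} (hab : a ≠ b) (γ : F) :
    ∃ c, planeInvariant a b c = γ := by
  have hsurj := Finite.surjective_of_injective hinj
  by_cases hε : a.2 = b.2
  · have h0 : a.1 + b.1 ≠ 0 := fun h0 => hab (Prod.ext (by grind) hε)
    obtain ⟨w, hw⟩ := exists_sq_add_self h2 hinj (γ / (a.1 + b.1) ^ 3)
    rw [eq_div_iff (pow_ne_zero 3 h0), eq_div_iff (pow_ne_zero 3 h0)] at hw
    rcases hw with hw | hw
    · refine ⟨(a.1 + (a.1 + b.1) * w, a.2), ?_⟩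
      rw [planeInvariant_of_eq h2 hε, if_pos rfl, ← hw]
      grind
    · refine ⟨(a.1 + (a.1 + b.1) * w, !a.2), ?_⟩
      rw [planeInvariant_of_eq h2 hε, if_neg (by simp), ← hw]
      grind
  · obtain ⟨z, hz⟩ := hsurj (γ - (a.1 + b.1) ^ 3)
    refine ⟨(z - b.1, a.2), ?_⟩
    rw [planeInvariant_of_ne h2 hε, if_pos rfl]
    simp only at hz
    rw [add_sub_cancel, hz]
    ring

theorem isPointedSystem_planeFamily [Fintype F] (h2 : (2 : F) = 0)
    (hinj : Function.Injective fun x : F => x ^ 3) :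
    IsPointedSystem (Set.univ : Set F) 0 planeFamily where
  subset := fun _ _ _ _ _ _ _ => trivial
  card_eq := fun _ _ _ _ hB => hB.1
  exists_pair := by
    intro t _ ht a b _ _ hab
    obtain ⟨c, hc⟩ := exists_planeInvariant_eq h2 hinj hab (t ^ 3)
    have ht3 : t ^ 3 ≠ 0 := pow_ne_zero 3 ht
    refine ⟨_, insert_fourthPoint_mem_planeFamily h2 hab ?_ ?_ hc, by simp, by simp⟩
    · rintro rfl
      exact ht3 (hc.symm.trans (planeInvariant_left h2 _ _))
    · rintro rfl
      exact ht3 (hc.symm.trans (planeInvariant_right h2 _ _))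
  unique := by
    intro t _ ht B hB B' hB' a b hab ha hb ha' hb'
    obtain ⟨c, rfl, hc⟩ := exists_eq_insert_of_mem_planeFamily h2 hB hab ha hb
    obtain ⟨d, rfl, hd⟩ := exists_eq_insert_of_mem_planeFamily h2 hB' hab ha' hb'
    rcases eq_or_eq_fourthPoint h2 hinj hab (hc.trans hd.symm) with rfl | rfl
    · rfl
    · have : fourthPoint a b (fourthPoint a b c) = c := by
        refine Prod.ext ?_ ?_
        · simp only [fourthPoint]; grind
        · simp only [fourthPoint]; grind
      rw [this, Finset.pair_comm]
  base_mem := by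
    intro t _ ht
    have h : ({0, t} ×ˢ Finset.univ : Finset (F × Bool)) =
        {(0, false), (t, false), (0, true), fourthPoint (0, false) (t, false) (0, true)} := by
      ext ⟨x, ε⟩
      cases ε <;> simp [fourthPoint]
    rw [h]
    refine insert_fourthPoint_mem_planeFamily h2 (by simpa using ht.symm) (by simp) (by simp) ?_
    simp [planeInvariant, fourthPoint]
    grind
  exists_triple := by
    intro a b c _ _ _ hab hac hbc
    obtain ⟨t, ht⟩ := Finite.surjective_of_injective hinj (planeInvariant a b c)
    refine ⟨t, trivial, ?_, _, insert_fourthPoint_mem_planeFamily h2 hab hac hbc ht.symm,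
      by simp, by simp, by simp⟩
    rintro rfl
    exact planeInvariant_ne_zero h2 hinj hab hac hbc (by simpa using ht.symm)

end CharTwo

/-- The pointed systems exist over the additive group of the field with `2 ^ k` elements, if `k` is
odd. -/
theorem exists_isPointedSystem_of_card {P : Type*} [DecidableEq P] (C : Set P) (k : ℕ)
    (hk : Odd k) (hC : Nat.card C = 2 ^ k) (o : P) (ho : o ∈ C) :
    ∃ A, IsPointedSystem C o A := by
  classical
  have hk0 : k ≠ 0 := by rintro rfl; simp at hk
  have hcard := GaloisField.card 2 k hk0
  have : Finite C := Nat.finite_of_card_ne_zero (by rw [hC]; positivity)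
  have : Finite (GaloisField 2 k) := Nat.finite_of_card_ne_zero (by rw [hcard]; positivity)
  have := Fintype.ofFinite (GaloisField 2 k)
  have h2 : (2 : GaloisField 2 k) = 0 := CharTwo.two_eq_zero
  have hinj : Function.Injective fun x : GaloisField 2 k => x ^ 3 := by
    intro x y hxy
    simp only at hxy
    by_cases hy : y = 0
    · subst hy
      simpa using hxy
    · have hone : (x / y) ^ 3 = 1 := by rw [div_pow, hxy, div_self (pow_ne_zero 3 hy)]
      have hx : x / y ≠ 0 := by
        intro h
        rw [h] at hone
        simp at hone
      have hone' : (x / y) ^ (2 ^ k - 1) = 1 := by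
        rw [← hcard, Nat.card_eq_fintype_card]
        exact FiniteField.pow_card_sub_one_eq_one _ hx
      have hgcd : Nat.gcd 3 (2 ^ k - 1) = 1 := by
        rw [← Nat.Coprime, Nat.Prime.coprime_iff_not_dvd Nat.prime_three]
        obtain ⟨j, rfl⟩ := hk
        have : 2 ^ (2 * j + 1) % 3 = 2 := by
          rw [pow_succ, pow_mul, Nat.mul_mod, Nat.pow_mod]
          norm_num
        have := Nat.one_le_two_pow (n := 2 * j + 1)
        generalize 2 ^ (2 * j + 1) = q at *
        omega
      have := pow_gcd_eq_one.2 ⟨hone, hone'⟩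
      rw [hgcd, pow_one] at this
      rwa [div_eq_one_iff_eq hy] at this
  obtain ⟨e⟩ : Nonempty (GaloisField 2 k ≃ C) :=
    Finite.card_eq.1 (hcard.trans hC.symm)
  let e' := (Equiv.swap 0 (e.symm ⟨o, ho⟩)).trans e
  let f : GaloisField 2 k ↪ P := e'.toEmbedding.trans (Function.Embedding.subtype _)
  have hf : f 0 = o := by simp [f, e']
  have hr : Set.range f = C := by
    have : (f : GaloisField 2 k → P) = Subtype.val ∘ e' := rfl
    rw [this, Set.range_comp, e'.surjective.range_eq, Set.image_univ, Subtype.range_coe]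
  have h := (isPointedSystem_planeFamily h2 hinj).push f
  rw [hf, hr] at h
  exact ⟨_, h⟩

section HalfLine

variable {F : Type*} [Field F]

/-- The properties of the fields with 7, 31 and 127 elements used in the construction of
transversal systems: `-1` is not a square, and there is a primitive cube root of unity `ω` such
that `ω - 1` is a square. -/
structure IsTransversalField (ω θ : F) : Prop where
  sq_add_add_one : ω ^ 2 + ω + 1 = 0
  sub_one : ω - 1 = θ ^ 2
  three_ne_zero : (3 : F) ≠ 0
  not_isSquare_neg_one : ¬ IsSquare (-1 : F)
  isSquare_or (x : F) : IsSquare x ∨ IsSquare (-x)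

/-- The determinant of two vectors of the plane. -/
def cross (u v : F × F) : F := u.1 * v.2 - u.2 * v.1

open Classical in
/-- The class of a nonzero vector up to multiplication by nonzero squares. The first component is
the line spanned by the vector. -/
noncomputable def halfLine (u : F × F) : Option F × Bool :=
  if u.2 = 0 then (none, decide (IsSquare u.1)) else (some (u.1 / u.2), decide (IsSquare u.2))

theorem ne_zero_of_cross_ne_zero {u v : F × F} (h : cross u v ≠ 0) : u ≠ 0 ∧ v ≠ 0 := by
  constructor <;> rintro rfl <;> simp [cross] at h

theorem exists_eq_smul_of_cross_eq_zero {u v : F × F} (hu : u ≠ 0) (h : cross u v = 0) :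
    ∃ κ : F, v = κ • u := by
  obtain ⟨x, y⟩ := u
  obtain ⟨z, w⟩ := v
  simp only [cross] at h
  by_cases hy : y = 0
  · subst hy
    have hx : x ≠ 0 := by
      rintro rfl
      exact hu rfl
    refine ⟨z / x, Prod.ext ?_ ?_⟩ <;> simp <;> grind
  · refine ⟨w / y, Prod.ext ?_ ?_⟩ <;> simp <;> grind

theorem halfLine_fst_eq_iff {u v : F × F} (hu : u ≠ 0) (hv : v ≠ 0) :
    (halfLine u).1 = (halfLine v).1 ↔ cross u v = 0 := by
  obtain ⟨x, y⟩ := u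
  obtain ⟨z, w⟩ := v
  simp only [ne_eq, Prod.mk_eq_zero] at hu hv
  simp only [halfLine, cross]
  split_ifs with hy hw hw <;> simp <;> grind

theorem halfLine_fst_smul {s : F} (hs : s ≠ 0) (u : F × F) :
    (halfLine (s • u)).1 = (halfLine u).1 := by
  by_cases hu : u.2 = 0
  · simp [halfLine, hu]
  · simp [halfLine, hu, hs, mul_div_mul_left _ _ hs]

theorem isSquare_mul_left_iff {s x : F} (hs : s ≠ 0) (h : IsSquare s) :
    IsSquare (s * x) ↔ IsSquare x := by
  refine ⟨fun h' => ?_, h.mul⟩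
  simpa [hs] using h.inv.mul h'

theorem halfLine_smul {s : F} (hs : s ≠ 0) (h : IsSquare s) (u : F × F) :
    halfLine (s • u) = halfLine u := by
  by_cases hu : u.2 = 0
  · simp [halfLine, hu, isSquare_mul_left_iff hs h]
  · simp [halfLine, hu, hs, mul_div_mul_left _ _ hs, isSquare_mul_left_iff hs h]

theorem IsTransversalField.isSquare_mul {ω θ : F} (hF : IsTransversalField ω θ) {x y : F}
    (h : IsSquare x ↔ IsSquare y) : IsSquare (x * y) := by
  by_cases hx : IsSquare x
  · exact hx.mul (h.1 hx)
  · have hy : ¬ IsSquare y := h.not.1 hx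
    simpa using ((hF.isSquare_or x).resolve_left hx).mul ((hF.isSquare_or y).resolve_left hy)

theorem IsTransversalField.halfLine_smul_eq {ω θ : F} (hF : IsTransversalField ω θ) {s : F}
    {u : F × F} (hu : u ≠ 0) (hs : s ≠ 0) (h : halfLine (s • u) = halfLine u) : IsSquare s := by
  by_contra hsq
  obtain ⟨x, y⟩ := u
  have key : ∀ z : F, z ≠ 0 → ¬ (IsSquare (s * z) ↔ IsSquare z) := by
    intro z hz h'
    have h1 := hF.isSquare_mul h'
    rw [mul_assoc, mul_comm, isSquare_mul_left_iff (mul_ne_zero hz hz) ⟨z, rfl⟩] at h1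
    exact hsq h1
  by_cases hy : y = 0
  · simp only [halfLine, hy, Prod.smul_mk, smul_zero, if_true, Prod.mk.injEq, decide_eq_decide,
      true_and] at h
    refine key x ?_ h
    rintro rfl
    exact hu (by rw [hy]; rfl)
  · have hy' : s * y ≠ 0 := mul_ne_zero hs hy
    simp only [halfLine, Prod.smul_mk, smul_eq_mul, if_neg hy, if_neg hy', Prod.mk.injEq,
      decide_eq_decide] at h
    exact key y hy h.2

theorem IsTransversalField.exists_halfLine_eq {ω θ : F} (hF : IsTransversalField ω θ)
    (a : Option F × Bool) : ∃ u ≠ 0, halfLine u = a := by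
  obtain ⟨_ | x, _ | _⟩ := a
  · exact ⟨(-1, 0), by simp, by simp [halfLine, hF.not_isSquare_neg_one]⟩
  · exact ⟨(1, 0), by simp, by simp [halfLine]⟩
  · exact ⟨(-x, -1), by simp, by simp [halfLine, hF.not_isSquare_neg_one]⟩
  · exact ⟨(x, 1), by simp, by simp [halfLine]⟩

theorem IsTransversalField.exists_eq_pow_four {ω θ : F} (hF : IsTransversalField ω θ) {κ : F}
    (h : IsSquare κ) : ∃ s, κ = s ^ 2 ∧ IsSquare s := by
  obtain ⟨r, rfl⟩ := h
  rcases hF.isSquare_or r with h | h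
  · exact ⟨r, by ring, h⟩
  · exact ⟨-r, by ring, h⟩

/-- The blocks of the transversal systems. -/
noncomputable def crossBlock (ω : F) (e f : F × F) : Finset (Option F × Bool) := by
  classical
  exact {halfLine f, halfLine (e - f), halfLine (ω • e - f), halfLine (ω ^ 2 • e - f)}

/-- The block sets of the transversal systems. -/
def crossFamily (ω : F) (t : Option F) : Set (Finset (Option F × Bool)) :=
  {B | ∃ e f, cross e f = 1 ∧ (halfLine e).1 = t ∧ B = crossBlock ω e f}

namespace IsTransversalField

variable {ω θ : F}

theorem ne_one (hF : IsTransversalField ω θ) : ω ≠ 1 := by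
  rintro rfl
  have := hF.sq_add_add_one
  have := hF.three_ne_zero
  grind

theorem cube_eq_one (hF : IsTransversalField ω θ) : ω ^ 3 = 1 := by
  have := hF.sq_add_add_one
  grind

theorem cube_eq_one_iff (hF : IsTransversalField ω θ) {z : F} :
    z ^ 3 = 1 ↔ z = 1 ∨ z = ω ∨ z = ω ^ 2 := by
  have h := hF.sq_add_add_one
  constructor
  · intro hz
    have : (z - 1) * ((z - ω) * (z - ω ^ 2)) = 0 := by grind
    simpa [sub_eq_zero] using this
  · rintro (rfl | rfl | rfl) <;> grind

theorem mem_crossBlock (hF : IsTransversalField ω θ) {e f : F × F} {a : Option F × Bool} :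
    a ∈ crossBlock ω e f ↔ ∃ c x : F, (c = 1 ∧ x = 0 ∨ c = -1 ∧ x ^ 3 = -1) ∧
      a = halfLine (c • (f + x • e)) := by
  have h : ∀ x : F, x ^ 3 = -1 ↔ x = -1 ∨ x = -ω ∨ x = -ω ^ 2 := by
    intro x
    have := hF.cube_eq_one_iff (z := -x)
    rwa [Odd.neg_pow (by decide), neg_eq_iff_eq_neg, neg_eq_iff_eq_neg, neg_eq_iff_eq_neg,
      neg_eq_iff_eq_neg] at this
  simp [crossBlock, h, or_and_right, exists_or, sub_eq_neg_add]

theorem fst_halfLine_inj {e f : F × F} (hef : cross e f = 1) {c c' x x' : F} (hc : c ≠ 0)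
    (hc' : c' ≠ 0) (h : (halfLine (c • (f + x • e))).1 = (halfLine (c' • (f + x' • e))).1) :
    x = x' := by
  have key : cross (f + x • e) (f + x' • e) = x - x' := by
    simp only [cross, Prod.fst_add, Prod.snd_add, Prod.smul_fst, Prod.smul_snd, smul_eq_mul] at *
    linear_combination (x - x') * hef
  have hne : ∀ y : F, f + y • e ≠ 0 := by
    intro y
    refine (ne_zero_of_cross_ne_zero (u := e) ?_).2
    simp only [cross, Prod.fst_add, Prod.snd_add, Prod.smul_fst, Prod.smul_snd, smul_eq_mul] at *
    grind
  rw [halfLine_fst_smul hc, halfLine_fst_smul hc', halfLine_fst_eq_iff (hne x) (hne x'), key] at h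
  exact sub_eq_zero.1 h

theorem isSquare_mul_of_halfLine_eq (hF : IsTransversalField ω θ) {e f : F × F}
    (hef : cross e f = 1) {c c' x x' : F} (hc : c ≠ 0) (hc' : c' ≠ 0)
    (h : halfLine (c • (f + x • e)) = halfLine (c' • (f + x' • e))) :
    x = x' ∧ IsSquare (c * c') := by
  obtain rfl := fst_halfLine_inj hef hc hc' (congrArg Prod.fst h)
  refine ⟨rfl, ?_⟩
  have hne : f + x • e ≠ 0 := by
    refine (ne_zero_of_cross_ne_zero (u := e) ?_).2
    simp only [cross, Prod.fst_add, Prod.snd_add, Prod.smul_fst, Prod.smul_snd, smul_eq_mul] at *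
    grind
  have h1 : (c / c') • c' • (f + x • e) = c • (f + x • e) := by
    rw [smul_smul, div_mul_cancel₀ c hc']
  rw [← h1] at h
  have h2 := hF.halfLine_smul_eq (smul_ne_zero hc' hne) (div_ne_zero hc hc') h
  rw [← isSquare_mul_left_iff (mul_ne_zero hc' hc') ⟨c', rfl⟩] at h2
  convert h2 using 1
  field_simp

theorem crossBlock_transversal (hF : IsTransversalField ω θ) {e f : F × F} (hef : cross e f = 1)
    {a b : Option F × Bool} (ha : a ∈ crossBlock ω e f) (hb : b ∈ crossBlock ω e f)
    (hab : a.1 = b.1) : a = b := by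
  obtain ⟨c, x, hcx, rfl⟩ := hF.mem_crossBlock.1 ha
  obtain ⟨c', x', hcx', rfl⟩ := hF.mem_crossBlock.1 hb
  obtain rfl := fst_halfLine_inj hef (by rintro rfl; simp at hcx) (by rintro rfl; simp at hcx') hab
  obtain rfl : c = c' := by
    rcases hcx with ⟨rfl, rfl⟩ | ⟨rfl, h⟩ <;> rcases hcx' with ⟨rfl, h'⟩ | ⟨rfl, h'⟩ <;> simp_all
  rfl

theorem card_crossBlock (hF : IsTransversalField ω θ) {e f : F × F} (hef : cross e f = 1) :
    (crossBlock ω e f).card = 4 := by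
  classical
  have h1 := hF.ne_one
  have h2 := hF.sq_add_add_one
  have hne : ∀ {u v : F × F}, cross u v ≠ 0 → halfLine u ≠ halfLine v := by
    intro u v h h'
    obtain ⟨hu, hv⟩ := ne_zero_of_cross_ne_zero h
    exact h ((halfLine_fst_eq_iff hu hv).1 (congrArg Prod.fst h'))
  simp only [cross] at hef hne
  rw [crossBlock, Finset.card_insert_of_notMem, Finset.card_insert_of_notMem,
    Finset.card_insert_of_notMem, Finset.card_singleton]
  all_goals
    simp only [Finset.mem_insert, Finset.mem_singleton, not_or]
    repeat' apply And.intro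
  all_goals
    apply hne
    simp only [Prod.fst_sub, Prod.snd_sub, Prod.smul_fst, Prod.smul_snd, smul_eq_mul]
    intro h
    grind

theorem fst_ne_of_mem_crossBlock (hF : IsTransversalField ω θ) {e f : F × F}
    (hef : cross e f = 1) {a : Option F × Bool} (ha : a ∈ crossBlock ω e f) :
    a.1 ≠ (halfLine e).1 := by
  obtain ⟨c, x, hcx, rfl⟩ := hF.mem_crossBlock.1 ha
  have hc : c ≠ 0 := by rintro rfl; simp at hcx
  have h : cross (f + x • e) e ≠ 0 := by
    simp only [cross, Prod.fst_add, Prod.snd_add, Prod.smul_fst, Prod.smul_snd, smul_eq_mul] at *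
    grind
  obtain ⟨hu, hv⟩ := ne_zero_of_cross_ne_zero h
  rwa [halfLine_fst_smul hc, Ne, halfLine_fst_eq_iff hu hv]

theorem eq_zero_of_sub_pow_three_eq (h3 : (3 : F) ≠ 0) {x y ρ τ : F} (hxy : x ≠ y)
    (hx : x ^ 3 = -1) (hy : y ^ 3 = -1) (hx' : (x - ρ) ^ 3 = -τ) (hy' : (y - ρ) ^ 3 = -τ)
    (hτ : τ ≠ -1) : ρ = 0 ∧ τ = 1 := by
  have hsub := sub_ne_zero.2 hxy
  have h1 : x ^ 2 + x * y + y ^ 2 = 0 := by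
    apply mul_left_cancel₀ hsub
    linear_combination hx - hy
  have h2 : ρ * (ρ - (x + y)) = 0 := by
    apply mul_left_cancel₀ (mul_ne_zero h3 hsub)
    linear_combination hx' - hy' - hx + hy
  rcases mul_eq_zero.1 h2 with rfl | h2
  · exact ⟨rfl, by linear_combination hx' - hx⟩
  · refine absurd ?_ hτ
    rw [sub_eq_zero.1 h2] at hx'
    linear_combination hx' + hy

theorem crossBlock_unique (hF : IsTransversalField ω θ) {e f e' f' : F × F}
    (hef : cross e f = 1) (hef' : cross e' f' = 1) (he : (halfLine e).1 = (halfLine e').1)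
    {a b : Option F × Bool} (hab : a ≠ b) (ha : a ∈ crossBlock ω e f) (hb : b ∈ crossBlock ω e f)
    (ha' : a ∈ crossBlock ω e' f') (hb' : b ∈ crossBlock ω e' f') :
    crossBlock ω e f = crossBlock ω e' f' := by
  obtain ⟨he0, -⟩ := ne_zero_of_cross_ne_zero (hef.trans_ne one_ne_zero)
  obtain ⟨he0', -⟩ := ne_zero_of_cross_ne_zero (hef'.trans_ne one_ne_zero)
  obtain ⟨s, rfl⟩ := exists_eq_smul_of_cross_eq_zero he0 ((halfLine_fst_eq_iff he0 he0').1 he)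
  have hs : s ≠ 0 := by rintro rfl; simp at he0'
  obtain ⟨ρ, hρ⟩ : ∃ ρ, s • f' - f = ρ • e := by
    apply exists_eq_smul_of_cross_eq_zero he0
    simp only [cross, Prod.fst_sub, Prod.snd_sub, Prod.smul_fst, Prod.smul_snd, smul_eq_mul] at *
    linear_combination hef' - hef
  have hpt : ∀ c x : F, halfLine (c • (f' + x • s • e)) =
      halfLine ((s * c) • (f + (ρ + s ^ 2 * x) • e)) := by
    intro c x
    rw [← halfLine_smul (pow_ne_zero 2 hs) (IsSquare.sq s)]
    congr 1
    have hf' : s • f' = f + ρ • e := by rw [← hρ, add_sub_cancel]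
    rw [pow_two, mul_smul, mul_smul, smul_comm s c, smul_add, hf']
    module
  obtain ⟨c₁, x₁, h₁, rfl⟩ := hF.mem_crossBlock.1 ha
  obtain ⟨c₂, x₂, h₂, rfl⟩ := hF.mem_crossBlock.1 hb
  obtain ⟨c₁', x₁', h₁', ha'⟩ := hF.mem_crossBlock.1 ha'
  obtain ⟨c₂', x₂', h₂', hb'⟩ := hF.mem_crossBlock.1 hb'
  have hc : ∀ {c x : F}, (c = 1 ∧ x = 0 ∨ c = -1 ∧ x ^ 3 = -1) → c ≠ 0 := by
    rintro c x h rfl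
    simp at h
  rw [hpt] at ha' hb'
  obtain ⟨hx₁, hs₁⟩ := hF.isSquare_mul_of_halfLine_eq hef (hc h₁) (mul_ne_zero hs (hc h₁')) ha'
  obtain ⟨hx₂, hs₂⟩ := hF.isSquare_mul_of_halfLine_eq hef (hc h₂) (mul_ne_zero hs (hc h₂')) hb'
  have hx : x₁ ≠ x₂ := by
    rintro rfl
    exact hab (hF.crossBlock_transversal hef ha hb
      (by rw [halfLine_fst_smul (hc h₁), halfLine_fst_smul (hc h₂)]))
  have hsq : ¬ (IsSquare s ∧ IsSquare (-s)) := by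
    rintro ⟨h, h'⟩
    apply hF.not_isSquare_neg_one
    have := h.inv.mul h'
    simpa [hs] using this
  have hneg : (s ^ 2) ^ 3 ≠ -1 := fun h => hF.not_isSquare_neg_one ⟨s ^ 3, by rw [← h]; ring⟩
  have key : ρ = 0 ∧ (s ^ 2) ^ 3 = 1 ∧ IsSquare s := by
    clear hpt ha hb ha' hb' hab
    have h3 := hF.three_ne_zero
    generalize hσ : s ^ 2 = σ at *
    rcases hF.isSquare_or s with h | h
    · have h' : ¬ IsSquare (-s) := fun h' => hsq ⟨h, h'⟩
      rcases h₁ with ⟨rfl, rfl⟩ | ⟨rfl, h₁⟩ <;> rcases h₁' with ⟨rfl, rfl⟩ | ⟨rfl, h₁'⟩ <;>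
        simp only [one_mul, mul_one, neg_mul, mul_neg, neg_neg] at hs₁ <;> try contradiction
      all_goals
        rcases h₂ with ⟨rfl, rfl⟩ | ⟨rfl, h₂⟩ <;> rcases h₂' with ⟨rfl, rfl⟩ | ⟨rfl, h₂'⟩ <;>
          simp only [one_mul, mul_one, neg_mul, mul_neg, neg_neg] at hs₂ <;> try contradiction
      · have hρ0 : ρ = 0 := by linear_combination -hx₁
        subst hρ0
        refine ⟨rfl, ?_, h⟩
        rw [zero_add] at hx₂
        rw [hx₂, mul_pow, h₂'] at h₂
        linear_combination -h₂
      · have hρ0 : ρ = 0 := by linear_combination -hx₂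
        subst hρ0
        refine ⟨rfl, ?_, h⟩
        rw [zero_add] at hx₁
        rw [hx₁, mul_pow, h₁'] at h₁
        linear_combination -h₁
      · obtain ⟨h0, h1⟩ := eq_zero_of_sub_pow_three_eq h3 (ρ := ρ) (τ := σ ^ 3) hx h₁ h₂
          (by rw [hx₁, add_sub_cancel_left, mul_pow, h₁', mul_neg_one])
          (by rw [hx₂, add_sub_cancel_left, mul_pow, h₂', mul_neg_one]) hneg
        exact ⟨h0, h1, h⟩
    · have h' : ¬ IsSquare s := fun h' => hsq ⟨h', h⟩
      exfalso
      rcases h₁ with ⟨rfl, rfl⟩ | ⟨rfl, h₁⟩ <;> rcases h₁' with ⟨rfl, rfl⟩ | ⟨rfl, h₁'⟩ <;>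
        simp only [one_mul, mul_one, neg_mul, mul_neg, neg_neg] at hs₁ <;> try contradiction
      all_goals
        rcases h₂ with ⟨rfl, rfl⟩ | ⟨rfl, h₂⟩ <;> rcases h₂' with ⟨rfl, rfl⟩ | ⟨rfl, h₂'⟩ <;>
          simp only [one_mul, mul_one, neg_mul, mul_neg, neg_neg] at hs₂ <;> try contradiction
      · apply hneg
        have : x₂ = -(σ * x₁') := by linear_combination hx₂ - hx₁
        rw [this, Odd.neg_pow (by decide), mul_pow, h₁'] at h₂
        linear_combination h₂
      · apply hneg
        have : x₁ = -(σ * x₂') := by linear_combination hx₁ - hx₂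
        rw [this, Odd.neg_pow (by decide), mul_pow, h₂'] at h₁
        linear_combination h₁
      · exact hx (by linear_combination hx₁ - hx₂)
  obtain ⟨rfl, hσ, hs'⟩ := key
  refine (Finset.eq_of_subset_of_card_le (fun a ha => ?_) ?_).symm
  · obtain ⟨c, x, h, rfl⟩ := hF.mem_crossBlock.1 ha
    rw [hpt]
    refine hF.mem_crossBlock.2 ⟨c, s ^ 2 * x, ?_, ?_⟩
    · rcases h with ⟨rfl, rfl⟩ | ⟨rfl, h⟩
      · simp
      · exact Or.inr ⟨rfl, by rw [mul_pow, hσ, h, one_mul]⟩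
    · rw [mul_smul, halfLine_smul hs hs', zero_add]
  · rw [hF.card_crossBlock hef, hF.card_crossBlock hef']

theorem halfLine_mem_crossBlock (hF : IsTransversalField ω θ) {e f u : F × F} {s z : F}
    (hs : s ≠ 0) (hs' : IsSquare s) (hz : z ^ 3 = 1) (hu : u = s • (z • e - f)) :
    halfLine u ∈ crossBlock ω e f := by
  refine hF.mem_crossBlock.2 ⟨-1, -z, Or.inr ⟨rfl, by rw [Odd.neg_pow (by decide), hz]⟩, ?_⟩
  rw [hu, halfLine_smul hs hs']
  congr 1
  module

theorem halfLine_mem_crossBlock_base (hF : IsTransversalField ω θ) {e f u : F × F} {s : F}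
    (hs : s ≠ 0) (hs' : IsSquare s) (hu : u = s • f) : halfLine u ∈ crossBlock ω e f := by
  refine hF.mem_crossBlock.2 ⟨1, 0, Or.inl ⟨rfl, rfl⟩, ?_⟩
  rw [hu, halfLine_smul hs hs']
  congr 1
  module

theorem crossBlock_mem_crossFamily {e f : F × F} (hef : cross e f = 1) :
    crossBlock ω e f ∈ crossFamily ω (halfLine e).1 :=
  ⟨e, f, hef, rfl, rfl⟩

theorem isSquare_omega (hF : IsTransversalField ω θ) : IsSquare ω :=
  ⟨ω ^ 2, by linear_combination -ω * hF.cube_eq_one⟩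

theorem omega_ne_zero (hF : IsTransversalField ω θ) : ω ≠ 0 := by
  rintro rfl
  simpa using hF.sq_add_add_one

theorem isSquare_sub_one (hF : IsTransversalField ω θ) : IsSquare (ω - 1) := by
  rw [hF.sub_one]
  exact IsSquare.sq θ

/-- A vector can be replaced by one on the same half-line whose determinant with a given vector is
`1` or `-1`. -/
theorem exists_cross_eq (hF : IsTransversalField ω θ) (w u : F × F) (h : cross w u ≠ 0) :
    ∃ s : F, s ≠ 0 ∧ IsSquare s ∧ (s * cross w u = 1 ∨ s * cross w u = -1) := by
  rcases hF.isSquare_or (cross w u) with h' | h'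
  · exact ⟨(cross w u)⁻¹, inv_ne_zero h, h'.inv, Or.inl (inv_mul_cancel₀ h)⟩
  · refine ⟨(-cross w u)⁻¹, inv_ne_zero (neg_ne_zero.2 h), h'.inv, Or.inr ?_⟩
    rw [inv_neg, neg_mul, inv_mul_cancel₀ h]

theorem exists_pair_of_cross_eq (hF : IsTransversalField ω θ) {w u v : F × F}
    (huv : cross u v ≠ 0) (hu : cross w u = -1) (hv : cross w v = -1) :
    ∃ B ∈ crossFamily ω (halfLine w).1, halfLine u ∈ B ∧ halfLine v ∈ B := by
  obtain ⟨hw, -⟩ := ne_zero_of_cross_ne_zero (hu.trans_ne (neg_ne_zero.2 one_ne_zero))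
  obtain ⟨κ, hκ⟩ := exists_eq_smul_of_cross_eq_zero hw (v := v - u) (by
    simp only [cross, Prod.fst_sub, Prod.snd_sub] at *
    linear_combination hv - hu)
  have hκ0 : κ ≠ 0 := by
    rintro rfl
    rw [zero_smul, sub_eq_zero] at hκ
    exact huv (by rw [hκ, cross]; ring)
  have h1 := sub_ne_zero.2 hF.ne_one
  wlog h : IsSquare (κ / (ω - 1)) generalizing u v κ
  · obtain ⟨B, hB, hvB, huB⟩ := this (u := v) (v := u) (κ := -κ)
      (fun h => huv (by simp only [cross] at *; linear_combination -h)) hv hu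
      (by rw [neg_smul, ← hκ, neg_sub]) (neg_ne_zero.2 hκ0)
      (by rw [neg_div]; exact (hF.isSquare_or _).resolve_left h)
    exact ⟨B, hB, huB, hvB⟩
  obtain ⟨s, hs, hs'⟩ := hF.exists_eq_pow_four h
  have hs0 : s ≠ 0 := by
    rintro rfl
    simp [hκ0, h1] at hs
  obtain rfl : κ = s ^ 2 * (ω - 1) := by rw [← hs, div_mul_cancel₀ _ h1]
  obtain rfl : v = u + (s ^ 2 * (ω - 1)) • w := by rw [← hκ, add_sub_cancel]
  refine ⟨crossBlock ω (s • w) (s • w - s⁻¹ • u), ?_, ?_, ?_⟩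
  · rw [← halfLine_fst_smul hs0 w]
    refine crossBlock_mem_crossFamily ?_
    simp only [cross, Prod.fst_sub, Prod.snd_sub, Prod.smul_fst, Prod.smul_snd, smul_eq_mul] at *
    field_simp
    linear_combination -hu
  · refine hF.halfLine_mem_crossBlock hs0 hs' (one_pow 3) ?_
    rw [one_smul, sub_sub_cancel, smul_smul, mul_inv_cancel₀ hs0, one_smul]
  · refine hF.halfLine_mem_crossBlock hs0 hs' hF.cube_eq_one ?_
    ext <;> simp <;> field_simp <;> ring

theorem exists_pair_of_cross_eq_neg (hF : IsTransversalField ω θ) {w u v : F × F}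
    (huv : cross u v ≠ 0) (hu : cross w u = 1) (hv : cross w v = -1) :
    ∃ B ∈ crossFamily ω (halfLine w).1, halfLine u ∈ B ∧ halfLine v ∈ B := by
  obtain ⟨hw, -⟩ := ne_zero_of_cross_ne_zero (hu.trans_ne one_ne_zero)
  obtain ⟨κ, hκ⟩ := exists_eq_smul_of_cross_eq_zero hw (v := u + v) (by
    simp only [cross, Prod.fst_add, Prod.snd_add] at *
    linear_combination hv + hu)
  have hκ0 : κ ≠ 0 := by
    rintro rfl
    rw [zero_smul] at hκ
    exact huv (by rw [eq_neg_of_add_eq_zero_right hκ, cross, Prod.fst_neg, Prod.snd_neg]; ring)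
  wlog h : IsSquare κ generalizing u v w κ
  · obtain ⟨B, hB, hvB, huB⟩ := this (u := v) (v := u) (w := (-1 : F) • w) (κ := -κ)
      (fun h => huv (by simp only [cross] at *; linear_combination -h))
      (by simp only [cross, Prod.smul_fst, Prod.smul_snd, smul_eq_mul] at *; linear_combination -hv)
      (by simp only [cross, Prod.smul_fst, Prod.smul_snd, smul_eq_mul] at *; linear_combination -hu)
      (smul_ne_zero (by simp) hw) (by rw [add_comm, hκ]; module) (neg_ne_zero.2 hκ0)
      ((hF.isSquare_or _).resolve_left h)
    rw [halfLine_fst_smul (by simp)] at hB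
    exact ⟨B, hB, huB, hvB⟩
  obtain ⟨s, rfl, hs'⟩ := hF.exists_eq_pow_four h
  have hs0 : s ≠ 0 := by
    rintro rfl
    simp at hκ0
  obtain rfl : v = s ^ 2 • w - u := by rw [← hκ, add_sub_cancel_left]
  refine ⟨crossBlock ω (s • w) (s⁻¹ • u), ?_, ?_, ?_⟩
  · rw [← halfLine_fst_smul hs0 w]
    refine crossBlock_mem_crossFamily ?_
    simp only [cross, Prod.smul_fst, Prod.smul_snd, smul_eq_mul] at *
    field_simp
    linear_combination hu
  · refine hF.halfLine_mem_crossBlock_base hs0 hs' ?_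
    rw [smul_smul, mul_inv_cancel₀ hs0, one_smul]
  · refine hF.halfLine_mem_crossBlock hs0 hs' (one_pow 3) ?_
    ext <;> simp <;> field_simp

theorem exists_pair_crossFamily (hF : IsTransversalField ω θ) (t : Option F)
    (a b : Option F × Bool) (ha : a.1 ≠ t) (hb : b.1 ≠ t) (hab : a.1 ≠ b.1) :
    ∃ B ∈ crossFamily ω t, a ∈ B ∧ b ∈ B := by
  obtain ⟨w, hw, hwt⟩ := hF.exists_halfLine_eq (t, false)
  obtain rfl : (halfLine w).1 = t := congrArg Prod.fst hwt
  obtain ⟨u, hu, rfl⟩ := hF.exists_halfLine_eq a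
  obtain ⟨v, hv, rfl⟩ := hF.exists_halfLine_eq b
  rw [ne_comm, Ne, halfLine_fst_eq_iff hw hu] at ha
  rw [ne_comm, Ne, halfLine_fst_eq_iff hw hv] at hb
  rw [Ne, halfLine_fst_eq_iff hu hv] at hab
  obtain ⟨r, hr0, hr, hr'⟩ := hF.exists_cross_eq w u ha
  obtain ⟨s, hs0, hs, hs'⟩ := hF.exists_cross_eq w v hb
  have hsmul : ∀ (c : F) (x y : F × F), cross x (c • y) = c * cross x y := by
    intro c x y
    simp only [cross, Prod.smul_fst, Prod.smul_snd, smul_eq_mul]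
    ring
  have hsmul' : ∀ (c : F) (x y : F × F), cross (c • x) y = c * cross x y := by
    intro c x y
    simp only [cross, Prod.smul_fst, Prod.smul_snd, smul_eq_mul]
    ring
  rw [← hsmul] at hr' hs'
  have huv : cross (r • u) (s • v) ≠ 0 := by
    rw [hsmul, hsmul']
    exact mul_ne_zero hs0 (mul_ne_zero hr0 hab)
  have hvu : cross (s • v) (r • u) ≠ 0 := by
    intro h
    apply huv
    simp only [cross] at *
    linear_combination -h
  rw [← halfLine_smul hr0 hr u, ← halfLine_smul hs0 hs v]
  rcases hr' with hr' | hr' <;> rcases hs' with hs' | hs'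
  · rw [← halfLine_fst_smul (neg_ne_zero.2 one_ne_zero) w]
    exact hF.exists_pair_of_cross_eq huv (by rw [hsmul', hr']; simp) (by rw [hsmul', hs']; simp)
  · exact hF.exists_pair_of_cross_eq_neg huv hr' hs'
  · obtain ⟨B, hB, h, h'⟩ := hF.exists_pair_of_cross_eq_neg hvu hs' hr'
    exact ⟨B, hB, h', h⟩
  · exact hF.exists_pair_of_cross_eq huv hr' hs'

theorem exists_triple_of_add_eq_zero (hF : IsTransversalField ω θ) {u v w : F × F}
    (huv : cross u v ≠ 0) (h : u + v + w = 0) :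
    ∃ t, ∃ B ∈ crossFamily ω t, halfLine u ∈ B ∧ halfLine v ∈ B ∧ halfLine w ∈ B := by
  have h1 := sub_ne_zero.2 hF.ne_one
  have h0 := hF.omega_ne_zero
  wlog hsq : IsSquare (cross u v / (ω * (ω - 1))) generalizing u v
  · have hvu : cross v u = -cross u v := by simp only [cross]; ring
    obtain ⟨t, B, hB, hv, hu, hw⟩ := this (u := v) (v := u) (by rw [hvu]; exact neg_ne_zero.2 huv)
      (by rw [add_comm v u, h]) (by rw [hvu, neg_div]; exact (hF.isSquare_or _).resolve_left hsq)
    exact ⟨t, B, hB, hu, hv, hw⟩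
  obtain ⟨s, hs, hs'⟩ := hF.exists_eq_pow_four hsq
  have hs0 : s ≠ 0 := by
    rintro rfl
    simp [huv, h0, h1] at hs
  rw [div_eq_iff (mul_ne_zero h0 h1)] at hs
  obtain ⟨x, rfl⟩ : ∃ x, u = s • x := ⟨s⁻¹ • u, by rw [smul_smul, mul_inv_cancel₀ hs0, one_smul]⟩
  obtain ⟨e, rfl⟩ : ∃ e, v = (s * ω) • (x + (ω - 1) • e) := by
    refine ⟨(ω - 1)⁻¹ • ((s * ω)⁻¹ • v - x), ?_⟩
    rw [smul_smul, mul_inv_cancel₀ h1, one_smul, add_sub_cancel, smul_smul,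
      mul_inv_cancel₀ (mul_ne_zero hs0 h0), one_smul]
  obtain rfl : w = (s * ω ^ 2) • (ω ^ 2 • e - (e - x)) := by
    rw [eq_neg_of_add_eq_zero_right h]
    have := hF.sq_add_add_one
    ext <;> simp <;> grind
  have hω := hF.isSquare_omega
  refine ⟨_, crossBlock ω e (e - x), crossBlock_mem_crossFamily ?_, ?_, ?_, ?_⟩
  · apply mul_left_cancel₀ (mul_ne_zero (pow_ne_zero 2 hs0) (mul_ne_zero h0 h1))
    simp only [cross, Prod.fst_sub, Prod.snd_sub, Prod.fst_add, Prod.snd_add, Prod.smul_fst,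
      Prod.smul_snd, smul_eq_mul] at hs ⊢
    linear_combination hs
  · refine hF.halfLine_mem_crossBlock hs0 hs' (one_pow 3) ?_
    rw [one_smul, sub_sub_cancel]
  · refine hF.halfLine_mem_crossBlock (mul_ne_zero hs0 h0) (hs'.mul hω) hF.cube_eq_one ?_
    module
  · refine hF.halfLine_mem_crossBlock (mul_ne_zero hs0 (pow_ne_zero 2 h0)) (hs'.mul (hω.pow 2))
      (z := ω ^ 2) ?_ rfl
    rw [← pow_mul, mul_comm, pow_mul, hF.cube_eq_one, one_pow]

theorem exists_triple_of_add_eq (hF : IsTransversalField ω θ) {u v w : F × F}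
    (huv : cross u v ≠ 0) (h : u + v = w) :
    ∃ t, ∃ B ∈ crossFamily ω t, halfLine u ∈ B ∧ halfLine v ∈ B ∧ halfLine w ∈ B := by
  have h1 := sub_ne_zero.2 hF.ne_one
  have h0 := hF.omega_ne_zero
  wlog hsq : IsSquare (cross u v / (ω * (ω - 1))) generalizing u v
  · have hvu : cross v u = -cross u v := by simp only [cross]; ring
    obtain ⟨t, B, hB, hv, hu, hw⟩ := this (u := v) (v := u) (by rw [hvu]; exact neg_ne_zero.2 huv)
      (by rw [add_comm v u, h]) (by rw [hvu, neg_div]; exact (hF.isSquare_or _).resolve_left hsq)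
    exact ⟨t, B, hB, hu, hv, hw⟩
  obtain ⟨s, hs, hs'⟩ := hF.exists_eq_pow_four hsq
  have hs0 : s ≠ 0 := by
    rintro rfl
    simp [huv, h0, h1] at hs
  rw [div_eq_iff (mul_ne_zero h0 h1)] at hs
  obtain ⟨f, rfl⟩ : ∃ f, v = (s * (ω - 1)) • f :=
    ⟨(s * (ω - 1))⁻¹ • v, by rw [smul_smul, mul_inv_cancel₀ (mul_ne_zero hs0 h1), one_smul]⟩
  obtain ⟨e, rfl⟩ : ∃ e, u = (s * ω) • (e - f) :=
    ⟨(s * ω)⁻¹ • u + f, by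
      rw [add_sub_cancel_right, smul_smul, mul_inv_cancel₀ (mul_ne_zero hs0 h0), one_smul]⟩
  subst h
  refine ⟨_, crossBlock ω e f, crossBlock_mem_crossFamily ?_, ?_, ?_, ?_⟩
  · apply mul_left_cancel₀ (mul_ne_zero (pow_ne_zero 2 hs0) (mul_ne_zero h0 h1))
    simp only [cross, Prod.fst_sub, Prod.snd_sub, Prod.smul_fst, Prod.smul_snd, smul_eq_mul]
      at hs ⊢
    linear_combination hs
  · refine hF.halfLine_mem_crossBlock (mul_ne_zero hs0 h0) (hs'.mul hF.isSquare_omega)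
      (one_pow 3) ?_
    rw [one_smul]
  · exact hF.halfLine_mem_crossBlock_base (mul_ne_zero hs0 h1) (hs'.mul hF.isSquare_sub_one) rfl
  · refine hF.halfLine_mem_crossBlock hs0 hs' hF.cube_eq_one ?_
    module

theorem exists_triple_crossFamily (hF : IsTransversalField ω θ) (a b c : Option F × Bool)
    (hab : a.1 ≠ b.1) (hac : a.1 ≠ c.1) (hbc : b.1 ≠ c.1) :
    ∃ t, ∃ B ∈ crossFamily ω t, a ∈ B ∧ b ∈ B ∧ c ∈ B := by
  obtain ⟨u, hu, rfl⟩ := hF.exists_halfLine_eq a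
  obtain ⟨v, hv, rfl⟩ := hF.exists_halfLine_eq b
  obtain ⟨w, hw, rfl⟩ := hF.exists_halfLine_eq c
  rw [Ne, halfLine_fst_eq_iff hu hv] at hab
  rw [Ne, halfLine_fst_eq_iff hu hw] at hac
  rw [Ne, halfLine_fst_eq_iff hv hw] at hbc
  have hsq : ∀ d : F, d ≠ 0 → ∃ s, s ≠ 0 ∧ IsSquare s ∧ (d = s ∨ d = -s) := by
    intro d hd
    rcases hF.isSquare_or d with h | h
    · exact ⟨d, hd, h, Or.inl rfl⟩
    · exact ⟨-d, neg_ne_zero.2 hd, h, Or.inr (neg_neg d).symm⟩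
  have hrel : cross v w • u + (-cross u w) • v + cross u v • w = 0 := by
    ext <;> simp [cross] <;> ring
  obtain ⟨r, hr, hr', h₁⟩ := hsq _ hbc
  obtain ⟨s, hs, hs', h₂⟩ := hsq _ (neg_ne_zero.2 hac)
  obtain ⟨q, hq, hq', h₃⟩ := hsq _ hab
  have hsmul : ∀ {c d : F} {x y : F × F}, c ≠ 0 → d ≠ 0 → cross x y ≠ 0 →
      cross (c • x) (d • y) ≠ 0 := by
    intro c d x y hc hd h
    have : cross (c • x) (d • y) = c * d * cross x y := by
      simp only [cross, Prod.smul_fst, Prod.smul_snd, smul_eq_mul]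
      ring
    rw [this]
    exact mul_ne_zero (mul_ne_zero hc hd) h
  replace hab := hsmul hr hs hab
  replace hac := hsmul hr hq hac
  replace hbc := hsmul hs hq hbc
  have hu' := halfLine_smul hr hr' u
  have hv' := halfLine_smul hs hs' v
  have hw' := halfLine_smul hq hq' w
  rw [← hu', ← hv', ← hw']
  have hcyc : r • u + s • v + q • w = 0 → ∃ t, ∃ B ∈ crossFamily ω t,
      halfLine (r • u) ∈ B ∧ halfLine (s • v) ∈ B ∧ halfLine (q • w) ∈ B :=
    hF.exists_triple_of_add_eq_zero hab
  have htrans₁ : r • u + s • v = q • w → ∃ t, ∃ B ∈ crossFamily ω t,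
      halfLine (r • u) ∈ B ∧ halfLine (s • v) ∈ B ∧ halfLine (q • w) ∈ B :=
    hF.exists_triple_of_add_eq hab
  have htrans₂ : r • u + q • w = s • v → ∃ t, ∃ B ∈ crossFamily ω t,
      halfLine (r • u) ∈ B ∧ halfLine (s • v) ∈ B ∧ halfLine (q • w) ∈ B := by
    intro h
    obtain ⟨t, B, hB, h1, h2, h3⟩ := hF.exists_triple_of_add_eq hac h
    exact ⟨t, B, hB, h1, h3, h2⟩
  have htrans₃ : s • v + q • w = r • u → ∃ t, ∃ B ∈ crossFamily ω t,
      halfLine (r • u) ∈ B ∧ halfLine (s • v) ∈ B ∧ halfLine (q • w) ∈ B := by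
    intro h
    obtain ⟨t, B, hB, h1, h2, h3⟩ := hF.exists_triple_of_add_eq hbc h
    exact ⟨t, B, hB, h3, h1, h2⟩
  rcases h₁ with h₁ | h₁ <;> rcases h₂ with h₂ | h₂ <;> rcases h₃ with h₃ | h₃ <;>
    rw [h₁, h₂, h₃] at hrel <;> try simp only [neg_smul] at hrel
  · exact hcyc hrel
  · exact htrans₁ (add_neg_eq_zero.1 hrel)
  · exact htrans₂ (by linear_combination (exp := 1) hrel)
  · exact htrans₃ (by linear_combination (exp := 1) -hrel)
  · exact htrans₃ (by linear_combination (exp := 1) hrel)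
  · exact htrans₂ (by linear_combination (exp := 1) -hrel)
  · exact htrans₁ (by linear_combination (exp := 1) -hrel)
  · exact hcyc (by linear_combination (exp := 1) -hrel)

theorem isTransversalSystem_crossFamily (hF : IsTransversalField ω θ) :
    IsTransversalSystem Set.univ (crossFamily ω) where
  subset := by
    rintro _ - _ ⟨e, f, hef, rfl, rfl⟩ a ha
    exact ⟨trivial, hF.fst_ne_of_mem_crossBlock hef ha⟩
  transversal := by
    rintro _ - _ ⟨e, f, hef, -, rfl⟩ a ha b hb
    exact hF.crossBlock_transversal hef ha hb
  card_eq := by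
    rintro _ - _ ⟨e, f, hef, -, rfl⟩
    exact hF.card_crossBlock hef
  exists_pair := fun t _ a b _ _ => hF.exists_pair_crossFamily t a b
  unique := by
    rintro _ - _ ⟨e, f, hef, he, rfl⟩ _ ⟨e', f', hef', he', rfl⟩ a b hab ha hb ha' hb'
    exact hF.crossBlock_unique hef hef' (he.trans he'.symm) hab ha hb ha' hb'
  exists_triple := by
    intro a b c _ _ _ hab hac hbc
    obtain ⟨t, h⟩ := hF.exists_triple_crossFamily a b c hab hac hbc
    exact ⟨t, trivial, h⟩

end IsTransversalField

end HalfLine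

theorem exists_isTransversalField {p : ℕ} [Fact p.Prime] (hp : p = 7 ∨ p = 31 ∨ p = 127) :
    ∃ ω θ : ZMod p, IsTransversalField ω θ := by
  have h3 : (3 : ZMod p) ≠ 0 := by
    have : ((3 : ℕ) : ZMod p) ≠ 0 := by
      rw [Ne, ZMod.natCast_eq_zero_iff]
      rcases hp with rfl | rfl | rfl <;> decide
    exact_mod_cast this
  have hneg : ¬ IsSquare (-1 : ZMod p) := by
    rw [ZMod.exists_sq_eq_neg_one_iff]
    rcases hp with rfl | rfl | rfl <;> decide
  have hor : ∀ x : ZMod p, IsSquare x ∨ IsSquare (-x) := by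
    intro x
    by_contra! h
    simp only [← quadraticChar_neg_one_iff_not_isSquare] at h hneg
    obtain ⟨h1, h2⟩ := h
    rw [neg_eq_neg_one_mul, map_mul, hneg, h1] at h2
    norm_num at h2
  rcases hp with rfl | rfl | rfl
  · exact ⟨2, 1, by reduce_mod_char, by reduce_mod_char, h3, hneg, hor⟩
  · exact ⟨5, 2, by reduce_mod_char, by reduce_mod_char, h3, hneg, hor⟩
  · exact ⟨19, 48, by reduce_mod_char, by reduce_mod_char, h3, hneg, hor⟩

theorem exists_isTransversalSystem_of_card {P : Type*} {p : ℕ} [Fact p.Prime]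
    (hp : p = 7 ∨ p = 31 ∨ p = 127) (C : Set P) (hC : Nat.card C = p + 1) :
    ∃ A, IsTransversalSystem C A := by
  obtain ⟨ω, θ, hF⟩ := exists_isTransversalField hp
  have : Finite C := Nat.finite_of_card_ne_zero (by omega)
  obtain ⟨e⟩ : Nonempty (Option (ZMod p) ≃ C) := Finite.card_eq.1 (by simp [hC])
  have hr : Set.range (e.toEmbedding.trans (Function.Embedding.subtype _)) = C := by
    change Set.range (Subtype.val ∘ e) = C
    rw [Set.range_comp, e.surjective.range_eq, Set.image_univ, Subtype.range_coe]
  have h := hF.isTransversalSystem_crossFamily.push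
    (e.toEmbedding.trans (Function.Embedding.subtype _))
  rw [hr] at h
  exact ⟨_, h⟩

section InversivePlane

open OnePoint Matrix

variable {F K : Type*} [Field F] [Field K] [DecidableEq K]

/-- The general linear group acts transitively on triples of distinct points of the projective
line. -/
theorem exists_smul_eq_of_ne {x y z : OnePoint K} (hxy : x ≠ y) (hxz : x ≠ z) (hyz : y ≠ z) :
    ∃ g : GL (Fin 2) K, g • (∞ : OnePoint K) = x ∧ g • ((0 : K) : OnePoint K) = y ∧
      g • ((1 : K) : OnePoint K) = z := by
  suffices h : ∃ a b c d : K, a * d - b * c ≠ 0 ∧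
      x = (if c = 0 then ∞ else ((a / c : K) : OnePoint K)) ∧
      y = (if d = 0 then ∞ else ((b / d : K) : OnePoint K)) ∧
      z = (if c + d = 0 then ∞ else (((a + b) / (c + d) : K) : OnePoint K)) by
    obtain ⟨a, b, c, d, hdet, rfl, rfl, rfl⟩ := h
    refine ⟨GeneralLinearGroup.mkOfDetNeZero !![a, b; c, d] (by rwa [det_fin_two_of]), ?_, ?_, ?_⟩
    · simp [smul_infty_eq_ite, GeneralLinearGroup.mkOfDetNeZero]
    · simp [smul_some_eq_ite, GeneralLinearGroup.mkOfDetNeZero]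
    · simp [smul_some_eq_ite, GeneralLinearGroup.mkOfDetNeZero]
  induction x using OnePoint.rec with
  | infty =>
    induction y using OnePoint.rec with
    | infty => exact absurd rfl hxy
    | coe y =>
      induction z using OnePoint.rec with
      | infty => exact absurd rfl hxz
      | coe z =>
        have : z - y ≠ 0 := sub_ne_zero.2 fun h => hyz (by rw [h])
        exact ⟨z - y, y, 0, 1, by simpa, by simp, by simp, by simp⟩
  | coe x =>
    induction y using OnePoint.rec with
    | infty =>
      induction z using OnePoint.rec with
      | infty => exact absurd rfl hyz
      | coe z =>
        have : x - z ≠ 0 := sub_ne_zero.2 fun h => hxz (by rw [h])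
        exact ⟨x, z - x, 1, 0, by simpa, by simp, by simp, by simp⟩
    | coe y =>
      have hxy : x - y ≠ 0 := sub_ne_zero.2 fun h => hxy (by rw [h])
      induction z using OnePoint.rec with
      | infty =>
        refine ⟨x, -y, 1, -1, ?_, by simp, by simp, by simp⟩
        intro h
        exact hxy (by linear_combination -h)
      | coe z =>
        have hxz : x - z ≠ 0 := sub_ne_zero.2 fun h => hxz (by rw [h])
        have hyz : z - y ≠ 0 := sub_ne_zero.2 fun h => hyz (by rw [h])
        have hsum : z - y + (x - z) = x - y := by ring
        refine ⟨x * (z - y), y * (x - z), z - y, x - z, ?_, ?_, ?_, ?_⟩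
        · have := mul_ne_zero hxy (mul_ne_zero hxz hyz)
          intro h
          exact this (by linear_combination h)
        · rw [if_neg hyz, mul_div_cancel_right₀ _ hyz]
        · rw [if_neg hxz, mul_div_cancel_right₀ _ hxz]
        · rw [hsum, if_neg hxy, OnePoint.coe_eq_coe, eq_div_iff hxy]
          ring

theorem smul_eq_of_fix {g : GL (Fin 2) K} (hinf : g • (∞ : OnePoint K) = ∞)
    (h0 : g • ((0 : K) : OnePoint K) = (0 : K)) (h1 : g • ((1 : K) : OnePoint K) = (1 : K))
    (t : OnePoint K) : g • t = t := by
  induction t using OnePoint.rec with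
  | infty => exact hinf
  | coe t =>
    rw [smul_infty_eq_self_iff] at hinf
    have hd : g 1 1 ≠ 0 := by
      intro h
      rw [smul_some_eq_ite] at h0
      simp [h] at h0
    simp only [smul_some_eq_ite, hinf, zero_mul, zero_add, if_neg hd, OnePoint.coe_eq_coe,
      mul_zero, mul_one, div_eq_iff hd, one_mul] at h0 h1 ⊢
    linear_combination t * h1 + (1 - t) * h0

theorem eq_smul_of_smul_eq {g h : GL (Fin 2) K} (hinf : g • (∞ : OnePoint K) = h • (∞ : OnePoint K))
    (h0 : g • ((0 : K) : OnePoint K) = h • ((0 : K) : OnePoint K))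
    (h1 : g • ((1 : K) : OnePoint K) = h • ((1 : K) : OnePoint K)) (t : OnePoint K) :
    g • t = h • t := by
  have := smul_eq_of_fix (g := h⁻¹ * g) (by rw [mul_smul, hinf, inv_smul_smul])
    (by rw [mul_smul, h0, inv_smul_smul]) (by rw [mul_smul, h1, inv_smul_smul]) t
  rwa [mul_smul, inv_smul_eq_iff] at this

/-- The circles of the inversive plane given by a field extension: the images of the projective line
over the subfield. -/
def circles (f : F →+* K) : Set (Set (OnePoint K)) :=
  {C | ∃ g : GL (Fin 2) K, C = Set.range fun s : OnePoint F => g • OnePoint.map f s}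

theorem card_of_mem_circles [Finite F] {f : F →+* K} {C : Set (OnePoint K)} (hC : C ∈ circles f) :
    Nat.card C = Nat.card F + 1 := by
  obtain ⟨g, rfl⟩ := hC
  rw [Nat.card_range_of_injective]
  · exact Finite.card_option
  · exact (MulAction.injective g).comp (Option.map_injective f.injective)

theorem exists_smul_eq_of_mem_circles [DecidableEq F] {f : F →+* K} {C : Set (OnePoint K)}
    (hC : C ∈ circles f) {x y z : OnePoint K} (hxy : x ≠ y) (hxz : x ≠ z) (hyz : y ≠ z) (hx : x ∈ C)
    (hy : y ∈ C) (hz : z ∈ C) :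
    ∃ g : GL (Fin 2) K, g • (∞ : OnePoint K) = x ∧ g • ((0 : K) : OnePoint K) = y ∧
      g • ((1 : K) : OnePoint K) = z ∧
        C = Set.range fun s : OnePoint F => g • OnePoint.map f s := by
  obtain ⟨g, rfl⟩ := hC
  obtain ⟨x, rfl⟩ := hx
  obtain ⟨y, rfl⟩ := hy
  obtain ⟨z, rfl⟩ := hz
  obtain ⟨h, rfl, rfl, rfl⟩ := exists_smul_eq_of_ne (x := x) (y := y) (z := z)
    (fun h => hxy (by rw [h])) (fun h => hxz (by rw [h])) (fun h => hyz (by rw [h]))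
  refine ⟨g * h.map f, ?_, ?_, ?_, ?_⟩
  · simp [mul_smul, OnePoint.map_smul]
  · simp [mul_smul, OnePoint.map_smul]
  · simp [mul_smul, OnePoint.map_smul]
  · simp only [mul_smul, ← OnePoint.map_smul]
    exact ((MulAction.surjective h).range_comp fun s => g • OnePoint.map f s).symm

theorem isInversive_circles [DecidableEq F] [Finite K] (f : F →+* K) : IsInversive (circles f) where
  exists_circle := by
    classical
    intro x y z
    have : Finite (OnePoint K) := inferInstanceAs (Finite (Option K))
    have := Fintype.ofFinite (OnePoint K)
    have h3 : 3 ≤ Fintype.card (OnePoint K) := by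
      have : Fintype.card (OnePoint K) = Nat.card K + 1 := by
        rw [← Nat.card_eq_fintype_card]
        exact Finite.card_option
      have := Finite.one_lt_card (α := K)
      omega
    obtain ⟨T, hT, hT3⟩ := Finset.exists_superset_card_eq
      (Finset.card_le_three (a := x) (b := y) (c := z)) h3
    obtain ⟨x', y', z', hxy, hxz, hyz, rfl⟩ := Finset.card_eq_three.1 hT3
    obtain ⟨g, h1, h2, h3⟩ := exists_smul_eq_of_ne hxy hxz hyz
    have key : ∀ t ∈ ({x', y', z'} : Finset (OnePoint K)),
        t ∈ Set.range fun s : OnePoint F => g • OnePoint.map f s := by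
      intro t ht
      simp only [Finset.mem_insert, Finset.mem_singleton] at ht
      rcases ht with rfl | rfl | rfl
      · exact ⟨∞, by simp [h1]⟩
      · exact ⟨(0 : F), by simp [h2]⟩
      · exact ⟨(1 : F), by simp [h3]⟩
    exact ⟨_, ⟨g, rfl⟩, key x (hT (by simp)), key y (hT (by simp)), key z (hT (by simp))⟩
  unique := by
    intro x y z hxy hxz hyz C hC C' hC' hx hy hz hx' hy' hz'
    obtain ⟨g, h1, h2, h3, rfl⟩ := exists_smul_eq_of_mem_circles hC hxy hxz hyz hx hy hz
    obtain ⟨h, h1', h2', h3', rfl⟩ := exists_smul_eq_of_mem_circles hC' hxy hxz hyz hx' hy' hz'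
    simp only [eq_smul_of_smul_eq (h1.trans h1'.symm) (h2.trans h2'.symm) (h3.trans h3'.symm)]

end InversivePlane

theorem exists_isTripleCovering_two_pow {k : ℕ} (hk : Odd k) :
    ∃ D : Fin (2 ^ k) → Set (Finset (Fin (2 ^ k) × Bool)), IsTripleCovering D := by
  have hk0 : k ≠ 0 := by
    rintro rfl
    simp at hk
  have : Nontrivial (Fin (2 ^ k)) := Fin.nontrivial_iff_two_le.2 (Nat.le_self_pow hk0 2)
  obtain ⟨o, p, hop⟩ := exists_pair_ne (Fin (2 ^ k))
  obtain ⟨A, hA⟩ := exists_isPointedSystem_of_card (Set.univ : Set (Fin (2 ^ k))) k hk (by simp) o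
    trivial
  exact ⟨_, hA.isTripleCovering hop.symm⟩

theorem exists_isTripleCovering_galoisField {p : ℕ} [Fact p.Prime] (hp : p = 7 ∨ p = 31 ∨ p = 127)
    {n : ℕ} (hn : n ≠ 0) :
    ∃ D : OnePoint (GaloisField p n) → Set (Finset (OnePoint (GaloisField p n) × Bool)),
      IsTripleCovering D := by
  classical
  have : Finite (GaloisField p n) := Nat.finite_of_card_ne_zero <| by
    rw [GaloisField.card p n hn]
    exact pow_ne_zero _ (Fact.out : p.Prime).ne_zero
  have hcard : ∀ C ∈ circles (algebraMap (ZMod p) (GaloisField p n)), Nat.card C = p + 1 := by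
    intro C hC
    rw [card_of_mem_circles hC, Nat.card_zmod]
  obtain ⟨k, hk, hpk⟩ : ∃ k, Odd k ∧ p + 1 = 2 ^ k := by
    rcases hp with rfl | rfl | rfl
    · exact ⟨3, by decide, by norm_num⟩
    · exact ⟨5, by decide, by norm_num⟩
    · exact ⟨7, by decide, by norm_num⟩
  have hinv := isInversive_circles (algebraMap (ZMod p) (GaloisField p n))
  obtain ⟨A, hA⟩ := hinv.exists_isPointedSystem OnePoint.infty
    (fun C hC ho => exists_isPointedSystem_of_card C k hk ((hcard C hC).trans hpk) _ ho)
    (fun C hC _ => exists_isTransversalSystem_of_card hp C (hcard C hC))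
  exact ⟨_, hA.isTripleCovering (OnePoint.coe_ne_infty 0)⟩

/-- If `v = 4^n` or `v = 2p^n + 2` with `p ∈ {7,31,127}` (where `n ≥ 1`), then
`C((m-1)v, 6, 3, m) ≤ v²(v-1)(m-1)/24` (the right-hand side is an exact division). -/
theorem bound_63m (n m v : ℕ) (hn : 0 < n) (hm : 3 ≤ m)
    (hv : v = 4 ^ n ∨ ∃ p ∈ ({7, 31, 127} : Finset ℕ), v = 2 * p ^ n + 2) :
    coverNumber ((m - 1) * v) 6 3 m ≤ v ^ 2 * (v - 1) * (m - 1) / 24 := by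
  rcases hv with rfl | ⟨p, hp, rfl⟩
  · obtain ⟨n, rfl⟩ : ∃ l, n = l + 1 := ⟨n - 1, by omega⟩
    obtain ⟨D, hD⟩ := exists_isTripleCovering_two_pow (odd_two_mul_add_one n)
    refine hD.coverNumber_le hm ?_
    rw [Fintype.card_fin, ← pow_succ', show 2 * n + 1 + 1 = 2 * (n + 1) by ring, pow_mul]
    norm_num
  · have hp : p = 7 ∨ p = 31 ∨ p = 127 := by simpa using hp
    have : Fact p.Prime := ⟨by rcases hp with rfl | rfl | rfl <;> norm_num⟩
    obtain ⟨D, hD⟩ := exists_isTripleCovering_galoisField hp hn.ne'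
    have hcard : Nat.card (OnePoint (GaloisField p n)) = p ^ n + 1 := by
      rw [← GaloisField.card p n hn.ne']
      have : Finite (GaloisField p n) :=
        Nat.finite_of_card_ne_zero <| by
          rw [GaloisField.card p n hn.ne']
          exact pow_ne_zero _ (Fact.out : p.Prime).ne_zero
      exact Finite.card_option
    have : Finite (OnePoint (GaloisField p n)) := Nat.finite_of_card_ne_zero (by omega)
    have := Fintype.ofFinite (OnePoint (GaloisField p n))
    refine hD.coverNumber_le hm ?_
    rw [← Nat.card_eq_fintype_card, hcard]
    ring
end

section
/- Let n be any positive integer. If v = 4^n, or v = 2p^n + 2 with p ∈ {7, 31, 127}, then C(3v, 6, 3, 4) ≤ v²(v−1)/8. -/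
/-- A partition-like family `D c`, `c ∈ B \ {o}`, of Steiner systems `S(2,4)` on `B × ZMod 2`
which together cover all triples, such that the block through `(o,0)`, `(o,1)` in `D c` is
`{o,c} × ZMod 2`. -/
structure PointedResolution {X : Type*} (B : Set X) (o : X)
    (D : X → Set (Finset (X × ZMod 2))) : Prop where
  card_eq : ∀ c ∈ B, c ≠ o → ∀ A ∈ D c, A.card = 4
  fst_mem : ∀ c ∈ B, c ≠ o → ∀ A ∈ D c, ∀ a ∈ A, a.1 ∈ B
  existsUnique : ∀ c ∈ B, c ≠ o → ∀ x y : X × ZMod 2, x.1 ∈ B → y.1 ∈ B → x ≠ y →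
    ∃! A, A ∈ D c ∧ x ∈ A ∧ y ∈ A
  base : ∀ c ∈ B, c ≠ o → ∃ A ∈ D c, ∀ i, (o, i) ∈ A ∧ (c, i) ∈ A
  triple : ∀ x y z : X × ZMod 2, x.1 ∈ B → y.1 ∈ B → z.1 ∈ B → x ≠ y → x ≠ z → y ≠ z →
    ∃ c ∈ B, c ≠ o ∧ ∃ A ∈ D c, x ∈ A ∧ y ∈ A ∧ z ∈ A

/-- An overlarge set of group divisible designs: for every `c ∈ B`, `G c` is a group divisible
design with block size four and groups `{x} × ZMod 2`, `x ∈ B \ {c}`, and together these designs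
cover all transversal triples. -/
structure OverlargeSet {X : Type*} (B : Set X)
    (G : X → Set (Finset (X × ZMod 2))) : Prop where
  card_eq : ∀ c ∈ B, ∀ A ∈ G c, A.card = 4
  fst_mem : ∀ c ∈ B, ∀ A ∈ G c, ∀ a ∈ A, a.1 ∈ B ∧ a.1 ≠ c
  transversal : ∀ c ∈ B, ∀ A ∈ G c, ∀ a ∈ A, ∀ b ∈ A, a.1 = b.1 → a = b
  existsUnique : ∀ c ∈ B, ∀ x y : X × ZMod 2, x.1 ∈ B → y.1 ∈ B → x.1 ≠ c → y.1 ≠ c →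
    x.1 ≠ y.1 → ∃! A, A ∈ G c ∧ x ∈ A ∧ y ∈ A
  triple : ∀ x y z : X × ZMod 2, x.1 ∈ B → y.1 ∈ B → z.1 ∈ B → x.1 ≠ y.1 → x.1 ≠ z.1 →
    y.1 ≠ z.1 → ∃ c ∈ B, ∃ A ∈ G c, x ∈ A ∧ y ∈ A ∧ z ∈ A

/-- The family of blocks transported along an injection of the underlying points. -/
def mapBlocks {X Y : Type*} (e : Y ↪ X) (D : Y → Set (Finset (Y × ZMod 2))) (x : X) :
    Set (Finset (X × ZMod 2)) :=
  {A | ∃ c, e c = x ∧ ∃ A' ∈ D c, A = A'.map (e.prodMap (Function.Embedding.refl _))}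

theorem mem_map_prod {X Y : Type*} (e : Y ↪ X) (A : Finset (Y × ZMod 2)) (y : Y) (i : ZMod 2) :
    (e y, i) ∈ A.map (e.prodMap (Function.Embedding.refl _)) ↔ (y, i) ∈ A := by
  have : (e y, i) = (e.prodMap (Function.Embedding.refl (ZMod 2))) (y, i) := rfl
  rw [this, Finset.mem_map']

theorem map_mem_mapBlocks {X Y : Type*} (e : Y ↪ X) (D : Y → Set (Finset (Y × ZMod 2))) {c : Y}
    {A : Finset (Y × ZMod 2)} (hA : A ∈ D c) :
    A.map (e.prodMap (Function.Embedding.refl _)) ∈ mapBlocks e D (e c) :=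
  ⟨c, rfl, A, hA, rfl⟩

theorem mem_mapBlocks_apply {X Y : Type*} {e : Y ↪ X} {D : Y → Set (Finset (Y × ZMod 2))} {c : Y}
    {A : Finset (X × ZMod 2)} (hA : A ∈ mapBlocks e D (e c)) :
    ∃ A' ∈ D c, A = A'.map (e.prodMap (Function.Embedding.refl _)) := by
  obtain ⟨c', hc, A', h, rfl⟩ := hA
  rw [e.injective hc] at h
  exact ⟨A', h, rfl⟩

theorem existsUnique_mapBlocks {X Y : Type*} (e : Y ↪ X) (D : Y → Set (Finset (Y × ZMod 2)))
    (c : Y) (x y : Y × ZMod 2) (h : ∃! A, A ∈ D c ∧ x ∈ A ∧ y ∈ A) :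
    ∃! A, A ∈ mapBlocks e D (e c) ∧ (e x.1, x.2) ∈ A ∧ (e y.1, y.2) ∈ A := by
  obtain ⟨A, ⟨hA, hx, hy⟩, huniq⟩ := h
  refine ⟨_, ⟨map_mem_mapBlocks e D hA, (mem_map_prod ..).2 hx, (mem_map_prod ..).2 hy⟩, ?_⟩
  rintro _ ⟨hA', hx', hy'⟩
  obtain ⟨A', h', rfl⟩ := mem_mapBlocks_apply hA'
  rw [huniq A' ⟨h', (mem_map_prod ..).1 hx', (mem_map_prod ..).1 hy'⟩]

theorem PointedResolution.map {X Y : Type*} (e : Y ↪ X) {o : Y}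
    {D : Y → Set (Finset (Y × ZMod 2))} (h : PointedResolution Set.univ o D) :
    PointedResolution (Set.range e) (e o) (mapBlocks e D) where
  card_eq := by
    rintro _ ⟨c, rfl⟩ hc A hA
    obtain ⟨A', hA', rfl⟩ := mem_mapBlocks_apply hA
    rw [Finset.card_map]
    exact h.card_eq c trivial (fun h => hc (h ▸ rfl)) _ hA'
  fst_mem := by
    rintro _ ⟨c, rfl⟩ hc A hA a ha
    obtain ⟨A', hA', rfl⟩ := mem_mapBlocks_apply hA
    obtain ⟨a', -, rfl⟩ := Finset.mem_map.1 ha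
    exact ⟨a'.1, rfl⟩
  existsUnique := by
    rintro _ ⟨c, rfl⟩ hc ⟨_, i⟩ ⟨_, j⟩ ⟨x, rfl⟩ ⟨y, rfl⟩ hxy
    exact existsUnique_mapBlocks e D c (x, i) (y, j) (h.existsUnique c trivial
      (fun h => hc (h ▸ rfl)) _ _ trivial trivial (by rintro ⟨⟩; exact hxy rfl))
  base := by
    rintro _ ⟨c, rfl⟩ hc
    obtain ⟨A, hA, hi⟩ := h.base c trivial (fun h => hc (h ▸ rfl))
    exact ⟨_, map_mem_mapBlocks e D hA, fun i =>
      ⟨(mem_map_prod ..).2 (hi i).1, (mem_map_prod ..).2 (hi i).2⟩⟩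
  triple := by
    rintro ⟨_, i⟩ ⟨_, j⟩ ⟨_, k⟩ ⟨x, rfl⟩ ⟨y, rfl⟩ ⟨z, rfl⟩ hxy hxz hyz
    obtain ⟨c, -, hc, A, hA, hx, hy, hz⟩ := h.triple (x, i) (y, j) (z, k) trivial trivial trivial
      (by rintro ⟨⟩; exact hxy rfl) (by rintro ⟨⟩; exact hxz rfl) (by rintro ⟨⟩; exact hyz rfl)
    exact ⟨e c, ⟨c, rfl⟩, fun h => hc (e.injective h), _, map_mem_mapBlocks e D hA,
      (mem_map_prod ..).2 hx, (mem_map_prod ..).2 hy, (mem_map_prod ..).2 hz⟩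

theorem OverlargeSet.map {X Y : Type*} (e : Y ↪ X)
    {G : Y → Set (Finset (Y × ZMod 2))} (h : OverlargeSet Set.univ G) :
    OverlargeSet (Set.range e) (mapBlocks e G) where
  card_eq := by
    rintro _ ⟨c, rfl⟩ A hA
    obtain ⟨A', hA', rfl⟩ := mem_mapBlocks_apply hA
    rw [Finset.card_map]
    exact h.card_eq c trivial _ hA'
  fst_mem := by
    rintro _ ⟨c, rfl⟩ A hA a ha
    obtain ⟨A', hA', rfl⟩ := mem_mapBlocks_apply hA
    obtain ⟨a', ha', rfl⟩ := Finset.mem_map.1 ha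
    exact ⟨⟨a'.1, rfl⟩, fun h' => (h.fst_mem c trivial _ hA' _ ha').2 (e.injective h')⟩
  transversal := by
    rintro _ ⟨c, rfl⟩ A hA a ha b hb hab
    obtain ⟨A', hA', rfl⟩ := mem_mapBlocks_apply hA
    obtain ⟨a', ha', rfl⟩ := Finset.mem_map.1 ha
    obtain ⟨b', hb', rfl⟩ := Finset.mem_map.1 hb
    rw [h.transversal c trivial _ hA' _ ha' _ hb' (e.injective hab)]
  existsUnique := by
    rintro _ ⟨c, rfl⟩ ⟨_, i⟩ ⟨_, j⟩ ⟨x, rfl⟩ ⟨y, rfl⟩ hx hy hxy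
    exact existsUnique_mapBlocks e G c (x, i) (y, j) (h.existsUnique c trivial _ _ trivial trivial
      (fun h => hx (congrArg e h)) (fun h => hy (congrArg e h)) (fun h => hxy (congrArg e h)))
  triple := by
    rintro ⟨_, i⟩ ⟨_, j⟩ ⟨_, k⟩ ⟨x, rfl⟩ ⟨y, rfl⟩ ⟨z, rfl⟩ hxy hxz hyz
    obtain ⟨c, -, A, hA, hx, hy, hz⟩ := h.triple (x, i) (y, j) (z, k) trivial trivial trivial
      (fun h => hxy (congrArg e h)) (fun h => hxz (congrArg e h)) (fun h => hyz (congrArg e h))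
    exact ⟨e c, ⟨c, rfl⟩, _, map_mem_mapBlocks e G hA,
      (mem_map_prod ..).2 hx, (mem_map_prod ..).2 hy, (mem_map_prod ..).2 hz⟩

/-- A family of sets such that every three distinct points lie in a unique member. -/
def IsThreeDesign {X : Type*} (S : Set (Set X)) : Prop :=
  ∀ x y z : X, x ≠ y → x ≠ z → y ≠ z → ∃! B, B ∈ S ∧ x ∈ B ∧ y ∈ B ∧ z ∈ B

/-- Filling the blocks of a `3`-design with pointed resolutions (blocks through `o`) and
overlarge sets (other blocks). -/
def composeBlocks {X : Type*} (S : Set (Set X)) (o : X)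
    (D G : Set X → X → Set (Finset (X × ZMod 2))) (c : X) : Set (Finset (X × ZMod 2)) :=
  {A | ∃ B ∈ S, c ∈ B ∧ (o ∈ B ∧ A ∈ D B c ∨ o ∉ B ∧ A ∈ G B c)}

theorem PointedResolution.mem_of_base {X : Type*} {B : Set X} {o c : X}
    {D : X → Set (Finset (X × ZMod 2))} (h : PointedResolution B o D) (hc : c ∈ B) (ho : o ∈ B)
    (hco : c ≠ o) {A : Finset (X × ZMod 2)} (hA : A ∈ D c) {x y : X × ZMod 2} (hx : x ∈ A)
    (hy : y ∈ A) (hxy : x ≠ y) (hx' : x.1 = o ∨ x.1 = c) (hy' : y.1 = o ∨ y.1 = c) :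
    ∀ a, a ∈ A ↔ a.1 = o ∨ a.1 = c := by
  classical
  obtain ⟨A', hA', hi⟩ := h.base c hc hco
  have key : ∀ a : X × ZMod 2, a.1 = o ∨ a.1 = c → a ∈ A' := by
    rintro ⟨a, i⟩ (rfl | rfl)
    · exact (hi i).1
    · exact (hi i).2
  have e : A = A' := (h.existsUnique c hc hco x y (h.fst_mem c hc hco A hA x hx)
    (h.fst_mem c hc hco A hA y hy) hxy).unique ⟨hA, hx, hy⟩ ⟨hA', key x hx', key y hy'⟩
  subst e
  have hs : ({o, c} : Finset X) ×ˢ (Finset.univ : Finset (ZMod 2)) ⊆ A := by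
    intro a ha
    simp only [Finset.mem_product, Finset.mem_insert, Finset.mem_singleton] at ha
    exact key a ha.1
  have := Finset.eq_of_subset_of_card_le hs (by
    rw [h.card_eq c hc hco A hA, Finset.card_product, Finset.card_pair hco.symm,
      Finset.card_univ, ZMod.card])
  intro a
  rw [← this]
  simp

theorem PointedResolution.compose {X : Type*} {S : Set (Set X)} (hS : IsThreeDesign S) (o : X)
    (hX : ∀ x : X, ∃ y, y ≠ x ∧ y ≠ o)
    {D G : Set X → X → Set (Finset (X × ZMod 2))}
    (hD : ∀ B ∈ S, o ∈ B → PointedResolution B o (D B))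
    (hG : ∀ B ∈ S, OverlargeSet B (G B)) :
    PointedResolution Set.univ o (composeBlocks S o D G) where
  card_eq := by
    rintro c - hc A ⟨B, hB, hcB, ⟨ho, hA⟩ | ⟨-, hA⟩⟩
    · exact (hD B hB ho).card_eq c hcB hc A hA
    · exact (hG B hB).card_eq c hcB A hA
  fst_mem := fun _ _ _ _ _ _ _ => trivial
  existsUnique := by
    rintro c - hc x y - - hxy
    by_cases hbase : (x.1 = o ∨ x.1 = c) ∧ (y.1 = o ∨ y.1 = c)
    · obtain ⟨w, hwc, hwo⟩ := hX c
      obtain ⟨B, ⟨hB, hcB, hoB, hwB⟩, -⟩ := hS c o w hc hwc.symm hwo.symm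
      have hm : ∀ x : X, x = o ∨ x = c → x ∈ B := by rintro _ (rfl | rfl) <;> assumption
      obtain ⟨A, ⟨hA, hxA, hyA⟩, -⟩ := (hD B hB hoB).existsUnique c hcB hc x y (hm _ hbase.1)
        (hm _ hbase.2) hxy
      refine ⟨A, ⟨⟨B, hB, hcB, .inl ⟨hoB, hA⟩⟩, hxA, hyA⟩, ?_⟩
      rintro A' ⟨⟨B', hB', hcB', ⟨hoB', hA'⟩ | ⟨hoB', hA'⟩⟩, hxA', hyA'⟩
      · ext a
        rw [(hD B hB hoB).mem_of_base hcB hoB hc hA hxA hyA hxy hbase.1 hbase.2,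
          (hD B' hB' hoB').mem_of_base hcB' hoB' hc hA' hxA' hyA' hxy hbase.1 hbase.2]
      · have hx1 := (hG B' hB').fst_mem c hcB' A' hA' x hxA'
        have hy1 := (hG B' hB').fst_mem c hcB' A' hA' y hyA'
        rcases hbase.1 with h | h
        · exact absurd (h ▸ hx1.1) hoB'
        · exact absurd h hx1.2
    · by_cases hgen : x.1 ≠ y.1 ∧ x.1 ≠ c ∧ y.1 ≠ c
      · obtain ⟨h1, h2, h3⟩ := hgen
        obtain ⟨B, ⟨hB, hxB, hyB, hcB⟩, huB⟩ := hS x.1 y.1 c h1 h2 h3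
        have hu : ∀ A, A ∈ composeBlocks S o D G c → x ∈ A → y ∈ A →
            (o ∈ B ∧ A ∈ D B c ∨ o ∉ B ∧ A ∈ G B c) := by
          rintro A ⟨B', hB', hcB', h⟩ hxA hyA
          have : B' = B := by
            rcases h with ⟨hoB', hA'⟩ | ⟨hoB', hA'⟩
            · exact huB B' ⟨hB', (hD B' hB' hoB').fst_mem c hcB' hc A hA' x hxA,
                (hD B' hB' hoB').fst_mem c hcB' hc A hA' y hyA, hcB'⟩
            · exact huB B' ⟨hB', ((hG B' hB').fst_mem c hcB' A hA' x hxA).1,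
                ((hG B' hB').fst_mem c hcB' A hA' y hyA).1, hcB'⟩
          rwa [this] at h
        by_cases hoB : o ∈ B
        · obtain ⟨A, ⟨hA, hxA, hyA⟩, huA⟩ := (hD B hB hoB).existsUnique c hcB hc x y hxB hyB hxy
          refine ⟨A, ⟨⟨B, hB, hcB, .inl ⟨hoB, hA⟩⟩, hxA, hyA⟩, ?_⟩
          rintro A' ⟨hA', hx', hy'⟩
          rcases hu A' hA' hx' hy' with h | h
          · exact huA A' ⟨h.2, hx', hy'⟩
          · exact absurd hoB h.1
        · obtain ⟨A, ⟨hA, hxA, hyA⟩, huA⟩ := (hG B hB).existsUnique c hcB x y hxB hyB h2 h3 h1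
          refine ⟨A, ⟨⟨B, hB, hcB, .inr ⟨hoB, hA⟩⟩, hxA, hyA⟩, ?_⟩
          rintro A' ⟨hA', hx', hy'⟩
          rcases hu A' hA' hx' hy' with h | h
          · exact absurd h.1 hoB
          · exact huA A' ⟨h.2, hx', hy'⟩
      · obtain ⟨w, hw, hwo, hwc⟩ : ∃ w, (w = x.1 ∨ w = y.1) ∧ w ≠ o ∧ w ≠ c := by
          by_cases h : x.1 = o ∨ x.1 = c
          · have : ¬(y.1 = o ∨ y.1 = c) := fun h' => hbase ⟨h, h'⟩
            exact ⟨y.1, .inr rfl, by tauto, by tauto⟩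
          · exact ⟨x.1, .inl rfl, by tauto, by tauto⟩
        obtain ⟨B, ⟨hB, hcB, hoB, hwB⟩, huB⟩ := hS c o w hc hwc.symm hwo.symm
        have hm : x.1 ∈ B ∧ y.1 ∈ B := by
          by_cases h1 : x.1 = y.1
          · rw [← h1] at hw ⊢
            rcases hw with rfl | rfl <;> exact ⟨hwB, hwB⟩
          · by_cases h2 : x.1 = c
            · refine ⟨h2 ▸ hcB, ?_⟩
              rcases hw with rfl | rfl
              · exact absurd h2 hwc
              · exact hwB
            · have h3 : y.1 = c := by
                by_contra h3
                exact hgen ⟨h1, h2, h3⟩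
              refine ⟨?_, h3 ▸ hcB⟩
              rcases hw with rfl | rfl
              · exact hwB
              · exact absurd h3 hwc
        obtain ⟨A, ⟨hA, hxA, hyA⟩, huA⟩ :=
          (hD B hB hoB).existsUnique c hcB hc x y hm.1 hm.2 hxy
        refine ⟨A, ⟨⟨B, hB, hcB, .inl ⟨hoB, hA⟩⟩, hxA, hyA⟩, ?_⟩
        rintro A' ⟨⟨B', hB', hcB', ⟨hoB', hA'⟩ | ⟨hoB', hA'⟩⟩, hxA', hyA'⟩
        · have hx1 := (hD B' hB' hoB').fst_mem c hcB' hc A' hA' x hxA'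
          have hy1 := (hD B' hB' hoB').fst_mem c hcB' hc A' hA' y hyA'
          have : B' = B := huB B' ⟨hB', hcB', hoB', by rcases hw with rfl | rfl <;> assumption⟩
          subst this
          exact huA A' ⟨hA', hxA', hyA'⟩
        · have hx1 := (hG B' hB').fst_mem c hcB' A' hA' x hxA'
          have hy1 := (hG B' hB').fst_mem c hcB' A' hA' y hyA'
          exact absurd ⟨fun h => hxy ((hG B' hB').transversal c hcB' A' hA' x hxA' y hyA' h),
            hx1.2, hy1.2⟩ hgen
  base := by
    rintro c - hc
    obtain ⟨w, hwc, hwo⟩ := hX c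
    obtain ⟨B, ⟨hB, hcB, hoB, hwB⟩, -⟩ := hS c o w hc hwc.symm hwo.symm
    obtain ⟨A, hA, h⟩ := (hD B hB hoB).base c hcB hc
    exact ⟨A, ⟨B, hB, hcB, .inl ⟨hoB, hA⟩⟩, h⟩
  triple := by
    rintro x y z - - - hxy hxz hyz
    have fill : ∀ B ∈ S, o ∈ B → x.1 ∈ B → y.1 ∈ B → z.1 ∈ B →
        ∃ c ∈ Set.univ, c ≠ o ∧ ∃ A ∈ composeBlocks S o D G c, x ∈ A ∧ y ∈ A ∧ z ∈ A := by
      intro B hB hoB hx hy hz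
      obtain ⟨c, hcB, hc, A, hA, h⟩ := (hD B hB hoB).triple x y z hx hy hz hxy hxz hyz
      exact ⟨c, trivial, hc, A, ⟨B, hB, hcB, .inl ⟨hoB, hA⟩⟩, h⟩
    have two : ∀ a b : X, ∃ B ∈ S, o ∈ B ∧ a ∈ B ∧ b ∈ B := by
      have one : ∀ a b : X, a ≠ o → ∃ B ∈ S, o ∈ B ∧ a ∈ B ∧ b ∈ B := by
        intro a b ha
        by_cases h : b ≠ a ∧ b ≠ o
        · obtain ⟨B, ⟨h1, h2, h3, h4⟩, -⟩ := hS o a b ha.symm h.2.symm h.1.symm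
          exact ⟨B, h1, h2, h3, h4⟩
        · obtain ⟨w, hw, hwo⟩ := hX a
          obtain ⟨B, ⟨h1, h2, h3, h4⟩, -⟩ := hS o a w ha.symm hwo.symm hw.symm
          refine ⟨B, h1, h2, h3, ?_⟩
          by_cases h5 : b = a
          · exact h5 ▸ h3
          · have : b = o := by tauto
            exact this ▸ h2
      intro a b
      by_cases ha : a = o
      · obtain ⟨w, hw, -⟩ := hX o
        by_cases hb : b = o
        · obtain ⟨B, h1, h2, h3, h4⟩ := one w w hw
          exact ⟨B, h1, h2, ha ▸ h2, hb ▸ h2⟩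
        · obtain ⟨B, h1, h2, h3, h4⟩ := one b b hb
          exact ⟨B, h1, h2, ha ▸ h2, h3⟩
      · exact one a b ha
    by_cases h1 : x.1 = y.1
    · obtain ⟨B, hB, h2, h3, h4⟩ := two x.1 z.1
      exact fill B hB h2 h3 (h1 ▸ h3) h4
    by_cases h2 : x.1 = z.1
    · obtain ⟨B, hB, h3, h4, h5⟩ := two x.1 y.1
      exact fill B hB h3 h4 h5 (h2 ▸ h4)
    by_cases h3 : y.1 = z.1
    · obtain ⟨B, hB, h4, h5, h6⟩ := two x.1 y.1
      exact fill B hB h4 h5 h6 (h3 ▸ h6)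
    obtain ⟨B, ⟨hB, hx, hy, hz⟩, -⟩ := hS _ _ _ h1 h2 h3
    by_cases hoB : o ∈ B
    · exact fill B hB hoB hx hy hz
    · obtain ⟨c, hcB, A, hA, h⟩ := (hG B hB).triple x y z hx hy hz h1 h2 h3
      exact ⟨c, trivial, fun h => hoB (h ▸ hcB), A, ⟨B, hB, hcB, .inr ⟨hoB, hA⟩⟩, h⟩

section Baker

variable {F : Type*} [Field F]

/-- Baker's colour of the plane through `0`, `p` and `q` in the affine space `F × ZMod 2`. -/
def bakerColor (p q : F × ZMod 2) : F :=
  p.1 ^ 2 * q.1 + p.1 * q.1 ^ 2 +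
    if p.2 = 0 then (if q.2 = 0 then 0 else p.1 ^ 3)
    else if q.2 = 0 then q.1 ^ 3 else (p.1 + q.1) ^ 3

theorem zmod_two_cases (i : ZMod 2) : i = 0 ∨ i = 1 := by
  revert i; decide

theorem bakerColor_comm (p q : F × ZMod 2) : bakerColor p q = bakerColor q p := by
  obtain ⟨x, i⟩ := p
  obtain ⟨y, j⟩ := q
  rcases zmod_two_cases i with rfl | rfl <;> rcases zmod_two_cases j with rfl | rfl <;>
    simp [bakerColor] <;> ring

theorem one_add_one_zmod_two : (1 + 1 : ZMod 2) = 0 := by decide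

theorem bakerColor_add_right (h2 : (2 : F) = 0) (p q : F × ZMod 2) :
    bakerColor p (p + q) = bakerColor p q := by
  obtain ⟨x, i⟩ := p
  obtain ⟨y, j⟩ := q
  rcases zmod_two_cases i with rfl | rfl <;> rcases zmod_two_cases j with rfl | rfl <;>
    simp [bakerColor, one_add_one_zmod_two]
  · linear_combination (x ^ 3 + x ^ 2 * y) * h2
  · linear_combination (x ^ 3 + x ^ 2 * y) * h2
  · linear_combination (5 * x ^ 3 + 7 * x ^ 2 * y + 3 * x * y ^ 2) * h2
  · linear_combination (x ^ 3 + x ^ 2 * y) * h2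

theorem bakerColor_zero_right (p : F × ZMod 2) : bakerColor p 0 = 0 := by
  simp [bakerColor]

theorem eq_or_eq_add_of_bakerColor_eq (h2 : (2 : F) = 0)
    (h3 : Function.Injective fun x : F => x ^ 3) {p q r : F × ZMod 2} (hp : p ≠ 0)
    (h : bakerColor p q = bakerColor p r) : r = q ∨ r = p + q := by
  have same : ∀ x y z : F, x ≠ 0 → x ^ 2 * y + x * y ^ 2 = x ^ 2 * z + x * z ^ 2 →
      z = y ∨ z = x + y := by
    intro x y z hx h
    have : x * ((z - y) * (z - (x + y))) = 0 := by
      linear_combination h + (x * z ^ 2 - x * y * z) * h2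
    rcases mul_eq_zero.1 ((mul_eq_zero.1 this).resolve_left hx) with h | h
    · exact .inl (sub_eq_zero.1 h)
    · exact .inr (sub_eq_zero.1 h)
  have diff : ∀ x y z : F, x ≠ 0 → x ^ 2 * y + x * y ^ 2 = x ^ 2 * z + x * z ^ 2 + x ^ 3 →
      False := by
    intro x y z hx h
    have h0 : x * (x ^ 2 + x * (y + z) + (y + z) ^ 2) = 0 := by
      linear_combination h + (x ^ 3 + x ^ 2 * z + x * z ^ 2 + x * y * z) * h2
    have h1 := (mul_eq_zero.1 h0).resolve_left hx
    have h4 : y + z = x := h3 (by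
      change (y + z) ^ 3 = x ^ 3
      linear_combination (y + z - x) * h1)
    rw [h4] at h1
    exact hx (pow_eq_zero_iff two_ne_zero |>.1 (by linear_combination h1 - x ^ 2 * h2))
  have cub : ∀ y z : F, y ^ 3 = z ^ 3 → z = y := fun y z h => (h3 h).symm
  obtain ⟨x, i⟩ := p
  obtain ⟨y, j⟩ := q
  obtain ⟨z, k⟩ := r
  simp only [Prod.mk_add_mk, Prod.mk.injEq]
  rcases zmod_two_cases i with rfl | rfl
  · have hx : x ≠ 0 := by rintro rfl; exact hp rfl
    rcases zmod_two_cases j with rfl | rfl <;> rcases zmod_two_cases k with rfl | rfl <;>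
      simp [bakerColor] at h ⊢
    · exact same x y z hx h
    · exact (diff x y z hx h).elim
    · exact (diff x z y hx h.symm).elim
    · exact same x y z hx h
  · rcases zmod_two_cases j with rfl | rfl <;> rcases zmod_two_cases k with rfl | rfl <;>
      simp [bakerColor, one_add_one_zmod_two] at h ⊢
    · have := cub (x + y) (x + z) (by
        linear_combination h + (x ^ 2 * y + x * y ^ 2 - x ^ 2 * z - x * z ^ 2) * h2)
      linear_combination this
    · exact cub (x + y) z (by
        linear_combination h + (x ^ 2 * y + x * y ^ 2 + 2 * x ^ 2 * z + 2 * x * z ^ 2 + x ^ 3) * h2)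
    · have := cub y (x + z) (by
        linear_combination h - (2 * x ^ 2 * y + 2 * x * y ^ 2 + x ^ 2 * z + x * z ^ 2 + x ^ 3) * h2)
      linear_combination this - x * h2
    · exact cub y z (by
        linear_combination h - (2 * x ^ 2 * y + 2 * x * y ^ 2 - 2 * x ^ 2 * z - 2 * x * z ^ 2) * h2)

theorem add_self_of_two_eq_zero (h2 : (2 : F) = 0) (p : F × ZMod 2) : p + p = 0 := by
  obtain ⟨x, i⟩ := p
  ext
  · change x + x = 0
    linear_combination x * h2
  · change i + i = 0
    revert i
    decide

theorem bakerColor_ne_zero (h2 : (2 : F) = 0)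
    (h3 : Function.Injective fun x : F => x ^ 3) {p q : F × ZMod 2} (hp : p ≠ 0) (hq : q ≠ 0)
    (hpq : p ≠ q) : bakerColor p q ≠ 0 := by
  intro h
  rw [← bakerColor_zero_right p] at h
  rcases eq_or_eq_add_of_bakerColor_eq h2 h3 hp h with h | h
  · exact hq h.symm
  · apply hpq
    have := add_self_of_two_eq_zero h2 q
    rw [← this] at h
    exact (add_right_cancel h).symm

theorem bakerColor_surjective [Finite F] (h2 : (2 : F) = 0)
    (h3 : Function.Injective fun x : F => x ^ 3) {p : F × ZMod 2} (hp : p ≠ 0) :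
    Function.Surjective (bakerColor p) := by
  classical
  have := Fintype.ofFinite F
  have hc := Finset.card_le_mul_card_image (s := Finset.univ) (f := bakerColor p) 2 (by
    intro c hc
    obtain ⟨q, -, rfl⟩ := Finset.mem_image.1 hc
    refine (Finset.card_le_card (t := {q, p + q}) ?_).trans Finset.card_le_two
    intro r hr
    have hr := (Finset.mem_filter.1 hr).2
    simpa using eq_or_eq_add_of_bakerColor_eq h2 h3 hp hr.symm)
  rw [Finset.card_univ, Fintype.card_prod, ZMod.card] at hc
  have : Finset.univ.image (bakerColor p) = Finset.univ := by
    apply Finset.eq_univ_of_card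
    exact le_antisymm (Finset.card_le_univ _) (by omega)
  intro c
  have hc : c ∈ Finset.univ.image (bakerColor p) := this ▸ Finset.mem_univ c
  obtain ⟨q, -, h⟩ := Finset.mem_image.1 hc
  exact ⟨q, h⟩

open scoped Classical in
/-- The plane through `w` with directions `p` and `q`. -/
noncomputable def bakerPlane (w p q : F × ZMod 2) : Finset (F × ZMod 2) :=
  {w, w + p, w + q, w + p + q}

theorem mem_bakerPlane {w p q a : F × ZMod 2} :
    a ∈ bakerPlane w p q ↔ a = w ∨ a = w + p ∨ a = w + q ∨ a = w + p + q := by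
  simp [bakerPlane]

/-- The planes of colour `c ^ 3`. -/
def bakerBlocks (c : F) : Set (Finset (F × ZMod 2)) :=
  {A | ∃ w p q, p ≠ 0 ∧ q ≠ 0 ∧ p ≠ q ∧ bakerColor p q = c ^ 3 ∧ A = bakerPlane w p q}

theorem bakerPlane_of_mem (h2 : (2 : F) = 0) {w p q a : F × ZMod 2}
    (h : a ∈ bakerPlane w p q) : bakerPlane w p q = bakerPlane a p q := by
  have hp := add_self_of_two_eq_zero h2 p
  have hq := add_self_of_two_eq_zero h2 q
  ext b
  simp only [mem_bakerPlane]
  rcases mem_bakerPlane.1 h with rfl | rfl | rfl | rfl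
  · rfl
  · have e1 : w + p + p = w := by rw [add_assoc, hp, add_zero]
    rw [e1]
    tauto
  · have e1 : w + q + p = w + p + q := by abel
    have e2 : w + q + q = w := by rw [add_assoc, hq, add_zero]
    have e3 : w + p + q + q = w + p := by rw [add_assoc, hq, add_zero]
    rw [e1, e2, e3]
    tauto
  · have e1 : w + p + q + p = w + q + (p + p) := by abel
    have e2 : w + p + q + q = w + p := by rw [add_assoc, hq, add_zero]
    have e3 : w + q + (p + p) + q = w + (p + p) + (q + q) := by abel
    rw [e1, e2, e3, hp, hq, add_zero, add_zero, add_zero]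
    tauto

theorem bakerPlane_swap (w p q : F × ZMod 2) : bakerPlane w p q = bakerPlane w q p := by
  ext b
  simp only [mem_bakerPlane]
  rw [add_right_comm w p q]
  tauto

theorem bakerPlane_add (h2 : (2 : F) = 0) (w p q : F × ZMod 2) :
    bakerPlane w p (p + q) = bakerPlane w p q := by
  have hp := add_self_of_two_eq_zero h2 p
  have e : w + p + (p + q) = w + (p + p) + q := by abel
  ext b
  simp only [mem_bakerPlane]
  rw [e, hp, add_zero, add_assoc w p q]
  tauto

theorem bakerBlocks_normalize (h2 : (2 : F) = 0) {c : F} {A : Finset (F × ZMod 2)}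
    (hA : A ∈ bakerBlocks c) {x d : F × ZMod 2} (hx : x ∈ A) (hy : x + d ∈ A) (hd : d ≠ 0) :
    ∃ q, bakerColor d q = c ^ 3 ∧ A = bakerPlane x d q := by
  obtain ⟨w, p, q, hp, hq, hpq, hc, rfl⟩ := hA
  rw [bakerPlane_of_mem h2 hx] at hy ⊢
  rcases mem_bakerPlane.1 hy with h | h | h | h
  · exact absurd (by simpa using h) hd
  · obtain rfl := add_left_cancel h
    exact ⟨q, hc, rfl⟩
  · obtain rfl := add_left_cancel h
    exact ⟨p, by rw [bakerColor_comm, hc], bakerPlane_swap ..⟩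
  · rw [add_assoc] at h
    obtain rfl := add_left_cancel h
    refine ⟨p, ?_, ?_⟩
    · rw [bakerColor_comm, bakerColor_add_right h2, hc]
    · rw [bakerPlane_swap x (p + q) p, bakerPlane_add h2]

theorem pointedResolution_bakerBlocks [Finite F] (h2 : (2 : F) = 0)
    (h3 : Function.Injective fun x : F => x ^ 3) :
    PointedResolution Set.univ (0 : F) bakerBlocks where
  card_eq := by
    classical
    rintro c - hc A ⟨w, p, q, hp, hq, hpq, -, rfl⟩
    have hpq' : p + q ≠ 0 := by
      rw [← add_self_of_two_eq_zero h2 q]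
      exact fun h => hpq (add_right_cancel h)
    unfold bakerPlane
    rw [Finset.card_insert_of_notMem, Finset.card_insert_of_notMem, Finset.card_insert_of_notMem,
      Finset.card_singleton]
    · simp [add_assoc, hp]
    · simp [add_assoc, hpq, hq]
    · simp [add_assoc, hp, hq, hpq']
  fst_mem := fun _ _ _ _ _ _ _ => trivial
  existsUnique := by
    rintro c - hc x y - - hxy
    obtain ⟨d, rfl⟩ : ∃ d, y = x + d := ⟨y - x, by abel⟩
    have hd : d ≠ 0 := by rintro rfl; simp at hxy
    obtain ⟨q, hq⟩ := bakerColor_surjective h2 h3 hd (c ^ 3)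
    have hq0 : q ≠ 0 := by
      rintro rfl
      rw [bakerColor_zero_right] at hq
      exact pow_ne_zero 3 hc hq.symm
    have hdq : d ≠ q := by
      rintro rfl
      have := bakerColor_add_right h2 d 0
      rw [add_zero, hq, bakerColor_zero_right] at this
      exact pow_ne_zero 3 hc this
    refine ⟨bakerPlane x d q, ⟨⟨x, d, q, hd, hq0, hdq, hq, rfl⟩, mem_bakerPlane.2 (.inl rfl),
      mem_bakerPlane.2 (.inr (.inl rfl))⟩, ?_⟩
    rintro A ⟨hA, hx, hy⟩
    obtain ⟨r, hr, rfl⟩ := bakerBlocks_normalize h2 hA hx hy hd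
    rcases eq_or_eq_add_of_bakerColor_eq h2 h3 hd (hq.trans hr.symm) with rfl | rfl
    · rfl
    · exact bakerPlane_add h2 ..
  base := by
    rintro c - hc
    refine ⟨bakerPlane 0 (c, 0) (0, 1), ⟨0, (c, 0), (0, 1), ?_, ?_, ?_, ?_, rfl⟩, fun i => ?_⟩
    · simpa using hc
    · simp
    · simp
    · simp [bakerColor]
    · rcases zmod_two_cases i with rfl | rfl <;> simp [mem_bakerPlane]
  triple := by
    rintro x y z - - - hxy hxz hyz
    obtain ⟨p, rfl⟩ : ∃ d, y = x + d := ⟨y - x, by abel⟩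
    obtain ⟨q, rfl⟩ : ∃ d, z = x + d := ⟨z - x, by abel⟩
    have hp : p ≠ 0 := by rintro rfl; simp at hxy
    have hq : q ≠ 0 := by rintro rfl; simp at hxz
    have hpq : p ≠ q := by rintro rfl; simp at hyz
    obtain ⟨c, hc : c ^ 3 = _⟩ := (Finite.injective_iff_surjective.1 h3) (bakerColor p q)
    refine ⟨c, trivial, ?_, bakerPlane x p q, ⟨x, p, q, hp, hq, hpq, hc.symm, rfl⟩, ?_⟩
    · rintro rfl
      exact bakerColor_ne_zero h2 h3 hp hq hpq (by rw [← hc]; simp)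
    · simp [mem_bakerPlane]

end Baker

section ProjectiveLine

variable {K : Type*} [Field K]

/-- The determinant of two vectors of the plane. -/
def planeDet (u w : K × K) : K := u.1 * w.2 - u.2 * w.1

/-- A vector representing a point of the projective line `Option K`. -/
def lineRep : Option K → K × K
  | none => (1, 0)
  | some t => (t, 1)

open scoped Classical in
/-- The point of the projective line spanned by a nonzero vector. -/
noncomputable def linePoint (v : K × K) : Option K :=
  if v.2 = 0 then none else some (v.1 / v.2)

theorem exists_eq_smul_lineRep {v : K × K} (hv : v ≠ 0) :
    ∃ l : K, l ≠ 0 ∧ v = l • lineRep (linePoint v) := by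
  obtain ⟨a, b⟩ := v
  by_cases hb : b = 0
  · subst hb
    exact ⟨a, by rintro rfl; exact hv rfl, by simp [linePoint, lineRep]⟩
  · exact ⟨b, hb, by simp [linePoint, lineRep, hb, mul_div_cancel₀]⟩

theorem planeDet_lineRep_ne_zero {x y : Option K} (h : x ≠ y) :
    planeDet (lineRep x) (lineRep y) ≠ 0 := by
  rcases x with _ | x <;> rcases y with _ | y <;> simp [planeDet, lineRep] at h ⊢
  exact sub_ne_zero.2 h

theorem linePoint_lineRep (x : Option K) : linePoint (lineRep x) = x := by
  rcases x with _ | x <;> simp [linePoint, lineRep]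

theorem linePoint_smul {l : K} (hl : l ≠ 0) (v : K × K) : linePoint (l • v) = linePoint v := by
  by_cases hv : v.2 = 0 <;> simp [linePoint, hl, hv, mul_div_mul_left]

theorem planeDet_eq_zero_of_linePoint_eq {v w : K × K} (hv : v ≠ 0) (hw : w ≠ 0)
    (h : linePoint v = linePoint w) : planeDet v w = 0 := by
  obtain ⟨a, -, ha⟩ := exists_eq_smul_lineRep hv
  obtain ⟨b, -, hb⟩ := exists_eq_smul_lineRep hw
  rw [ha, hb, h]
  simp only [planeDet, Prod.smul_fst, Prod.smul_snd, smul_eq_mul]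
  ring

theorem ne_zero_of_planeDet_ne_zero {u w : K × K} (h : planeDet u w ≠ 0) : u ≠ 0 := by
  rintro rfl
  simp [planeDet] at h

section SubfieldLines

variable {L : Type*} [Field L] [Algebra K L]

/-- The points of the projective line over `L` spanned by `K`-combinations of `u` and `w`. -/
def subLine (K : Type*) [Field K] [Algebra K L] (u w : L × L) : Set (Option L) :=
  {x | ∃ (a b : K) (m : L), lineRep x = m • (algebraMap K L a • u + algebraMap K L b • w)}

theorem lineRep_ne_zero (x : Option K) : lineRep x ≠ 0 := by
  rcases x with _ | x <;> simp [lineRep]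

theorem subLine_subset {u w u' w' : L × L} {m : L} {a b c d : K}
    (hu : u' = m • (algebraMap K L a • u + algebraMap K L b • w))
    (hw : w' = m • (algebraMap K L c • u + algebraMap K L d • w)) :
    subLine K u' w' ⊆ subLine K u w := by
  rintro x ⟨p, q, l, hx⟩
  refine ⟨p * a + q * c, p * b + q * d, l * m, ?_⟩
  rw [hx, hu, hw]
  simp only [map_add, map_mul]
  module

theorem subLine_eq {u w u' w' : L × L} {m : L} {a b c d : K} (hm : m ≠ 0)
    (hdet : a * d - b * c ≠ 0)
    (hu : u' = m • (algebraMap K L a • u + algebraMap K L b • w))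
    (hw : w' = m • (algebraMap K L c • u + algebraMap K L d • w)) :
    subLine K u' w' = subLine K u w := by
  have hk : algebraMap K L (a * d - b * c) ≠ 0 := (map_ne_zero _).2 hdet
  have hk' := hk
  simp only [map_sub, map_mul] at hk'
  apply Set.Subset.antisymm (subLine_subset hu hw)
  apply subLine_subset (m := (m * algebraMap K L (a * d - b * c))⁻¹) (a := d) (b := -b)
    (c := -c) (d := a)
  · rw [eq_inv_smul_iff₀ (mul_ne_zero hm hk), hu, hw]
    simp only [map_sub, map_mul, map_neg]
    module
  · rw [eq_inv_smul_iff₀ (mul_ne_zero hm hk), hu, hw]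
    simp only [map_sub, map_mul, map_neg]
    module

theorem subLine_eq_of_mem {u w : L × L} {x y z : Option L} (huw : planeDet u w ≠ 0)
    (hxy : x ≠ y) (hxz : x ≠ z) (hyz : y ≠ z)
    (hx : x ∈ subLine K u w) (hy : y ∈ subLine K u w) (hz : z ∈ subLine K u w) :
    subLine K u w = subLine K (planeDet (lineRep z) (lineRep y) • lineRep x)
      (planeDet (lineRep x) (lineRep z) • lineRep y) := by
  obtain ⟨a₁, b₁, m₁, h₁⟩ := hx
  obtain ⟨a₂, b₂, m₂, h₂⟩ := hy
  obtain ⟨a₃, b₃, m₃, h₃⟩ := hz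
  have key : ∀ (a b c d : K) (m n : L),
      planeDet (m • (algebraMap K L a • u + algebraMap K L b • w))
        (n • (algebraMap K L c • u + algebraMap K L d • w)) =
      m * n * planeDet u w * algebraMap K L (a * d - b * c) := by
    intro a b c d m n
    simp only [planeDet, Prod.smul_fst, Prod.smul_snd, Prod.fst_add, Prod.snd_add, smul_eq_mul,
      map_sub, map_mul]
    ring
  have n₁₂ := planeDet_lineRep_ne_zero hxy
  have n₁₃ := planeDet_lineRep_ne_zero hxz
  have n₃₂ := planeDet_lineRep_ne_zero hyz.symm
  rw [h₁, h₂, key] at n₁₂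
  rw [h₁, h₃, key] at n₁₃
  rw [h₃, h₂, key] at n₃₂
  have hm₁ : m₁ ≠ 0 := by rintro rfl; simp at n₁₂
  have hm₂ : m₂ ≠ 0 := by rintro rfl; simp at n₁₂
  have hm₃ : m₃ ≠ 0 := by rintro rfl; simp at n₁₃
  have k₁₂ : a₁ * b₂ - b₁ * a₂ ≠ 0 := by intro h; simp [h] at n₁₂
  have k₁₃ : a₁ * b₃ - b₁ * a₃ ≠ 0 := by intro h; simp [h] at n₁₃
  have k₃₂ : a₃ * b₂ - b₃ * a₂ ≠ 0 := by intro h; simp [h] at n₃₂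
  symm
  apply subLine_eq (m := m₁ * m₂ * m₃ * planeDet u w) (a := (a₃ * b₂ - b₃ * a₂) * a₁)
    (b := (a₃ * b₂ - b₃ * a₂) * b₁) (c := (a₁ * b₃ - b₁ * a₃) * a₂)
    (d := (a₁ * b₃ - b₁ * a₃) * b₂) (by simp [hm₁, hm₂, hm₃, huw])
  · have : (a₃ * b₂ - b₃ * a₂) * a₁ * ((a₁ * b₃ - b₁ * a₃) * b₂) -
        (a₃ * b₂ - b₃ * a₂) * b₁ * ((a₁ * b₃ - b₁ * a₃) * a₂) =
        (a₃ * b₂ - b₃ * a₂) * (a₁ * b₃ - b₁ * a₃) * (a₁ * b₂ - b₁ * a₂) := by ring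
    rw [this]
    exact mul_ne_zero (mul_ne_zero k₃₂ k₁₃) k₁₂
  · rw [h₁, h₂, h₃, key]
    simp only [map_sub, map_mul]
    module
  · rw [h₁, h₂, h₃, key]
    simp only [map_sub, map_mul]
    module

/-- The blocks of the spherical geometry on the projective line over `L`. -/
def sphericalBlocks (K L : Type*) [Field K] [Field L] [Algebra K L] : Set (Set (Option L)) :=
  {B | ∃ u w : L × L, planeDet u w ≠ 0 ∧ B = subLine K u w}

theorem isThreeDesign_sphericalBlocks : IsThreeDesign (sphericalBlocks K L) := by
  intro x y z hxy hxz hyz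
  have n₁₂ := planeDet_lineRep_ne_zero hxy
  have n₁₃ := planeDet_lineRep_ne_zero hxz
  have n₃₂ := planeDet_lineRep_ne_zero hyz.symm
  refine ⟨subLine K (planeDet (lineRep z) (lineRep y) • lineRep x)
      (planeDet (lineRep x) (lineRep z) • lineRep y), ⟨⟨_, _, ?_, rfl⟩, ?_, ?_, ?_⟩, ?_⟩
  · have : planeDet (planeDet (lineRep z) (lineRep y) • lineRep x)
        (planeDet (lineRep x) (lineRep z) • lineRep y) = planeDet (lineRep z) (lineRep y) *
        planeDet (lineRep x) (lineRep z) * planeDet (lineRep x) (lineRep y) := by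
      simp only [planeDet, Prod.smul_fst, Prod.smul_snd, smul_eq_mul]
      ring
    rw [this]
    exact mul_ne_zero (mul_ne_zero n₃₂ n₁₃) n₁₂
  · exact ⟨1, 0, (planeDet (lineRep z) (lineRep y))⁻¹, by simp [smul_smul, n₃₂]⟩
  · exact ⟨0, 1, (planeDet (lineRep x) (lineRep z))⁻¹, by simp [smul_smul, n₁₃]⟩
  · refine ⟨1, 1, (planeDet (lineRep x) (lineRep y))⁻¹, ?_⟩
    rw [eq_inv_smul_iff₀ n₁₂]
    ext <;> simp [planeDet] <;> ring
  · rintro _ ⟨⟨u, w, huw, rfl⟩, hx, hy, hz⟩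
    exact subLine_eq_of_mem huw hxy hxz hyz hx hy hz

theorem exists_embedding_range_eq {B : Set (Option L)} (hB : B ∈ sphericalBlocks K L) :
    ∃ e : Option K ↪ Option L, Set.range e = B := by
  obtain ⟨u, w, huw, rfl⟩ := hB
  let g : Option K → L × L := fun x =>
    algebraMap K L (lineRep x).1 • u + algebraMap K L (lineRep x).2 • w
  have hdet : ∀ x y, planeDet (g x) (g y) =
      algebraMap K L (planeDet (lineRep x) (lineRep y)) * planeDet u w := by
    intro x y
    simp only [g, planeDet, Prod.smul_fst, Prod.smul_snd, Prod.fst_add, Prod.snd_add,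
      smul_eq_mul, map_sub, map_mul]
    ring
  have hne : ∀ x y, x ≠ y → planeDet (g x) (g y) ≠ 0 := by
    intro x y h
    rw [hdet]
    exact mul_ne_zero (by simpa using planeDet_lineRep_ne_zero h) huw
  have hg : ∀ x, g x ≠ 0 := by
    intro x
    obtain ⟨y, hy⟩ := exists_ne x
    exact ne_zero_of_planeDet_ne_zero (hne x y hy.symm)
  refine ⟨⟨fun x => linePoint (g x), fun x y h => ?_⟩, ?_⟩
  · by_contra hxy
    exact hne x y hxy (planeDet_eq_zero_of_linePoint_eq (hg x) (hg y) h)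
  · ext x
    constructor
    · rintro ⟨t, rfl⟩
      obtain ⟨l, hl, h⟩ := exists_eq_smul_lineRep (hg t)
      refine ⟨(lineRep t).1, (lineRep t).2, l⁻¹, ?_⟩
      rw [eq_inv_smul_iff₀ hl]
      exact h.symm
    · rintro ⟨a, b, m, h⟩
      have hm : m ≠ 0 := by
        rintro rfl
        exact lineRep_ne_zero x (by simpa using h)
      have hab : ((a, b) : K × K) ≠ 0 := by
        rintro hab
        obtain ⟨rfl, rfl⟩ := Prod.mk.inj hab
        exact lineRep_ne_zero x (by simpa using h)
      obtain ⟨l, hl, h'⟩ := exists_eq_smul_lineRep hab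
      generalize linePoint (a, b) = t at h'
      have ha : a = l * (lineRep t).1 := congrArg Prod.fst h'
      have hb : b = l * (lineRep t).2 := congrArg Prod.snd h'
      refine ⟨t, ?_⟩
      have hx : lineRep x = (m * algebraMap K L l) • g t := by
        rw [h, ha, hb]
        simp only [g, map_mul]
        module
      change linePoint (g _) = x
      rw [← linePoint_lineRep x, hx, linePoint_smul (mul_ne_zero hm (by simpa using hl))]

end SubfieldLines

end ProjectiveLine

section Overlarge

variable {K : Type*} [Field K]

/-- The `ω`-block with apex `b` on level `i`. -/
noncomputable def apexBlock [DecidableEq K] (ω b s : K) (i : ZMod 2) : Finset (K × ZMod 2) :=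
  {(b, i), (b + s, i + 1), (b + s * ω, i + 1), (b + s * ω ^ 2, i + 1)}

open scoped Classical in
/-- A group divisible design on `K × ZMod 2` with block size four. -/
def apexBlocks (ω : K) : Set (Finset (K × ZMod 2)) :=
  {A | ∃ b s i, s ≠ 0 ∧ IsSquare s ∧ A = apexBlock ω b s i}

theorem mem_apexBlock [DecidableEq K] {ω b s : K} {i : ZMod 2} {a : K × ZMod 2} :
    a ∈ apexBlock ω b s i ↔ a = (b, i) ∨ a = (b + s, i + 1) ∨ a = (b + s * ω, i + 1) ∨
      a = (b + s * ω ^ 2, i + 1) := by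
  simp [apexBlock]

theorem zmod_two_add_one_ne (i : ZMod 2) : i + 1 ≠ i := by revert i; decide

theorem zmod_two_add_one_add_one (i : ZMod 2) : i + 1 + 1 = i := by revert i; decide

theorem zmod_two_eq_add_one_of_ne {i j : ZMod 2} (h : i ≠ j) : j = i + 1 := by
  revert i j; decide

variable {ω : K}

theorem cube_eq_one_of_root (hω : ω ^ 2 + ω + 1 = 0) : ω ^ 3 = 1 := by
  linear_combination (ω - 1) * hω

theorem ne_zero_of_root (hω : ω ^ 2 + ω + 1 = 0) : ω ≠ 0 := by
  rintro rfl
  simp at hω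

theorem one_sub_ne_zero_of_root (h3 : (3 : K) ≠ 0) (hω : ω ^ 2 + ω + 1 = 0) : 1 - ω ≠ 0 := by
  intro h
  apply h3
  linear_combination hω + (ω + 2) * h

theorem isSquare_mul_root (hω : ω ^ 2 + ω + 1 = 0) {s : K} (hs : IsSquare s) :
    IsSquare (s * ω) :=
  hs.mul ⟨ω ^ 2, by linear_combination (-ω ^ 2 + ω) * hω⟩

theorem apexBlock_mul_root [DecidableEq K] (hω : ω ^ 2 + ω + 1 = 0) (b s : K) (i : ZMod 2) :
    apexBlock ω b (s * ω) i = apexBlock ω b s i := by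
  have h1 : s * ω * ω = s * ω ^ 2 := by ring
  have h2 : s * ω * ω ^ 2 = s := by linear_combination s * (ω - 1) * hω
  ext a
  rw [mem_apexBlock, mem_apexBlock, h1, h2]
  tauto

theorem mul_root_ne (h3 : (3 : K) ≠ 0) (hω : ω ^ 2 + ω + 1 = 0) {s : K} (hs : s ≠ 0) :
    s ≠ s * ω ∧ s ≠ s * ω ^ 2 ∧ s * ω ≠ s * ω ^ 2 := by
  have h1 := ne_zero_of_root hω
  have h2 := one_sub_ne_zero_of_root h3 hω
  refine ⟨fun h => ?_, fun h => ?_, fun h => ?_⟩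
  · exact mul_ne_zero hs h2 (by linear_combination h)
  · exact mul_ne_zero (mul_ne_zero hs h2) h1 (by
      linear_combination s * ω * (1 - ω) * hω - ω ^ 2 * h)
  · exact mul_ne_zero (mul_ne_zero hs h2) h1 (by linear_combination h)

theorem apexBlock_transversal [DecidableEq K] (h3 : (3 : K) ≠ 0) (hω : ω ^ 2 + ω + 1 = 0)
    {b s : K} (hs : s ≠ 0) {i : ZMod 2} {x y : K × ZMod 2} (hx : x ∈ apexBlock ω b s i)
    (hy : y ∈ apexBlock ω b s i) (hxy : x.1 = y.1) : x = y := by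
  have h1 := mul_ne_zero hs (ne_zero_of_root hω)
  have h2 : s * ω ^ 2 ≠ 0 := mul_ne_zero hs (pow_ne_zero 2 (ne_zero_of_root hω))
  obtain ⟨e1, e2, e3⟩ := mul_root_ne h3 hω hs
  rcases mem_apexBlock.1 hx with rfl | rfl | rfl | rfl <;>
    rcases mem_apexBlock.1 hy with rfl | rfl | rfl | rfl <;>
    simp only [add_right_inj, left_eq_add, add_eq_left] at hxy <;>
    first
    | rfl
    | exact absurd hxy ‹_›
    | exact absurd hxy.symm ‹_›

theorem card_apexBlock [DecidableEq K] (h3 : (3 : K) ≠ 0) (hω : ω ^ 2 + ω + 1 = 0)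
    {b s : K} (hs : s ≠ 0) (i : ZMod 2) : (apexBlock ω b s i).card = 4 := by
  obtain ⟨e1, e2, e3⟩ := mul_root_ne h3 hω hs
  have hi := (zmod_two_add_one_ne i).symm
  unfold apexBlock
  rw [Finset.card_insert_of_notMem, Finset.card_insert_of_notMem, Finset.card_insert_of_notMem,
    Finset.card_singleton]
  · simpa using e3
  · simpa using ⟨e1, e2⟩
  · simp [hi]

theorem exists_apexBlock_of_same_level [DecidableEq K] (hω : ω ^ 2 + ω + 1 = 0) {b s : K}
    (hs : IsSquare s) (hs0 : s ≠ 0) {i j : ZMod 2} {x y : K} (hxy : x ≠ y)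
    (hx : (x, j) ∈ apexBlock ω b s i) (hy : (y, j) ∈ apexBlock ω b s i) :
    i = j + 1 ∧ ∃ t, IsSquare t ∧ t ≠ 0 ∧ apexBlock ω b s i = apexBlock ω b t i ∧
      (x = b + t ∧ y = b + t * ω ∨ y = b + t ∧ x = b + t * ω) := by
  have h3 := cube_eq_one_of_root hω
  have h0 := ne_zero_of_root hω
  have hsω := isSquare_mul_root hω hs
  have hsωω := isSquare_mul_root hω hsω
  have hs1 := mul_ne_zero hs0 h0
  have hs2 := mul_ne_zero hs1 h0
  have b1 := (apexBlock_mul_root hω b s i).symm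
  have b2 := b1.trans (apexBlock_mul_root hω b (s * ω) i).symm
  have hi := zmod_two_add_one_ne i
  have p2 : b + s * ω ^ 2 = b + s * ω * ω := by ring
  have p3 : b + s = b + s * ω * ω * ω := by linear_combination -s * h3
  simp only [mem_apexBlock, Prod.mk.injEq] at hx hy
  rcases hx with ⟨rfl, rfl⟩ | hx
  · rcases hy with ⟨rfl, -⟩ | ⟨-, h⟩ | ⟨-, h⟩ | ⟨-, h⟩
    · exact absurd rfl hxy
    all_goals exact absurd h.symm hi
  have hj : j = i + 1 := by tauto
  subst hj
  refine ⟨(zmod_two_add_one_add_one i).symm, ?_⟩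
  have hx : x = b + s ∨ x = b + s * ω ∨ x = b + s * ω ^ 2 := by tauto
  have hy : y = b + s ∨ y = b + s * ω ∨ y = b + s * ω ^ 2 := by tauto
  rcases hx with rfl | rfl | rfl <;> rcases hy with rfl | rfl | rfl <;>
    first
    | exact absurd rfl hxy
    | exact ⟨s, hs, hs0, rfl, .inl ⟨rfl, rfl⟩⟩
    | exact ⟨s, hs, hs0, rfl, .inr ⟨rfl, rfl⟩⟩
    | exact ⟨s * ω, hsω, hs1, b1, .inl ⟨rfl, p2⟩⟩
    | exact ⟨s * ω, hsω, hs1, b1, .inr ⟨rfl, p2⟩⟩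
    | exact ⟨s * ω * ω, hsωω, hs2, b2, .inl ⟨p2, p3⟩⟩
    | exact ⟨s * ω * ω, hsωω, hs2, b2, .inr ⟨p2, p3⟩⟩

theorem apexBlock_of_levels [DecidableEq K] (hω : ω ^ 2 + ω + 1 = 0) {b s : K}
    (hs : IsSquare s) {i j : ZMod 2} {x y : K} (hx : (x, j) ∈ apexBlock ω b s i)
    (hy : (y, j + 1) ∈ apexBlock ω b s i) :
    IsSquare (y - x) ∧ apexBlock ω b s i = apexBlock ω x (y - x) j ∨
      IsSquare (x - y) ∧ apexBlock ω b s i = apexBlock ω y (x - y) (j + 1) := by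
  have hsω := isSquare_mul_root hω hs
  have hsωω := isSquare_mul_root hω hsω
  have b1 := (apexBlock_mul_root hω b s i).symm
  have b2 := b1.trans (apexBlock_mul_root hω b (s * ω) i).symm
  have p2 : s * ω ^ 2 = s * ω * ω := by ring
  have key : ∀ z, z = b + s ∨ z = b + s * ω ∨ z = b + s * ω ^ 2 →
      IsSquare (z - b) ∧ apexBlock ω b s i = apexBlock ω b (z - b) i := by
    rintro z (rfl | rfl | rfl)
    · rw [add_sub_cancel_left]
      exact ⟨hs, rfl⟩
    · rw [add_sub_cancel_left]
      exact ⟨hsω, b1⟩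
    · rw [add_sub_cancel_left, p2]
      exact ⟨hsωω, b2⟩
  simp only [mem_apexBlock, Prod.mk.injEq] at hx hy
  have hj := zmod_two_add_one_ne j
  by_cases hij : i = j
  · subst hij
    obtain rfl : x = b := by
      rcases hx with ⟨h, -⟩ | ⟨-, h⟩ | ⟨-, h⟩ | ⟨-, h⟩
      · exact h
      all_goals exact absurd h.symm hj
    exact .inl (key y (by tauto))
  · obtain rfl := zmod_two_eq_add_one_of_ne (Ne.symm hij)
    obtain rfl : y = b := by
      rcases hy with ⟨h, -⟩ | ⟨-, h⟩ | ⟨-, h⟩ | ⟨-, h⟩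
      · exact h
      all_goals exact absurd h.symm (zmod_two_add_one_ne _)
    exact .inr (key x (by tauto))

theorem existsUnique_apexBlocks (h3 : (3 : K) ≠ 0) (hω : ω ^ 2 + ω + 1 = 0)
    (hsq : ∀ a : K, a ≠ 0 → (IsSquare a ↔ ¬IsSquare (-a))) {x y : K × ZMod 2}
    (hxy : x.1 ≠ y.1) : ∃! A, A ∈ apexBlocks ω ∧ x ∈ A ∧ y ∈ A := by
  classical
  have hd : 1 - ω ≠ 0 := one_sub_ne_zero_of_root h3 hω
  obtain ⟨x, j⟩ := x
  obtain ⟨y, k⟩ := y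
  change x ≠ y at hxy
  by_cases hjk : j = k
  · subst hjk
    have hex : ∀ x y : K, x ≠ y → IsSquare ((x - y) / (1 - ω)) →
        ∃! A, A ∈ apexBlocks ω ∧ (x, j) ∈ A ∧ (y, j) ∈ A := by
      intro x y hxy hs
      obtain ⟨t, ht⟩ : ∃ t, t = (x - y) / (1 - ω) := ⟨_, rfl⟩
      rw [← ht] at hs
      have ht' : t * (1 - ω) = x - y := by rw [ht, div_mul_cancel₀ _ hd]
      have ht0 : t ≠ 0 := ht ▸ div_ne_zero (sub_ne_zero.2 hxy) hd
      have e1 : x = x - t + t := by ring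
      have e2 : y = x - t + t * ω := by linear_combination ht'
      refine ⟨apexBlock ω (x - t) t (j + 1), ⟨⟨_, _, _, ht0, hs, by congr⟩, ?_, ?_⟩, ?_⟩
      · refine mem_apexBlock.2 (.inr (.inl ?_))
        rw [← e1, zmod_two_add_one_add_one]
      · refine mem_apexBlock.2 (.inr (.inr (.inl ?_)))
        rw [← e2, zmod_two_add_one_add_one]
      · rintro _ ⟨⟨b, s, i, hs0, hs', rfl⟩, hx, hy⟩
        obtain ⟨rfl, t', hst', ht0', e, ⟨h1, h2⟩ | ⟨h1, h2⟩⟩ :=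
          exists_apexBlock_of_same_level hω hs' hs0 hxy hx hy
        · have : t' = t := mul_right_cancel₀ hd (by rw [ht', h1, h2]; ring)
          have hb : x - t = b := by rw [h1, this]; ring
          rw [hb, ← this]
          convert e
        · have : t' = -t := mul_right_cancel₀ hd (by rw [neg_mul, ht', h1, h2]; ring)
          rw [this] at hst'
          exact absurd hst' ((hsq t ht0).1 hs)
    by_cases hs : IsSquare ((x - y) / (1 - ω))
    · exact hex x y hxy hs
    · have h0 : (x - y) / (1 - ω) ≠ 0 := div_ne_zero (sub_ne_zero.2 hxy) hd
      have hs' : IsSquare ((y - x) / (1 - ω)) := by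
        have : (y - x) / (1 - ω) = -((x - y) / (1 - ω)) := by ring
        rw [this]
        by_contra h
        exact hs ((hsq _ h0).2 h)
      simpa only [and_comm] using hex y x hxy.symm hs'
  · obtain rfl := zmod_two_eq_add_one_of_ne hjk
    have h0 := sub_ne_zero.2 hxy
    have hneg : -(x - y) = y - x := by ring
    have hs := hsq _ h0
    rw [hneg] at hs
    by_cases hxy' : IsSquare (x - y)
    · refine ⟨apexBlock ω y (x - y) (j + 1), ⟨⟨_, _, _, h0, hxy', by congr⟩, ?_, ?_⟩, ?_⟩
      · refine mem_apexBlock.2 (.inr (.inl ?_))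
        rw [add_sub_cancel, zmod_two_add_one_add_one]
      · exact mem_apexBlock.2 (.inl rfl)
      · rintro _ ⟨⟨b, s, i, hs0, hs', rfl⟩, hx, hy⟩
        rcases apexBlock_of_levels hω hs' hx hy with h | h
        · exact absurd h.1 (hs.1 hxy')
        · convert h.2
    · have hyx : IsSquare (y - x) := by tauto
      refine ⟨apexBlock ω x (y - x) j,
        ⟨⟨_, _, _, sub_ne_zero.2 hxy.symm, hyx, by congr⟩, ?_, ?_⟩, ?_⟩
      · exact mem_apexBlock.2 (.inl rfl)
      · refine mem_apexBlock.2 (.inr (.inl ?_))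
        rw [add_sub_cancel]
      · rintro _ ⟨⟨b, s, i, hs0, hs', rfl⟩, hx, hy⟩
        rcases apexBlock_of_levels hω hs' hx hy with h | h
        · convert h.2
        · exact absurd h.1 hxy'

end Overlarge

section OverlargeProjective

variable {K : Type*} [Field K]

/-- A vector whose determinant with `lineRep c` is one. -/
def lineDual : Option K → K × K
  | none => (0, 1)
  | some _ => (-1, 0)

theorem planeDet_lineDual (c : Option K) : planeDet (lineRep c) (lineDual c) = 1 := by
  rcases c with _ | c <;> simp [planeDet, lineRep, lineDual]

/-- The affine chart of the projective line with `c` as point at infinity. -/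
noncomputable def lineChart (c : Option K) (t : K) : Option K :=
  linePoint (t • lineRep c + lineDual c)

theorem planeDet_chart (c : Option K) (t : K) :
    planeDet (lineRep c) (t • lineRep c + lineDual c) = 1 := by
  rw [← planeDet_lineDual c]
  simp only [planeDet, Prod.smul_fst, Prod.smul_snd, Prod.fst_add, Prod.snd_add, smul_eq_mul]
  ring

theorem chart_ne_zero (c : Option K) (t : K) : t • lineRep c + lineDual c ≠ 0 := by
  intro h
  have := planeDet_chart c t
  rw [h] at this
  simp [planeDet] at this

theorem lineChart_ne (c : Option K) (t : K) : lineChart c t ≠ c := by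
  intro h
  have := planeDet_eq_zero_of_linePoint_eq (lineRep_ne_zero c) (chart_ne_zero c t)
    (by rw [linePoint_lineRep]; exact h.symm)
  rw [planeDet_chart] at this
  exact one_ne_zero this

theorem exists_lineChart_eq {c x : Option K} (h : x ≠ c) : ∃ t, lineChart c t = x := by
  have hd := planeDet_lineRep_ne_zero h.symm
  have h1 := planeDet_lineDual c
  refine ⟨(planeDet (lineRep c) (lineRep x))⁻¹ * planeDet (lineRep x) (lineDual c), ?_⟩
  have : lineRep x = planeDet (lineRep c) (lineRep x) •
      (((planeDet (lineRep c) (lineRep x))⁻¹ * planeDet (lineRep x) (lineDual c)) • lineRep c +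
        lineDual c) := by
    rw [smul_add, smul_smul, mul_inv_cancel_left₀ hd]
    simp only [planeDet] at h1 ⊢
    ext
    · simp only [Prod.smul_fst, Prod.fst_add, smul_eq_mul]
      linear_combination -(lineRep x).1 * h1
    · simp only [Prod.smul_snd, Prod.snd_add, smul_eq_mul]
      linear_combination -(lineRep x).2 * h1
  conv_rhs => rw [← linePoint_lineRep x, this, linePoint_smul hd]
  rfl

theorem sub_mul_planeDet_of_lineChart {c x y : Option K} {t r : K} (hx : lineChart c t = x)
    (hy : lineChart c r = y) : (t - r) * (planeDet (lineRep c) (lineRep x) *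
      planeDet (lineRep c) (lineRep y)) = planeDet (lineRep x) (lineRep y) := by
  obtain ⟨l, -, h1⟩ := exists_eq_smul_lineRep (chart_ne_zero c t)
  obtain ⟨m, -, h2⟩ := exists_eq_smul_lineRep (chart_ne_zero c r)
  change _ = l • lineRep (lineChart c t) at h1
  change _ = m • lineRep (lineChart c r) at h2
  have e1 := planeDet_chart c t
  have e2 := planeDet_chart c r
  have e3 : planeDet (t • lineRep c + lineDual c) (r • lineRep c + lineDual c) = t - r := by
    have := planeDet_lineDual c
    simp only [planeDet, Prod.smul_fst, Prod.smul_snd, Prod.fst_add, Prod.snd_add,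
      smul_eq_mul] at this ⊢
    linear_combination (t - r) * this
  rw [h1, hx] at e1 e3
  rw [h2, hy] at e2 e3
  have smul_det : ∀ (a : K) (u w : K × K), planeDet u (a • w) = a * planeDet u w := by
    intro a u w
    simp only [planeDet, Prod.smul_fst, Prod.smul_snd, smul_eq_mul]
    ring
  have det_smul : ∀ (a : K) (u w : K × K), planeDet (a • u) w = a * planeDet u w := by
    intro a u w
    simp only [planeDet, Prod.smul_fst, Prod.smul_snd, smul_eq_mul]
    ring
  rw [smul_det] at e1 e2
  rw [smul_det, det_smul] at e3
  rw [← e3]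
  linear_combination planeDet (lineRep x) (lineRep y) * (m * planeDet (lineRep c) (lineRep y) * e1
    + e2)

/-- The affine chart as an embedding. -/
noncomputable def lineChartEmb (c : Option K) : K ↪ Option K :=
  ⟨lineChart c, fun t r h => by
    have h1 := sub_mul_planeDet_of_lineChart h (rfl : lineChart c r = _)
    have h2 := planeDet_lineRep_ne_zero (lineChart_ne c r).symm
    have h3 : planeDet (lineRep (lineChart c r)) (lineRep (lineChart c r)) = 0 := by
      simp only [planeDet]
      ring
    rw [h3] at h1
    exact sub_eq_zero.1 ((mul_eq_zero.1 h1).resolve_right (mul_ne_zero h2 h2))⟩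

theorem lineChartEmb_apply (c : Option K) (t : K) : lineChartEmb c t = lineChart c t := rfl

theorem exists_lineChart_apex {ω : K} (hω₀ : ω ≠ 0) (hω₁ : 1 - ω ≠ 0)
    {x y z : Option K} (hxy : x ≠ y) (hxz : x ≠ z) (hyz : y ≠ z)
    (hs : IsSquare (ω * (1 - ω) * planeDet (lineRep x) (lineRep y) *
      planeDet (lineRep x) (lineRep z) * planeDet (lineRep y) (lineRep z))) :
    ∃ c b s, s ≠ 0 ∧ IsSquare s ∧ lineChart c b = x ∧ lineChart c (b + s) = y ∧
      lineChart c (b + s * ω) = z := by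
  have nX := planeDet_lineRep_ne_zero hxy
  have nY := planeDet_lineRep_ne_zero hxz
  have nZ := planeDet_lineRep_ne_zero hyz
  obtain ⟨v, hv⟩ : ∃ v, v = planeDet (lineRep x) (lineRep z) • lineRep y -
    (ω * planeDet (lineRep x) (lineRep y)) • lineRep z := ⟨_, rfl⟩
  have hvx : planeDet v (lineRep x) = -(1 - ω) * planeDet (lineRep x) (lineRep y) *
      planeDet (lineRep x) (lineRep z) := by
    rw [hv]; simp [planeDet]; ring
  have hvy : planeDet v (lineRep y) = ω * planeDet (lineRep x) (lineRep y) *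
      planeDet (lineRep y) (lineRep z) := by
    rw [hv]; simp [planeDet]; ring
  have hvz : planeDet v (lineRep z) = planeDet (lineRep x) (lineRep z) *
      planeDet (lineRep y) (lineRep z) := by
    rw [hv]; simp [planeDet]; ring
  have hv0 : v ≠ 0 := ne_zero_of_planeDet_ne_zero (by rw [hvz]; exact mul_ne_zero nY nZ)
  obtain ⟨l, hl, hlv⟩ := exists_eq_smul_lineRep hv0
  obtain ⟨c, hc⟩ : ∃ c, c = linePoint v := ⟨_, rfl⟩
  rw [← hc] at hlv
  have hlw : ∀ w, planeDet v w = l * planeDet (lineRep c) w := by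
    intro w
    rw [hlv]; simp [planeDet]; ring
  have hne : ∀ x, planeDet v (lineRep x) ≠ 0 → x ≠ c := by
    rintro x h rfl
    apply h
    rw [hlw]
    simp only [planeDet]
    ring
  obtain ⟨tx, htx⟩ := exists_lineChart_eq (hne x (by
    rw [hvx]
    exact mul_ne_zero (mul_ne_zero (neg_ne_zero.2 hω₁) nX) nY))
  obtain ⟨ty, hty⟩ := exists_lineChart_eq (hne y (by rw [hvy]; simp [nX, nZ, hω₀]))
  obtain ⟨tz, htz⟩ := exists_lineChart_eq (hne z (by rw [hvz]; simp [nY, nZ]))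
  have dxy := sub_mul_planeDet_of_lineChart htx hty
  have dxz := sub_mul_planeDet_of_lineChart htx htz
  rw [hlw] at hvx hvy hvz
  generalize planeDet (lineRep x) (lineRep y) = X at *
  generalize planeDet (lineRep x) (lineRep z) = Y at *
  generalize planeDet (lineRep y) (lineRep z) = Z at *
  generalize planeDet (lineRep c) (lineRep x) = cx at *
  generalize planeDet (lineRep c) (lineRep y) = cy at *
  generalize planeDet (lineRep c) (lineRep z) = cz at *
  have e1 : (ty - tx) * (ω * (1 - ω) * X * Y * Z) = l * l := by
    apply mul_left_cancel₀ nX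
    linear_combination l ^ 2 * dxy - (tx - ty) * (l * cy) * hvx -
      (tx - ty) * (-(1 - ω) * X * Y) * hvy
  have e2 : (tz - tx) * ((1 - ω) * X * Y * Z) = l * l := by
    apply mul_left_cancel₀ nY
    linear_combination l ^ 2 * dxz - (tx - tz) * (l * cz) * hvx -
      (tx - tz) * (-(1 - ω) * X * Y) * hvz
  have hQ : (1 - ω) * X * Y * Z ≠ 0 := by simp [nX, nY, nZ, hω₁]
  have hts : tz = tx + (ty - tx) * ω := by
    apply mul_right_cancel₀ hQ
    linear_combination e2 - e1
  have hs0 : ty - tx ≠ 0 := by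
    intro h
    rw [h, zero_mul] at e1
    exact mul_ne_zero hl hl e1.symm
  obtain ⟨r, hr⟩ := hs
  have hr0 : r ≠ 0 := by
    rintro rfl
    apply mul_ne_zero hω₀ hQ
    linear_combination hr
  refine ⟨c, tx, ty - tx, hs0, ⟨l / r, ?_⟩, htx, ?_, ?_⟩
  · rw [div_mul_div_comm, eq_div_iff (mul_ne_zero hr0 hr0), ← hr, e1]
  · rw [add_sub_cancel, hty]
  · rw [← hts, htz]

theorem exists_lineChart_base {ω : K} (hω : ω ^ 2 + ω + 1 = 0) (hω₀ : ω ≠ 0) (hω₁ : 1 - ω ≠ 0)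
    {x y z : Option K} (hxy : x ≠ y) (hxz : x ≠ z) (hyz : y ≠ z)
    (hs : IsSquare (-((1 - ω) * planeDet (lineRep x) (lineRep y) *
      planeDet (lineRep x) (lineRep z) * planeDet (lineRep y) (lineRep z)))) :
    ∃ c b s, s ≠ 0 ∧ IsSquare s ∧ lineChart c (b + s) = x ∧ lineChart c (b + s * ω) = y ∧
      lineChart c (b + s * ω ^ 2) = z := by
  have nX := planeDet_lineRep_ne_zero hxy
  have nY := planeDet_lineRep_ne_zero hxz
  have nZ := planeDet_lineRep_ne_zero hyz
  obtain ⟨v, hv⟩ : ∃ v, v = planeDet (lineRep y) (lineRep z) • lineRep x -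
    (ω * planeDet (lineRep x) (lineRep y)) • lineRep z := ⟨_, rfl⟩
  have hvx : planeDet v (lineRep x) = ω * planeDet (lineRep x) (lineRep y) *
      planeDet (lineRep x) (lineRep z) := by
    rw [hv]; simp [planeDet]; ring
  have hvy : planeDet v (lineRep y) = (-ω ^ 2) * planeDet (lineRep x) (lineRep y) *
      planeDet (lineRep y) (lineRep z) := by
    rw [show -ω ^ 2 = 1 + ω by linear_combination -hω, hv]; simp [planeDet]; ring
  have hvz : planeDet v (lineRep z) = planeDet (lineRep x) (lineRep z) *
      planeDet (lineRep y) (lineRep z) := by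
    rw [hv]; simp [planeDet]; ring
  have hv0 : v ≠ 0 := ne_zero_of_planeDet_ne_zero (by rw [hvz]; exact mul_ne_zero nY nZ)
  obtain ⟨l, hl, hlv⟩ := exists_eq_smul_lineRep hv0
  obtain ⟨c, hc⟩ : ∃ c, c = linePoint v := ⟨_, rfl⟩
  rw [← hc] at hlv
  have hlw : ∀ w, planeDet v w = l * planeDet (lineRep c) w := by
    intro w
    rw [hlv]; simp [planeDet]; ring
  have hne : ∀ x, planeDet v (lineRep x) ≠ 0 → x ≠ c := by
    rintro x h rfl
    apply h
    rw [hlw]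
    simp only [planeDet]
    ring
  obtain ⟨tx, htx⟩ := exists_lineChart_eq (hne x (by rw [hvx]; simp [nX, nY, hω₀]))
  obtain ⟨ty, hty⟩ := exists_lineChart_eq (hne y (by rw [hvy]; simp [nX, nZ, hω₀]))
  obtain ⟨tz, htz⟩ := exists_lineChart_eq (hne z (by rw [hvz]; simp [nY, nZ]))
  have dxy := sub_mul_planeDet_of_lineChart htx hty
  have dyz := sub_mul_planeDet_of_lineChart hty htz
  rw [hlw] at hvx hvy hvz
  generalize planeDet (lineRep x) (lineRep y) = X at *
  generalize planeDet (lineRep x) (lineRep z) = Y at *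
  generalize planeDet (lineRep y) (lineRep z) = Z at *
  generalize planeDet (lineRep c) (lineRep x) = cx at *
  generalize planeDet (lineRep c) (lineRep y) = cy at *
  generalize planeDet (lineRep c) (lineRep z) = cz at *
  have e1 : (tx - ty) * (ω ^ 3 * X * Y * Z) = -(l * l) := by
    apply mul_left_cancel₀ nX
    linear_combination -l ^ 2 * dxy + (tx - ty) * (l * cy) * hvx +
      (tx - ty) * (ω * X * Y) * hvy
  have e2 : (ty - tz) * (ω ^ 2 * X * Y * Z) = -(l * l) := by
    apply mul_left_cancel₀ nZ
    linear_combination -l ^ 2 * dyz + (ty - tz) * (l * cz) * hvy +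
      (ty - tz) * (-ω ^ 2 * X * Z) * hvz
  have hω3 := cube_eq_one_of_root hω
  have hQ : ω ^ 2 * X * Y * Z ≠ 0 := by simp [nX, nY, nZ, hω₀]
  have hyz' : ty - tz = ω * (tx - ty) := by
    apply mul_right_cancel₀ hQ
    linear_combination e2 - e1
  obtain ⟨s, hs'⟩ : ∃ s, s * (1 - ω) = tx - ty := ⟨(tx - ty) / (1 - ω), div_mul_cancel₀ _ hω₁⟩
  have e3 : s * (-((1 - ω) * X * Y * Z)) = l * l := by
    linear_combination -e1 - X * Y * Z * hs' + (tx - ty) * X * Y * Z * hω3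
  have hs0 : s ≠ 0 := by
    rintro rfl
    rw [zero_mul] at e3
    exact mul_ne_zero hl hl e3.symm
  obtain ⟨r, hr⟩ := hs
  have hr0 : r ≠ 0 := by
    rintro rfl
    rw [hr, mul_zero, mul_zero] at e3
    exact mul_ne_zero hl hl e3.symm
  refine ⟨c, tx - s, s, hs0, ⟨l / r, ?_⟩, ?_, ?_, ?_⟩
  · rw [div_mul_div_comm, eq_div_iff (mul_ne_zero hr0 hr0), ← hr, e3]
  · rw [sub_add_cancel, htx]
  · rw [show tx - s + s * ω = ty by linear_combination -hs', hty]
  · rw [show tx - s + s * ω ^ 2 = tz by linear_combination -(1 + ω) * hs' + hyz', htz]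

/-- The overlarge set of designs on the projective line obtained from `apexBlocks` by moving the
point at infinity. -/
def overlargeBlocks (ω : K) (c : Option K) : Set (Finset (Option K × ZMod 2)) :=
  {A | ∃ A' ∈ apexBlocks ω, A = A'.map ((lineChartEmb c).prodMap (Function.Embedding.refl _))}

theorem exists_overlargeBlocks_of_apex {ω : K} {c : Option K} {b s : K} (hs0 : s ≠ 0)
    (hs : IsSquare s) (i : ZMod 2) : ∃ A ∈ overlargeBlocks ω c, (lineChart c b, i) ∈ A ∧
      (lineChart c (b + s), i + 1) ∈ A ∧ (lineChart c (b + s * ω), i + 1) ∈ A ∧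
      (lineChart c (b + s * ω ^ 2), i + 1) ∈ A := by
  refine ⟨_, ⟨_, ⟨b, s, i, hs0, hs, rfl⟩, rfl⟩, ?_⟩
  simp only [← lineChartEmb_apply, mem_map_prod, mem_apexBlock]
  tauto

theorem isSquare_or_isSquare_neg (hsq : ∀ a : K, a ≠ 0 → (IsSquare a ↔ ¬IsSquare (-a))) (a : K) :
    IsSquare a ∨ IsSquare (-a) := by
  by_cases ha : a = 0
  · exact .inl (ha ▸ .zero)
  · have := hsq a ha
    tauto

theorem planeDet_swap (u w : K × K) : planeDet u w = -planeDet w u := by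
  simp only [planeDet]
  ring

theorem exists_overlargeBlocks_of_level_eq {ω : K} (h3 : (3 : K) ≠ 0) (hω : ω ^ 2 + ω + 1 = 0)
    (hsq : ∀ a : K, a ≠ 0 → (IsSquare a ↔ ¬IsSquare (-a))) (i : ZMod 2) {x y z : Option K}
    (hxy : x ≠ y) (hxz : x ≠ z) (hyz : y ≠ z) :
    ∃ c, ∃ A ∈ overlargeBlocks ω c, (x, i) ∈ A ∧ (y, i) ∈ A ∧ (z, i) ∈ A := by
  have h0 := ne_zero_of_root hω
  have h1 := one_sub_ne_zero_of_root h3 hω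
  rcases isSquare_or_isSquare_neg hsq (-((1 - ω) * planeDet (lineRep x) (lineRep y) *
    planeDet (lineRep x) (lineRep z) * planeDet (lineRep y) (lineRep z))) with hs | hs
  · obtain ⟨c, b, s, hs0, hs', rfl, rfl, rfl⟩ := exists_lineChart_base hω h0 h1 hxy hxz hyz hs
    obtain ⟨A, hA, -, h⟩ := exists_overlargeBlocks_of_apex (ω := ω) (c := c) (b := b)
      hs0 hs' (i + 1)
    rw [zmod_two_add_one_add_one] at h
    exact ⟨c, A, hA, h⟩
  · obtain ⟨c, b, s, hs0, hs', rfl, rfl, rfl⟩ :=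
      exists_lineChart_base hω h0 h1 hxy.symm hyz hxz (by
        convert hs using 1
        rw [planeDet_swap (lineRep y) (lineRep x)]
        ring)
    obtain ⟨A, hA, -, h⟩ := exists_overlargeBlocks_of_apex (ω := ω) (c := c) (b := b)
      hs0 hs' (i + 1)
    rw [zmod_two_add_one_add_one] at h
    exact ⟨c, A, hA, h.2.1, h.1, h.2.2⟩

theorem exists_overlargeBlocks_of_level_ne {ω : K} (h3 : (3 : K) ≠ 0) (hω : ω ^ 2 + ω + 1 = 0)
    (hsq : ∀ a : K, a ≠ 0 → (IsSquare a ↔ ¬IsSquare (-a))) (i : ZMod 2) {x y z : Option K}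
    (hxy : x ≠ y) (hxz : x ≠ z) (hyz : y ≠ z) :
    ∃ c, ∃ A ∈ overlargeBlocks ω c, (x, i) ∈ A ∧ (y, i + 1) ∈ A ∧ (z, i + 1) ∈ A := by
  have h0 := ne_zero_of_root hω
  have h1 := one_sub_ne_zero_of_root h3 hω
  rcases isSquare_or_isSquare_neg hsq (ω * (1 - ω) * planeDet (lineRep x) (lineRep y) *
    planeDet (lineRep x) (lineRep z) * planeDet (lineRep y) (lineRep z)) with hs | hs
  · obtain ⟨c, b, s, hs0, hs', rfl, rfl, rfl⟩ := exists_lineChart_apex h0 h1 hxy hxz hyz hs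
    obtain ⟨A, hA, h⟩ := exists_overlargeBlocks_of_apex (ω := ω) (c := c) (b := b) hs0 hs' i
    exact ⟨c, A, hA, h.1, h.2.1, h.2.2.1⟩
  · obtain ⟨c, b, s, hs0, hs', rfl, rfl, rfl⟩ :=
      exists_lineChart_apex h0 h1 hxz hxy hyz.symm (by
        convert hs using 1
        rw [planeDet_swap (lineRep z) (lineRep y)]
        ring)
    obtain ⟨A, hA, h⟩ := exists_overlargeBlocks_of_apex (ω := ω) (c := c) (b := b) hs0 hs' i
    exact ⟨c, A, hA, h.1, h.2.2.1, h.2.1⟩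

theorem existsUnique_overlargeBlocks {ω : K} (h3 : (3 : K) ≠ 0) (hω : ω ^ 2 + ω + 1 = 0)
    (hsq : ∀ a : K, a ≠ 0 → (IsSquare a ↔ ¬IsSquare (-a))) {c x y : Option K} (hx : x ≠ c)
    (hy : y ≠ c) (hxy : x ≠ y) (i j : ZMod 2) :
    ∃! A, A ∈ overlargeBlocks ω c ∧ (x, i) ∈ A ∧ (y, j) ∈ A := by
  obtain ⟨t, rfl⟩ := exists_lineChart_eq hx
  obtain ⟨r, rfl⟩ := exists_lineChart_eq hy
  have htr : t ≠ r := ne_of_apply_ne _ hxy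
  obtain ⟨A, ⟨hA, h1, h2⟩, hu⟩ :=
    existsUnique_apexBlocks h3 hω hsq (x := (t, i)) (y := (r, j)) htr
  simp only [← lineChartEmb_apply]
  refine ⟨_, ⟨⟨A, hA, rfl⟩, (mem_map_prod ..).2 h1, (mem_map_prod ..).2 h2⟩, ?_⟩
  rintro _ ⟨⟨A', hA', rfl⟩, h1', h2'⟩
  rw [mem_map_prod] at h1' h2'
  rw [hu A' ⟨hA', h1', h2'⟩]

theorem transversal_overlargeBlocks {ω : K} (h3 : (3 : K) ≠ 0) (hω : ω ^ 2 + ω + 1 = 0)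
    {c : Option K} {A : Finset (Option K × ZMod 2)} (hA : A ∈ overlargeBlocks ω c)
    {x y : Option K × ZMod 2} (hx : x ∈ A) (hy : y ∈ A) (hxy : x.1 = y.1) : x = y := by
  classical
  obtain ⟨A', ⟨b, s, i, hs, -, hA'⟩, rfl⟩ := hA
  obtain ⟨x', hx', rfl⟩ := Finset.mem_map.1 hx
  obtain ⟨y', hy', rfl⟩ := Finset.mem_map.1 hy
  have h : x' = y' := by
    subst hA'
    exact apexBlock_transversal h3 hω hs hx' hy' ((lineChartEmb c).injective hxy)
  rw [h]

theorem fst_ne_of_mem_overlargeBlocks {ω : K} {c : Option K} {A : Finset (Option K × ZMod 2)}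
    (hA : A ∈ overlargeBlocks ω c) {x : Option K × ZMod 2} (hx : x ∈ A) : x.1 ≠ c := by
  obtain ⟨A', -, rfl⟩ := hA
  obtain ⟨t, -, rfl⟩ := Finset.mem_map.1 hx
  exact lineChart_ne c t.1

theorem overlargeSet_overlargeBlocks {ω : K} (h3 : (3 : K) ≠ 0) (hω : ω ^ 2 + ω + 1 = 0)
    (hsq : ∀ a : K, a ≠ 0 → (IsSquare a ↔ ¬IsSquare (-a))) :
    OverlargeSet Set.univ (overlargeBlocks ω) where
  card_eq := by
    classical
    rintro c - _ ⟨_, ⟨b, s, i, hs, -, rfl⟩, rfl⟩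
    rw [Finset.card_map, card_apexBlock h3 hω hs]
  fst_mem := fun _ _ _ hA _ ha => ⟨trivial, fst_ne_of_mem_overlargeBlocks hA ha⟩
  transversal := fun _ _ _ hA _ hx _ hy hxy => transversal_overlargeBlocks h3 hω hA hx hy hxy
  existsUnique := fun _ _ x y _ _ hx hy hxy =>
    existsUnique_overlargeBlocks h3 hω hsq hx hy hxy x.2 y.2
  triple := by
    rintro ⟨x, i⟩ ⟨y, j⟩ ⟨z, k⟩ - - - hxy hxz hyz
    change x ≠ y at hxy
    change x ≠ z at hxz
    change y ≠ z at hyz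
    by_cases hij : i = j
    · subst hij
      by_cases hik : i = k
      · subst hik
        obtain ⟨c, A, hA, h⟩ :=
          exists_overlargeBlocks_of_level_eq h3 hω hsq i hxy hxz hyz
        exact ⟨c, trivial, A, hA, h⟩
      · obtain rfl := zmod_two_eq_add_one_of_ne (Ne.symm hik)
        obtain ⟨c, A, hA, h⟩ :=
          exists_overlargeBlocks_of_level_ne h3 hω hsq k hxz.symm hyz.symm hxy
        exact ⟨c, trivial, A, hA, h.2.1, h.2.2, h.1⟩
    · obtain rfl := zmod_two_eq_add_one_of_ne hij
      by_cases hik : i = k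
      · subst hik
        obtain ⟨c, A, hA, h⟩ :=
          exists_overlargeBlocks_of_level_ne h3 hω hsq (i + 1) hxy.symm hyz hxz
        rw [zmod_two_add_one_add_one] at h
        exact ⟨c, trivial, A, hA, h.2.1, h.1, h.2.2⟩
      · obtain rfl := zmod_two_eq_add_one_of_ne hik
        obtain ⟨c, A, hA, h⟩ :=
          exists_overlargeBlocks_of_level_ne h3 hω hsq i hxy hxz hyz
        exact ⟨c, trivial, A, hA, h⟩

end OverlargeProjective

section TuranCover

theorem coverNumber_le_card {α : Type*} [Fintype α] [DecidableEq α] {v k t m : ℕ}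
    (hv : Fintype.card α = v) {Bs : Finset (Finset α)} (h : IsCover Finset.univ Bs k t m) :
    coverNumber v k t m ≤ Bs.card := by
  let e := Fintype.equivFinOfCardEq hv
  refine Nat.sInf_le ⟨Bs.map (Finset.mapEmbedding e.toEmbedding).toEmbedding, ⟨?_, ?_⟩,
    Finset.card_map _⟩
  · intro B hB
    obtain ⟨A, hA, rfl⟩ := Finset.mem_map.1 hB
    exact ⟨Finset.subset_univ _, (Finset.card_map _).trans (h.1 A hA).2⟩
  · intro M _ hM
    obtain ⟨A, hA, hMA⟩ := h.2 (M.map e.symm.toEmbedding) (Finset.subset_univ _)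
      ((Finset.card_map _).trans hM)
    refine ⟨_, Finset.mem_map_of_mem _ hA, hMA.trans ?_⟩
    rw [← Finset.card_map e.toEmbedding]
    refine Finset.card_le_card fun x hx => ?_
    obtain ⟨y, hy, rfl⟩ := Finset.mem_map.1 hx
    obtain ⟨hy₁, hy₂⟩ := Finset.mem_inter.1 hy
    obtain ⟨x, hxM, rfl⟩ := Finset.mem_map.1 hy₁
    refine Finset.mem_inter.2 ⟨by simpa using hxM, Finset.mem_map_of_mem _ hy₂⟩

theorem card_blocks_mul_le {α : Type*} [Fintype α] [DecidableEq α] {D : Finset (Finset α)}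
    (h4 : ∀ A ∈ D, A.card = 4)
    (h : ∀ x y : α, x ≠ y → ∀ A ∈ D, ∀ A' ∈ D, x ∈ A → y ∈ A → x ∈ A' → y ∈ A' → A = A') :
    12 * D.card ≤ Fintype.card α * (Fintype.card α - 1) := by
  have hd : (D : Set (Finset α)).PairwiseDisjoint Finset.offDiag := by
    intro A hA A' hA' hne
    refine Finset.disjoint_left.2 fun a ha ha' => hne ?_
    rw [Finset.mem_offDiag] at ha ha'
    exact h a.1 a.2 ha.2.2 A hA A' hA' ha.1 ha.2.1 ha'.1 ha'.2.1
  have hc : (D.biUnion Finset.offDiag).card = D.card * 12 := by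
    rw [Finset.card_biUnion hd, Finset.sum_const_nat]
    intro A hA
    rw [Finset.offDiag_card, h4 A hA]
  have hle : (D.biUnion Finset.offDiag).card ≤ (Finset.univ : Finset α).offDiag.card :=
    Finset.card_le_card (Finset.biUnion_subset.2 fun A _ =>
      Finset.offDiag_mono (Finset.subset_univ A))
  rw [Finset.offDiag_card, Finset.card_univ] at hle
  rw [Nat.mul_sub_one]
  omega

variable {X : Type*} [DecidableEq X]

/-- The union of a block on level `i` and a pair `{x} × ZMod 2` on level `i + 1`. -/
def turanBlock (i : ZMod 3) (x : X) (A : Finset (X × ZMod 2)) : Finset ((X × ZMod 2) × ZMod 3) :=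
  A ×ˢ {i} ∪ ({x} ×ˢ Finset.univ) ×ˢ {i + 1}

theorem mem_turanBlock {i : ZMod 3} {x : X} {A : Finset (X × ZMod 2)}
    {a : (X × ZMod 2) × ZMod 3} :
    a ∈ turanBlock i x A ↔ a.1 ∈ A ∧ a.2 = i ∨ a.1.1 = x ∧ a.2 = i + 1 := by
  simp only [turanBlock, Finset.mem_union, Finset.mem_product, Finset.mem_singleton,
    Finset.mem_univ, and_true]

theorem card_turanBlock (i : ZMod 3) (x : X) (A : Finset (X × ZMod 2)) :
    (turanBlock i x A).card = A.card + 2 := by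
  have hi : i ≠ i + 1 := by revert i; decide
  rw [turanBlock, Finset.card_union_of_disjoint]
  · simp [ZMod.card]
  · refine Finset.disjoint_left.2 fun a ha ha' => hi ?_
    rw [Finset.mem_product, Finset.mem_singleton] at ha ha'
    exact ha.2.symm.trans ha'.2

theorem exists_triple_of_card_eq_four {α : Type*} [DecidableEq α] {M : Finset (α × ZMod 3)}
    (hM : M.card = 4) : ∃ i x y z, x ≠ y ∧ (x, i) ∈ M ∧ (y, i) ∈ M ∧
      ((x ≠ z ∧ y ≠ z ∧ (z, i) ∈ M) ∨ (z, i + 1) ∈ M) := by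
  have hs : ∑ i : ZMod 3, (M.filter fun a => a.2 = i).card = 4 := by
    rw [← hM]
    exact (Finset.card_eq_sum_card_fiberwise fun _ _ => Finset.mem_univ _).symm
  have hi : ∃ i, 2 < (M.filter fun a => a.2 = i).card ∨
      1 < (M.filter fun a => a.2 = i).card ∧ 0 < (M.filter fun a => a.2 = i + 1).card := by
    have hsum : (M.filter fun a => a.2 = 0).card + (M.filter fun a => a.2 = 0 + 1).card +
        (M.filter fun a => a.2 = 0 + 1 + 1).card = 4 := by
      rw [← hs]
      exact (Fin.sum_univ_three fun i : Fin 3 => (M.filter fun a => a.2 = i).card).symm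
    by_contra! h
    have h0 := h 0
    have h1 := h (0 + 1)
    have h2 := h (0 + 1 + 1)
    rw [show (0 + 1 + 1 + 1 : ZMod 3) = 0 by decide] at h2
    omega
  obtain ⟨i, hi | ⟨hi, hj⟩⟩ := hi
  · obtain ⟨⟨x, a⟩, hx, ⟨y, b⟩, hy, ⟨z, c⟩, hz, hxy, hxz, hyz⟩ := Finset.two_lt_card.1 hi
    rw [Finset.mem_filter] at hx hy hz
    obtain ⟨hx, rfl⟩ := hx
    obtain ⟨hy, rfl⟩ := hy
    obtain ⟨hz, rfl⟩ := hz
    exact ⟨_, x, y, z, by simpa using hxy, hx, hy, .inl ⟨by simpa using hxz,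
      by simpa using hyz, hz⟩⟩
  · obtain ⟨⟨x, a⟩, hx, ⟨y, b⟩, hy, hxy⟩ := Finset.one_lt_card.1 hi
    obtain ⟨⟨z, c⟩, hz⟩ := Finset.card_pos.1 hj
    rw [Finset.mem_filter] at hx hy hz
    obtain ⟨hx, rfl⟩ := hx
    obtain ⟨hy, rfl⟩ := hy
    obtain ⟨hz, rfl⟩ := hz
    exact ⟨_, x, y, z, by simpa using hxy, hx, hy, .inr hz⟩

open scoped Classical in
theorem PointedResolution.coverNumber_le [Fintype X] {o : X} {D : X → Set (Finset (X × ZMod 2))}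
    (h : PointedResolution Set.univ o D) (ho : ∃ c, c ≠ o) {v : ℕ}
    (hv : v = 2 * Fintype.card X) : coverNumber (3 * v) 6 3 4 ≤ v ^ 2 * (v - 1) / 8 := by
  obtain ⟨c₀, hc₀⟩ := ho
  obtain ⟨col, hcol⟩ : ∃ col : X → X, col = fun x => if x = o then c₀ else x := ⟨_, rfl⟩
  have hne : ∀ x, col x ≠ o := by
    intro x
    rw [hcol]
    by_cases hx : x = o <;> simp [hx, hc₀]
  have hsurj : ∀ c, c ≠ o → col c = c := by
    intro c hc
    simp [hcol, hc]
  obtain ⟨Bs, hBs⟩ : ∃ Bs : Finset (Finset ((X × ZMod 2) × ZMod 3)),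
      Bs = (Finset.univ : Finset (ZMod 3 × X)).biUnion fun a =>
        (D (col a.2)).toFinset.image (turanBlock a.1 a.2) := ⟨_, rfl⟩
  have hmem : ∀ i x, ∀ A ∈ D (col x), turanBlock i x A ∈ Bs := by
    intro i x A hA
    rw [hBs]
    exact Finset.mem_biUnion.2 ⟨(i, x), Finset.mem_univ _,
      Finset.mem_image_of_mem _ (Set.mem_toFinset.2 hA)⟩
  have hV : Fintype.card (X × ZMod 2) = v := by
    rw [Fintype.card_prod, ZMod.card, hv, mul_comm]
  have hcover : IsCover Finset.univ Bs 6 3 4 := by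
    refine ⟨fun B hB => ⟨Finset.subset_univ _, ?_⟩, fun M _ hM => ?_⟩
    · rw [hBs] at hB
      obtain ⟨a, -, ha⟩ := Finset.mem_biUnion.1 hB
      obtain ⟨A, hA, rfl⟩ := Finset.mem_image.1 ha
      rw [card_turanBlock, h.card_eq _ trivial (hne _) A (Set.mem_toFinset.1 hA)]
    · obtain ⟨i, x, y, z, hxy, hx, hy, hz⟩ := exists_triple_of_card_eq_four hM
      rcases hz with ⟨hxz, hyz, hz⟩ | hz
      · obtain ⟨c, -, hc, A, hA, hxA, hyA, hzA⟩ :=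
          h.triple x y z trivial trivial trivial hxy hxz hyz
        refine ⟨_, hmem i c A (by rwa [hsurj c hc]), Finset.two_lt_card.2
          ⟨(x, i), ?_, (y, i), ?_, (z, i), ?_, ?_⟩⟩ <;>
          simp [mem_turanBlock, *]
      · obtain ⟨A, ⟨hA, hxA, hyA⟩, -⟩ :=
          h.existsUnique (col z.1) trivial (hne _) x y trivial trivial hxy
        have hi : ∀ i : ZMod 3, i ≠ i + 1 := by decide
        refine ⟨_, hmem i z.1 A hA, Finset.two_lt_card.2
          ⟨(x, i), ?_, (y, i), ?_, (z, i + 1), ?_, ?_⟩⟩ <;>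
          simp [mem_turanBlock, *]
  have hD : ∀ x, 12 * (D (col x)).toFinset.card ≤ v * (v - 1) := by
    intro x
    rw [← hV]
    refine card_blocks_mul_le (fun A hA => h.card_eq _ trivial (hne x) A (Set.mem_toFinset.1 hA)) ?_
    intro a b hab A hA A' hA' h1 h2 h3 h4
    exact (h.existsUnique _ trivial (hne x) a b trivial trivial hab).unique
      ⟨Set.mem_toFinset.1 hA, h1, h2⟩ ⟨Set.mem_toFinset.1 hA', h3, h4⟩
  have hcard : 12 * Bs.card ≤ (3 * Fintype.card X) * (v * (v - 1)) := by
    calc 12 * Bs.card ≤ 12 * ∑ a : ZMod 3 × X, (D (col a.2)).toFinset.card := by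
          rw [hBs]
          exact Nat.mul_le_mul_left _ (Finset.card_biUnion_le.trans
            (Finset.sum_le_sum fun a _ => Finset.card_image_le))
      _ = ∑ a : ZMod 3 × X, 12 * (D (col a.2)).toFinset.card := Finset.mul_sum ..
      _ ≤ ∑ _a : ZMod 3 × X, v * (v - 1) := Finset.sum_le_sum fun a _ => hD a.2
      _ = (3 * Fintype.card X) * (v * (v - 1)) := by
          rw [Finset.sum_const, Finset.card_univ, Fintype.card_prod, ZMod.card, smul_eq_mul]
  refine (coverNumber_le_card ?_ hcover).trans ?_
  · rw [Fintype.card_prod, hV, ZMod.card, mul_comm]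
  · rw [Nat.le_div_iff_mul_le (by norm_num)]
    have : 3 * (Bs.card * 8) ≤ 3 * (v ^ 2 * (v - 1)) := by
      calc 3 * (Bs.card * 8) = 2 * (12 * Bs.card) := by ring
        _ ≤ 2 * ((3 * Fintype.card X) * (v * (v - 1))) := Nat.mul_le_mul_left _ hcard
        _ = 3 * ((2 * Fintype.card X) * v * (v - 1)) := by ring
        _ = 3 * (v ^ 2 * (v - 1)) := by rw [← hv, sq]
    omega

end TuranCover

section Instances

theorem cube_injective_of_card {F : Type*} [Field F] [Finite F] {m : ℕ} (hm : Odd m)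
    (hF : Nat.card F = 2 ^ m) : Function.Injective fun x : F => x ^ 3 := by
  have hcop : (Nat.card Fˣ).Coprime 3 := by
    rw [Nat.card_units, hF, Nat.coprime_comm, Nat.Prime.coprime_iff_not_dvd Nat.prime_three]
    obtain ⟨k, rfl⟩ := hm
    have h4 : 4 ^ k % 3 = 1 := by
      rw [Nat.pow_mod]
      simp
    have h2 : 2 ^ (2 * k + 1) = 4 ^ k * 2 := by rw [pow_succ, pow_mul]; rfl
    rw [h2]
    omega
  intro x y hxy
  change x ^ 3 = y ^ 3 at hxy
  by_cases hx : x = 0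
  · subst hx
    rw [zero_pow three_ne_zero] at hxy
    exact (eq_zero_of_pow_eq_zero hxy.symm).symm
  · have hy : y ≠ 0 := by
      rintro rfl
      rw [zero_pow three_ne_zero] at hxy
      exact hx (eq_zero_of_pow_eq_zero hxy)
    have : Units.mk0 x hx = Units.mk0 y hy := by
      apply (powCoprime hcop).injective
      ext
      simpa using hxy
    exact congrArg Units.val this

theorem exists_pointedResolution_galoisField {m : ℕ} (hm : Odd m) :
    ∃ D, PointedResolution Set.univ (0 : GaloisField 2 m) D := by
  have hF := GaloisField.card 2 m (by rintro rfl; simp at hm)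
  exact ⟨_, pointedResolution_bakerBlocks
    (by exact_mod_cast CharP.cast_eq_zero (GaloisField 2 m) 2) (cube_injective_of_card hm hF)⟩

theorem exists_pointedResolution_of_range {Y X : Type*} [Finite Y] {m : ℕ} (hm : Odd m)
    (hY : Nat.card Y = 2 ^ m) {B : Set X} {o : X} (ho : o ∈ B) {e : Y ↪ X}
    (he : Set.range e = B) : ∃ D, PointedResolution B o D := by
  classical
  obtain ⟨D, hD⟩ := exists_pointedResolution_galoisField hm
  subst he
  obtain ⟨y, rfl⟩ := ho
  have hF := GaloisField.card 2 m (by rintro rfl; simp at hm)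
  obtain ⟨f⟩ : Nonempty (GaloisField 2 m ≃ Y) := Finite.card_eq.1 (hF.trans hY.symm)
  let g : GaloisField 2 m ≃ Y := f.trans (Equiv.swap (f 0) y)
  have hg : g 0 = y := Equiv.swap_apply_left _ _
  have := hD.map (g.toEmbedding.trans e)
  have hr : Set.range (g.toEmbedding.trans e) = Set.range e := g.surjective.range_comp e
  have h0 : (g.toEmbedding.trans e) 0 = e y := congrArg e hg
  rw [hr, h0] at this
  exact ⟨_, this⟩

theorem isSquare_iff_not_isSquare_neg {p : ℕ} [Fact p.Prime] (hp : p % 4 = 3) (a : ZMod p)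
    (ha : a ≠ 0) : IsSquare a ↔ ¬IsSquare (-a) := by
  have hchar : ringChar (ZMod p) ≠ 2 := by
    rw [ZMod.ringChar_zmod_n]
    omega
  have h1 : quadraticChar (ZMod p) (-1) = -1 := by
    rw [quadraticChar_neg_one_iff_not_isSquare, ZMod.exists_sq_eq_neg_one_iff]
    simpa using hp
  have h2 : quadraticChar (ZMod p) (-a) = -quadraticChar (ZMod p) a := by
    rw [← neg_one_mul, map_mul, h1, neg_one_mul]
  rw [← quadraticChar_neg_one_iff_not_isSquare, h2, neg_inj, quadraticChar_one_iff_isSquare ha]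

theorem exists_pointedResolution_option_galoisField {p m n : ℕ} [Fact p.Prime]
    (hm : Odd m) (hp : p + 1 = 2 ^ m) (hp4 : p % 4 = 3) (hp3 : (3 : ZMod p) ≠ 0)
    {ω : ZMod p} (hω : ω ^ 2 + ω + 1 = 0) :
    ∃ D, PointedResolution Set.univ (none : Option (GaloisField p n)) D := by
  have hK : Nat.card (Option (ZMod p)) = 2 ^ m := by
    rw [Finite.card_option, Nat.card_zmod, hp]
  have hD : ∀ B, ∃ D, B ∈ sphericalBlocks (ZMod p) (GaloisField p n) → none ∈ B →
      PointedResolution B none D := by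
    intro B
    by_cases h : B ∈ sphericalBlocks (ZMod p) (GaloisField p n) ∧ none ∈ B
    · obtain ⟨e, he⟩ := exists_embedding_range_eq h.1
      obtain ⟨D, hD⟩ := exists_pointedResolution_of_range hm hK h.2 he
      exact ⟨D, fun _ _ => hD⟩
    · exact ⟨fun _ => ∅, fun h1 h2 => absurd ⟨h1, h2⟩ h⟩
  have hG : ∀ B, ∃ G, B ∈ sphericalBlocks (ZMod p) (GaloisField p n) → OverlargeSet B G := by
    intro B
    by_cases h : B ∈ sphericalBlocks (ZMod p) (GaloisField p n)
    · obtain ⟨e, rfl⟩ := exists_embedding_range_eq h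
      exact ⟨_, fun _ => (overlargeSet_overlargeBlocks hp3 hω
        (isSquare_iff_not_isSquare_neg hp4)).map e⟩
    · exact ⟨fun _ => ∅, fun h1 => absurd h1 h⟩
  choose D hD using hD
  choose G hG using hG
  refine ⟨_, PointedResolution.compose isThreeDesign_sphericalBlocks none ?_ hD hG⟩
  rintro (_ | x)
  · exact ⟨some 0, by simp, by simp⟩
  · obtain ⟨y, hy⟩ := exists_ne x
    exact ⟨some y, by simpa using hy, by simp⟩

theorem coverNumber_le_of_prime {p m n : ℕ} (hp : p.Prime) (hn : n ≠ 0)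
    (hm : Odd m) (hpm : p + 1 = 2 ^ m) (hp4 : p % 4 = 3) (hp3 : (3 : ZMod p) ≠ 0)
    {ω : ZMod p} (hω : ω ^ 2 + ω + 1 = 0) {v : ℕ} (hv : v = 2 * p ^ n + 2) :
    coverNumber (3 * v) 6 3 4 ≤ v ^ 2 * (v - 1) / 8 := by
  classical
  have := Fact.mk hp
  obtain ⟨D, hD⟩ := exists_pointedResolution_option_galoisField (n := n) hm hpm hp4 hp3 hω
  have := Fintype.ofFinite (GaloisField p n)
  refine hD.coverNumber_le ⟨some 0, by simp⟩ ?_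
  rw [Fintype.card_option, ← Nat.card_eq_fintype_card, GaloisField.card p n hn, hv]
  ring

theorem coverNumber_le_of_four_pow {n v : ℕ} (hn : 0 < n) (hv : v = 4 ^ n) :
    coverNumber (3 * v) 6 3 4 ≤ v ^ 2 * (v - 1) / 8 := by
  classical
  obtain ⟨k, rfl⟩ : ∃ k, n = k + 1 := ⟨n - 1, by omega⟩
  obtain ⟨D, hD⟩ := exists_pointedResolution_galoisField (m := 2 * k + 1) ⟨k, rfl⟩
  have := Fintype.ofFinite (GaloisField 2 (2 * k + 1))
  refine hD.coverNumber_le ⟨1, one_ne_zero⟩ ?_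
  rw [← Nat.card_eq_fintype_card, GaloisField.card 2 _ (by omega), hv, pow_succ 2, pow_mul,
    pow_succ]
  ring

end Instances

/-- If `v = 4^n` or `v = 2p^n + 2` with `p ∈ {7,31,127}` (where `n ≥ 1`), then
`C(3v, 6, 3, 4) ≤ v²(v-1)/8` (the right-hand side is an exact division). -/
theorem bound_634 (n v : ℕ) (hn : 0 < n)
    (hv : v = 4 ^ n ∨ ∃ p ∈ ({7, 31, 127} : Finset ℕ), v = 2 * p ^ n + 2) :
    coverNumber (3 * v) 6 3 4 ≤ v ^ 2 * (v - 1) / 8 := by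
  rcases hv with hv | ⟨p, hp, hv⟩
  · exact coverNumber_le_of_four_pow hn hv
  · simp only [Finset.mem_insert, Finset.mem_singleton] at hp
    rcases hp with rfl | rfl | rfl
    · exact coverNumber_le_of_prime (m := 3) (ω := 2) (by norm_num) hn.ne' (by decide)
        (by norm_num) (by norm_num) (by decide) (by decide) hv
    · exact coverNumber_le_of_prime (m := 5) (ω := 5) (by norm_num) hn.ne' (by decide)
        (by norm_num) (by norm_num) (by decide) (by decide) hv
    · exact coverNumber_le_of_prime (m := 7) (ω := 19) (by norm_num) hn.ne' (by decide)
        (by norm_num) (by norm_num) (by decide) (by decide) hv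
end
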